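/- For every integer d ≥ 3 there is a constant C = C(d) with the following property. Let H be a finite collection of n hyperplanes in ℝ^d, let r be a real number with 2 ≤ r ≤ n, and let K₀ ⊆ ℝ^d be a convex set with frontier σ. Then there exists a finite family Ξ of at most C·r^{d−1}·log₂ r closed convex sets, each a nonempty intersection of at most d+1 closed halfspaces, with pairwise disjoint interiors, such that: (a) the union of the members of Ξ contains every connected component of ℝ^d ∖ ⋃H whose closure meets σ, and (b) for each Δ ∈ Ξ, the number of hyperplanes of H that intersect the interior of Δ is at most n/r. (Cutting Lemma for the zone of a convex set, d ≥ 3.) -/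

import Mathlib

open scoped RealInnerProductSpace
open scoped Classical

noncomputable section

/-- A closed halfspace in `ℝ^d`. -/
def halfspace {d : ℕ} (a : EuclideanSpace ℝ (Fin d)) (b : ℝ) : Set (EuclideanSpace ℝ (Fin d)) :=
  {x | ⟪x, a⟫ ≤ b}

/-- A hyperplane in `ℝ^d`. -/
def hyperplane {d : ℕ} (a : EuclideanSpace ℝ (Fin d)) (b : ℝ) : Set (EuclideanSpace ℝ (Fin d)) :=
  {x | ⟪x, a⟫ = b}

/-- A point `p` of a finite set `P` is `k`-shallow if some closed halfspace contains `p`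
and at most `k` points of `P` (including `p`). -/
def IsShallowPt {d : ℕ} (P : Finset (EuclideanSpace ℝ (Fin d))) (k : ℕ)
    (p : EuclideanSpace ℝ (Fin d)) : Prop :=
  ∃ a b, a ≠ 0 ∧ p ∈ halfspace a b ∧
    ((P : Set (EuclideanSpace ℝ (Fin d))) ∩ halfspace a b).ncard ≤ k

/-- `P` is in general position: no `d+1` points of `P` lie on a common hyperplane. -/
def GenPos {d : ℕ} (P : Finset (EuclideanSpace ℝ (Fin d))) : Prop :=
  ∀ (a : EuclideanSpace ℝ (Fin d)) (b : ℝ), a ≠ 0 →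
    ((P : Set (EuclideanSpace ℝ (Fin d))) ∩ hyperplane a b).ncard ≤ d

namespace ZoneCutting

open Finset Filter Topology

/-- Points of `ℝ^d`. -/
abbrev Pt (d : ℕ) := EuclideanSpace ℝ (Fin d)

/-! ### The lexicographic order -/

/-- The first nonzero coordinate of `x` exists and is positive. -/
def LexPos {d : ℕ} (x : Pt d) : Prop := ∃ i, 0 < x i ∧ ∀ j < i, x j = 0

variable {d : ℕ}

lemma LexPos.add {x y : Pt d} (hx : LexPos x) (hy : LexPos y) : LexPos (x + y) := by
  obtain ⟨i, hi, hi'⟩ := hx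
  obtain ⟨j, hj, hj'⟩ := hy
  rcases lt_trichotomy i j with h | h | h
  · exact ⟨i, by simp [hj' i h, hi], fun k hk => by simp [hi' k hk, hj' k (hk.trans h)]⟩
  · subst h
    exact ⟨i, by simpa using add_pos hi hj, fun k hk => by simp [hi' k hk, hj' k hk]⟩
  · exact ⟨j, by simp [hi' j h, hj], fun k hk => by simp [hi' k (hk.trans h), hj' k hk]⟩

lemma LexPos.smul {x : Pt d} (hx : LexPos x) {c : ℝ} (hc : 0 < c) : LexPos (c • x) := by
  obtain ⟨i, hi, hi'⟩ := hx
  exact ⟨i, by simpa using mul_pos hc hi, fun k hk => by simp [hi' k hk]⟩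

lemma not_lexPos_zero : ¬ LexPos (0 : Pt d) := by
  rintro ⟨i, hi, -⟩
  simp at hi

lemma LexPos.not_neg {x : Pt d} (hx : LexPos x) : ¬ LexPos (-x) := fun h =>
  not_lexPos_zero (by simpa using hx.add h)

lemma lexPos_or_neg {x : Pt d} (hx : x ≠ 0) : LexPos x ∨ LexPos (-x) := by
  have hne : (univ.filter fun i => x i ≠ 0).Nonempty := by
    by_contra h
    apply hx
    ext i
    by_contra hi
    exact h ⟨i, by simpa using hi⟩
  set i := (univ.filter fun i => x i ≠ 0).min' hne with hi
  have hxi : x i ≠ 0 := by simpa using (mem_filter.1 (min'_mem _ hne)).2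
  have hlt : ∀ j < i, x j = 0 := by
    intro j hj
    by_contra h
    exact absurd (min'_le (univ.filter fun i => x i ≠ 0) j (by simpa using h)) (not_le.2 hj)
  rcases lt_or_gt_of_ne hxi with h | h
  · exact Or.inr ⟨i, by simpa using h, fun j hj => by simp [hlt j hj]⟩
  · exact Or.inl ⟨i, h, hlt⟩

/-- `w` is the lexicographic minimum of `s`. -/
def IsLexMin (s : Set (Pt d)) (w : Pt d) : Prop := w ∈ s ∧ ∀ y ∈ s, y ≠ w → LexPos (y - w)

/-- `w` is the lexicographic maximum of `s`. -/
def IsLexMax (s : Set (Pt d)) (w : Pt d) : Prop := w ∈ s ∧ ∀ y ∈ s, y ≠ w → LexPos (w - y)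

lemma IsLexMin.unique {s : Set (Pt d)} {v w : Pt d} (hv : IsLexMin s v) (hw : IsLexMin s w) :
    v = w := by
  by_contra h
  exact (hv.2 w hw.1 (Ne.symm h)).not_neg (by simpa using hw.2 v hv.1 h)

lemma IsLexMax.unique {s : Set (Pt d)} {v w : Pt d} (hv : IsLexMax s v) (hw : IsLexMax s w) :
    v = w := by
  by_contra h
  exact (hv.2 w hw.1 (Ne.symm h)).not_neg (by simpa using hw.2 v hv.1 h)

lemma exists_isLexMin {s : Set (Pt d)} (hs : IsCompact s) (hne : s.Nonempty) :
    ∃ w, IsLexMin s w := by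
  have key : ∀ k ≤ d, ∃ w, ∃ S : Set (Pt d), IsCompact S ∧ w ∈ S ∧ S ⊆ s ∧
      (∀ y ∈ S, ∀ i : Fin d, (i : ℕ) < k → y i = w i) ∧
      ∀ y ∈ s, y ∉ S → ∃ i : Fin d, (i : ℕ) < k ∧ 0 < (y - w) i ∧ ∀ j < i, (y - w) j = 0 := by
    intro k
    induction k with
    | zero =>
      intro _
      obtain ⟨w, hw⟩ := hne
      exact ⟨w, s, hs, hw, subset_rfl, by simp, fun y hy h => absurd hy h⟩
    | succ k ih =>
      intro hk
      obtain ⟨w, S, hS, hwS, hSs, heq, hlt⟩ := ih (by omega)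
      set i₀ : Fin d := ⟨k, by omega⟩
      have hcont : Continuous fun y : Pt d => y i₀ := by fun_prop
      obtain ⟨w', hw'S, hmin⟩ := hS.exists_isMinOn ⟨w, hwS⟩ hcont.continuousOn
      refine ⟨w', S ∩ {y | y i₀ = w' i₀}, hS.inter_right (isClosed_eq hcont
        continuous_const), ⟨hw'S, rfl⟩, fun y hy => hSs hy.1, ?_, ?_⟩
      · rintro y ⟨hy, hy'⟩ i hi
        rcases Nat.lt_succ_iff_lt_or_eq.1 hi with h | h
        · rw [heq y hy i h, heq w' hw'S i h]
        · have : i = i₀ := Fin.ext h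
          rw [this]; exact hy'
      · intro y hy hyS
        by_cases h : y ∈ S
        · have hne : y i₀ ≠ w' i₀ := fun h' => hyS ⟨h, h'⟩
          refine ⟨i₀, Nat.lt_succ_self k, ?_, ?_⟩
          · simpa using lt_of_le_of_ne (hmin h) (Ne.symm hne)
          · intro j hj
            simp [heq y h j hj, heq w' hw'S j hj]
        · obtain ⟨i, hik, hi, hi'⟩ := hlt y hy h
          refine ⟨i, Nat.lt_succ_of_lt hik, ?_, ?_⟩
          · simpa [heq w' hw'S i hik] using hi
          · intro j hj
            have := hi' j hj
            simpa [heq w' hw'S j (lt_trans (by exact_mod_cast hj) hik)] using this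
  obtain ⟨w, S, -, hwS, hSs, heq, hlt⟩ := key d le_rfl
  refine ⟨w, hSs hwS, fun y hy hne => ?_⟩
  obtain ⟨i, -, h⟩ := hlt y hy fun h => hne (by ext i; exact heq y h i i.2)
  exact ⟨i, h⟩

/-! ### Families of affine functionals and their faces -/

variable {κ : Type*}

/-- The affine functional whose zero set is the `i`-th hyperplane of the family. -/
def ev (h : κ → Pt d × ℝ) (i : κ) (x : Pt d) : ℝ := ⟪x, (h i).1⟫ - (h i).2

/-- The closed face, on the flat of the hyperplanes in `T`, of the cell of the arrangement of the
hyperplanes in `R` on whose positive side are exactly those in `Q`. -/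
def face (h : κ → Pt d × ℝ) (R T Q : Finset κ) : Set (Pt d) :=
  {x | (∀ i ∈ T, ev h i x = 0) ∧
    ∀ i ∈ R, (i ∈ Q → 0 ≤ ev h i x) ∧ (i ∉ Q → ev h i x ≤ 0)}

/-- The hyperplanes of `R` through `x`. -/
def zeros (h : κ → Pt d × ℝ) (R : Finset κ) (x : Pt d) : Finset κ :=
  R.filter fun i => ev h i x = 0

/-- The hyperplanes of `R` with `x` strictly on the positive side. -/
def signs (h : κ → Pt d × ℝ) (R : Finset κ) (x : Pt d) : Finset κ :=
  R.filter fun i => 0 < ev h i x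

variable (h : κ → Pt d × ℝ)

@[simp] lemma mem_zeros {R : Finset κ} {x : Pt d} {i : κ} :
    i ∈ zeros h R x ↔ i ∈ R ∧ ev h i x = 0 := by simp [zeros]

@[simp] lemma mem_signs {R : Finset κ} {x : Pt d} {i : κ} :
    i ∈ signs h R x ↔ i ∈ R ∧ 0 < ev h i x := by simp [signs]

lemma zeros_subset (R : Finset κ) (x : Pt d) : zeros h R x ⊆ R := filter_subset _ _

lemma ev_add_smul (i : κ) (x e : Pt d) (t : ℝ) :
    ev h i (x + t • e) = ev h i x + t * ⟪e, (h i).1⟫ := by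
  simp [ev, inner_add_left, real_inner_smul_left]; ring

lemma continuous_ev (i : κ) : Continuous (ev h i) := by
  unfold ev; fun_prop

/-- `ev` on an affine combination. -/
lemma ev_combo (i : κ) (x y : Pt d) {a b : ℝ} (hab : a + b = 1) :
    ev h i (a • x + b • y) = a * ev h i x + b * ev h i y := by
  have : (h i).2 = a * (h i).2 + b * (h i).2 := by rw [← add_mul, hab, one_mul]
  simp only [ev, inner_add_left, real_inner_smul_left]
  linear_combination -this

lemma ev_sum {α : Type*} (s : Finset α) (c : α → ℝ) (v : α → Pt d) (hc : ∑ k ∈ s, c k = 1)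
    (i : κ) : ev h i (∑ k ∈ s, c k • v k) = ∑ k ∈ s, c k * ev h i (v k) := by
  simp only [ev, sum_inner, real_inner_smul_left, mul_sub, sum_sub_distrib, ← sum_mul, hc, one_mul]

lemma face_convex (R T Q : Finset κ) : Convex ℝ (face h R T Q) := by
  intro x hx y hy a b ha hb hab
  refine ⟨fun i hi => ?_, fun i hi => ⟨fun hq => ?_, fun hq => ?_⟩⟩
  · rw [ev_combo h i x y hab, hx.1 i hi, hy.1 i hi]; ring
  · rw [ev_combo h i x y hab]
    have := (hx.2 i hi).1 hq
    have := (hy.2 i hi).1 hq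
    positivity
  · rw [ev_combo h i x y hab]
    have h1 := (hx.2 i hi).2 hq
    have h2 := (hy.2 i hi).2 hq
    nlinarith

lemma face_closed (R T Q : Finset κ) : IsClosed (face h R T Q) := by
  have : face h R T Q = (⋂ i ∈ T, {x | ev h i x = 0}) ∩
      ⋂ i ∈ R, ((⋂ _ : i ∈ Q, {x | 0 ≤ ev h i x}) ∩ ⋂ _ : i ∉ Q, {x | ev h i x ≤ 0}) := by
    ext x; simp [face]
  rw [this]
  have hc := continuous_ev h
  refine IsClosed.inter (isClosed_biInter fun i _ => isClosed_eq (hc i) continuous_const)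
    (isClosed_biInter fun i _ => IsClosed.inter (isClosed_iInter fun _ =>
      isClosed_le continuous_const (hc i)) (isClosed_iInter fun _ =>
      isClosed_le (hc i) continuous_const))

lemma eventually_mem_face {R T Q : Finset κ} {w e : Pt d} (hw : w ∈ face h R T Q)
    (heT : ∀ i ∈ T, ⟪e, (h i).1⟫ = 0)
    (he : ∀ i ∈ zeros h R w, (i ∈ Q → 0 ≤ ⟪e, (h i).1⟫) ∧ (i ∉ Q → ⟪e, (h i).1⟫ ≤ 0)) :
    ∀ᶠ t in 𝓝[>] (0 : ℝ), w + t • e ∈ face h R T Q := by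
  have hR : ∀ᶠ t in 𝓝[>] (0 : ℝ), ∀ i ∈ R, (i ∈ Q → 0 ≤ ev h i (w + t • e)) ∧
      (i ∉ Q → ev h i (w + t • e) ≤ 0) := by
    rw [Filter.eventually_all_finset]
    intro i hi
    have hlim : Tendsto (fun t : ℝ => ev h i (w + t • e)) (𝓝[>] 0) (𝓝 (ev h i w)) := by
      have : Continuous fun t : ℝ => ev h i (w + t • e) := by
        simp only [ev_add_smul]; fun_prop
      simpa using (this.tendsto 0).mono_left nhdsWithin_le_nhds
    by_cases h0 : ev h i w = 0
    · filter_upwards [self_mem_nhdsWithin] with t (ht : 0 < t)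
      have := he i (by simp [hi, h0])
      rw [ev_add_smul, h0, zero_add]
      exact ⟨fun hq => mul_nonneg ht.le (this.1 hq),
        fun hq => mul_nonpos_of_nonneg_of_nonpos ht.le (this.2 hq)⟩
    · by_cases hq : i ∈ Q
      · have : 0 < ev h i w := lt_of_le_of_ne ((hw.2 i hi).1 hq) (Ne.symm h0)
        filter_upwards [hlim.eventually_const_lt this] with t ht
        exact ⟨fun _ => ht.le, fun h => absurd hq h⟩
      · have : ev h i w < 0 := lt_of_le_of_ne ((hw.2 i hi).2 hq) h0
        filter_upwards [hlim.eventually_lt_const this] with t ht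
        exact ⟨fun h => absurd h hq, fun _ => ht.le⟩
  filter_upwards [hR] with t ht
  refine ⟨fun i hi => ?_, ht⟩
  rw [ev_add_smul, hw.1 i hi, heT i hi]; simp

/-- A vector orthogonal to fewer than `d` given vectors. -/
lemma exists_orthogonal (D : Finset κ) (hD : D.card < d) :
    ∃ e : Pt d, e ≠ 0 ∧ ∀ i ∈ D, ⟪e, (h i).1⟫ = 0 := by
  set W : Submodule ℝ (Pt d) :=
    Submodule.span ℝ ((D.image fun i => (h i).1 : Finset (Pt d)) : Set (Pt d))
  have hW : Module.finrank ℝ W < d :=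
    ((finrank_span_finset_le_card _).trans card_image_le).trans_lt hD
  have hW' : 0 < Module.finrank ℝ Wᗮ := by
    have := W.finrank_add_finrank_orthogonal
    rw [finrank_euclideanSpace_fin] at this
    omega
  have : Nontrivial Wᗮ := Module.finrank_pos_iff.1 hW'
  obtain ⟨e, he⟩ := exists_ne (0 : Wᗮ)
  refine ⟨e, by simpa using he, fun i hi => ?_⟩
  rw [real_inner_comm]
  exact e.2 _ (Submodule.subset_span (by simpa using ⟨i, hi, rfl⟩))

/-- Prescribing inner products with linearly independent vectors. -/
lemma exists_inner_eq {D : Finset κ} (hD : LinearIndependent ℝ fun i : D => (h i).1) (c : κ → ℝ) :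
    ∃ e : Pt d, ∀ i ∈ D, ⟪e, (h i).1⟫ = c i := by
  obtain ⟨φ, hφ⟩ := (Module.Basis.span hD).constr ℝ (fun i : D => c i) |>.exists_extend
  refine ⟨(InnerProductSpace.toDual ℝ (Pt d)).symm (LinearMap.toContinuousLinearMap φ),
    fun i hi => ?_⟩
  rw [InnerProductSpace.toDual_symm_apply, LinearMap.coe_toContinuousLinearMap']
  have h1 : φ (Module.Basis.span hD ⟨i, hi⟩ : Pt d) = c i := by
    have := congrArg (fun f => f (Module.Basis.span hD ⟨i, hi⟩)) hφ
    simpa only [LinearMap.comp_apply, Submodule.subtype_apply, Module.Basis.constr_basis] using this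
  rwa [Module.Basis.span_apply] at h1

variable [Fintype κ]

/-- General position. -/
structure Generic (h : κ → Pt d × ℝ) : Prop where
  indep : ∀ D : Finset κ, D.card ≤ d → LinearIndependent ℝ fun i : D => (h i).1
  card_zeros : ∀ x, (zeros h univ x).card ≤ d

lemma card_zeros_le {h : κ → Pt d × ℝ} (hG : Generic h) (R : Finset κ) (x : Pt d) :
    (zeros h R x).card ≤ d :=
  (card_le_card fun i hi => by simp_all).trans (hG.card_zeros x)

/-- The lexicographic minimum of a face is a vertex. -/
lemma card_zeros_of_isLexMin {h : κ → Pt d × ℝ} (hG : Generic h) {R T Q : Finset κ} (hT : T ⊆ R)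
    {w : Pt d} (hw : IsLexMin (face h R T Q) w) : (zeros h R w).card = d := by
  refine le_antisymm (card_zeros_le hG R w) ?_
  by_contra hlt
  obtain ⟨e, he0, he⟩ := exists_orthogonal h _ (not_le.1 hlt)
  have main : ∀ e : Pt d, (∀ i ∈ zeros h R w, ⟪e, (h i).1⟫ = 0) → ¬ LexPos (-e) := by
    intro e he hneg
    have hev := eventually_mem_face h hw.1 (e := e)
      (fun i hi => he i (by simp [hT hi, hw.1.1 i hi])) (fun i hi => by simp [he i hi])
    obtain ⟨t, ht, ht0 : 0 < t⟩ := (hev.and self_mem_nhdsWithin).exists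
    have hne : w + t • e ≠ w := by
      intro h'
      have : t • e = 0 := by simpa using h'
      rcases smul_eq_zero.1 this with h | h
      · exact ht0.ne' h
      · exact not_lexPos_zero (by simpa [h] using hneg)
    have := hw.2 _ ht hne
    rw [add_sub_cancel_left] at this
    exact this.not_neg (by simpa using hneg.smul ht0)
  rcases lexPos_or_neg he0 with h | h
  · exact main (-e) (fun i hi => by simp [he i hi]) (by simpa using h)
  · exact main e he h

section

variable {d : ℕ} {κ : Type*}

/-! ### The number of cells crossed by the boundary of a convex set -/

/-- The flat cut out by the hyperplanes in `Z`. -/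
def flat (h : κ → Pt d × ℝ) (Z : Finset κ) : Set (Pt d) := {x | ∀ i ∈ Z, ev h i x = 0}

lemma mem_face_signs (h : κ → Pt d × ℝ) (R : Finset κ) (x : Pt d) :
    x ∈ face h R ∅ (signs h R x) := by
  refine ⟨by simp, fun i hi => ⟨fun hq => ?_, fun hq => ?_⟩⟩
  · exact ((mem_signs h).1 hq).2.le
  · simp only [mem_signs, hi, true_and, not_lt] at hq
    exact hq

/-- `w` is a lexicographically extreme point of the intersection of `A` with its flat. -/
def IsExtremeAt (h : κ → Pt d × ℝ) (R : Finset κ) (A : Set (Pt d)) (w : Pt d) (top : Bool) : Prop :=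
  if top then IsLexMax (flat h (zeros h R w) ∩ A) w else IsLexMin (flat h (zeros h R w) ∩ A) w

lemma eventually_smul_mem {U : Set (Pt d)} {w e : Pt d} (hU : U ∈ 𝓝 w) :
    ∀ᶠ t in 𝓝[>] (0 : ℝ), w + t • e ∈ U := by
  have : Continuous fun t : ℝ => w + t • e := by fun_prop
  have h := (this.tendsto 0)
  simp only [zero_smul, add_zero] at h
  exact (h.mono_left nhdsWithin_le_nhds).eventually hU

lemma eventually_lt_one : ∀ᶠ t in 𝓝[>] (0 : ℝ), 0 < t ∧ t < 1 :=
  Filter.eventually_of_mem (Ioo_mem_nhdsGT one_pos) fun _ ht => ht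

variable [Fintype κ]

/-- A cell meeting both the interior and the complement of a closed convex set `A` has on its
boundary a point which is extreme on its flat. -/
lemma exists_isExtremeAt {h : κ → Pt d × ℝ} (hG : Generic h) {R Q : Finset κ}
    (hc : IsCompact (face h R ∅ Q)) {A : Set (Pt d)} (hA : IsClosed A) (hA' : Convex ℝ A)
    (hvert : ∀ w, (zeros h R w).card = d → w ∉ frontier A) {x y : Pt d} (hx : x ∈ face h R ∅ Q)
    (hxA : x ∈ interior A) (hy : y ∈ face h R ∅ Q) (hyA : y ∉ A) :
    ∃ w ∈ face h R ∅ Q, (zeros h R w).card < d ∧ ∃ top, IsExtremeAt h R A w top := by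
  have hcard : ∀ w, w ∈ A → w ∉ interior A → (zeros h R w).card < d := fun w h1 h2 =>
    lt_of_le_of_ne (card_zeros_le hG R w) fun h3 => hvert w h3 (by
      rw [hA.frontier_eq]; exact ⟨h1, h2⟩)
  have hseg : ∀ {p q : Pt d}, p ∈ face h R ∅ Q → q ∈ face h R ∅ Q → ∀ t : ℝ, 0 < t → t < 1 →
      p + t • (q - p) ∈ face h R ∅ Q := fun hp hq t h0 h1 =>
    (face_convex h R ∅ Q).add_smul_sub_mem hp hq ⟨h0.le, h1.le⟩
  have hmove : ∀ {p q : Pt d}, p ∈ face h R ∅ Q → q ∈ flat h (zeros h R p) → ∀ c : ℝ,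
      ∀ᶠ t in 𝓝[>] (0 : ℝ), p + t • (c • (q - p)) ∈ face h R ∅ Q := by
    intro p q hp hq c
    refine eventually_mem_face h hp (by simp) fun i hi => ?_
    have h1 := hq i hi
    have h2 := ((mem_zeros h).1 hi).2
    have : ⟪c • (q - p), (h i).1⟫ = 0 := by
      simp only [ev] at h1 h2
      rw [real_inner_smul_left, inner_sub_left]
      linear_combination c * (h1 - h2)
    simp [this]
  obtain ⟨v, hv⟩ := exists_isLexMin hc ⟨x, hx⟩
  have hvZ := card_zeros_of_isLexMin hG (empty_subset _) hv
  by_cases hvA : v ∈ A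
  · have hvI : v ∈ interior A := by
      by_contra h'
      exact hvert v hvZ (by rw [hA.frontier_eq]; exact ⟨hvA, h'⟩)
    have hcp : IsCompact (face h R ∅ Q \ interior A) := hc.diff isOpen_interior
    obtain ⟨p, hp⟩ := exists_isLexMin hcp ⟨y, hy, fun h' => hyA (interior_subset h')⟩
    have hpv : p ≠ v := fun h' => hp.1.2 (h' ▸ hvI)
    have hpv' : LexPos (p - v) := hv.2 p hp.1.1 hpv
    have hpA : p ∈ A := by
      by_contra hpA
      obtain ⟨t, ht, ht0, ht1⟩ := ((eventually_smul_mem (e := v - p)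
        (hA.isOpen_compl.mem_nhds hpA)).and eventually_lt_one).exists
      have hmem : p + t • (v - p) ∈ face h R ∅ Q \ interior A :=
        ⟨hseg hp.1.1 hv.1 t ht0 ht1, fun h' => ht (interior_subset h')⟩
      have hne : p + t • (v - p) ≠ p := by
        simp [ht0.ne', sub_eq_zero, Ne.symm hpv]
      have := hp.2 _ hmem hne
      rw [add_sub_cancel_left] at this
      refine this.not_neg ?_
      rw [← smul_neg, neg_sub]
      exact hpv'.smul ht0
    refine ⟨p, hp.1.1, hcard p hpA hp.1.2, true, ?_⟩
    refine ⟨⟨fun i hi => ((mem_zeros h).1 hi).2, hpA⟩, fun z hz hzp => ?_⟩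
    by_contra hneg
    have hpos : LexPos (z - p) := by
      rcases lexPos_or_neg (sub_ne_zero.2 hzp) with h' | h'
      · exact h'
      · exact absurd (by simpa using h') hneg
    obtain ⟨t, ht, ht0, ht1⟩ := ((hmove hp.1.1 hz.1 (-1)).and eventually_lt_one).exists
    have hzI : p + t • (-1 : ℝ) • (z - p) ∈ interior A := by
      by_contra hI
      have hne : p + t • (-1 : ℝ) • (z - p) ≠ p := by
        simp [ht0.ne', sub_eq_zero, hzp.symm]
      have := hp.2 _ ⟨ht, hI⟩ hne
      rw [add_sub_cancel_left] at this
      refine this.not_neg ?_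
      rw [show -(t • (-1 : ℝ) • (z - p)) = t • (z - p) by module]
      exact hpos.smul ht0
    refine hp.1.2 (hA'.openSegment_interior_self_subset_interior hzI hz.2
      ⟨1 / (1 + t), t / (1 + t), by positivity, by positivity, by field_simp, ?_⟩)
    have h1t : (1 + t) ≠ 0 := by positivity
    rw [← sub_eq_zero]
    have : (1 / (1 + t)) • (p + t • (-1 : ℝ) • (z - p)) + (t / (1 + t)) • z - p =
        (1 / (1 + t) + t / (1 + t) - 1) • p := by
      module
    rw [this, show 1 / (1 + t) + t / (1 + t) - 1 = 0 by field_simp; ring, zero_smul]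
  · obtain ⟨q, hq⟩ := exists_isLexMin (hc.inter_right hA) ⟨x, hx, interior_subset hxA⟩
    have hqv : q ≠ v := fun h' => hvA (h' ▸ hq.1.2)
    have hqv' : LexPos (q - v) := hv.2 q hq.1.1 hqv
    have hqI : q ∉ interior A := by
      intro hqI
      obtain ⟨t, ht, ht0, ht1⟩ := ((eventually_smul_mem (e := v - q)
        (mem_interior_iff_mem_nhds.1 hqI)).and eventually_lt_one).exists
      have hne : q + t • (v - q) ≠ q := by
        simp [ht0.ne', sub_eq_zero, Ne.symm hqv]
      have := hq.2 _ ⟨hseg hq.1.1 hv.1 t ht0 ht1, ht⟩ hne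
      rw [add_sub_cancel_left] at this
      refine this.not_neg ?_
      rw [← smul_neg, neg_sub]
      exact hqv'.smul ht0
    refine ⟨q, hq.1.1, hcard q hq.1.2 hqI, false, ?_⟩
    refine ⟨⟨fun i hi => ((mem_zeros h).1 hi).2, hq.1.2⟩, fun z hz hzq => ?_⟩
    rcases lexPos_or_neg (sub_ne_zero.2 hzq) with h' | hneg
    · exact h'
    exfalso
    obtain ⟨t, ht, ht0, ht1⟩ := ((hmove hq.1.1 hz.1 1).and eventually_lt_one).exists
    rw [one_smul] at ht
    have hne : q + t • (z - q) ≠ q := by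
      simp [ht0.ne', sub_eq_zero, hzq]
    have := hq.2 _ ⟨ht, hA'.add_smul_sub_mem hq.1.2 hz.2 ⟨ht0.le, ht1.le⟩⟩ hne
    rw [add_sub_cancel_left] at this
    refine this.not_neg ?_
    rw [← smul_neg]
    exact hneg.smul ht0

omit [Fintype κ] in
lemma card_small_subsets_le (R : Finset κ) :
    (R.powerset.filter fun Z => Z.card < d).card ≤ d * (R.card + 1) ^ (d - 1) := by
  have hsub : (R.powerset.filter fun Z => Z.card < d) ⊆
      (range d).biUnion fun k => R.powersetCard k := by
    intro Z hZ
    simp only [mem_filter, mem_powerset] at hZ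
    simp [hZ.1, hZ.2]
  refine (card_le_card hsub).trans (card_biUnion_le.trans ?_)
  calc ∑ k ∈ range d, (R.powersetCard k).card
      ≤ ∑ _k ∈ range d, (R.card + 1) ^ (d - 1) := by
        refine sum_le_sum fun k hk => ?_
        rw [card_powersetCard]
        have hk' : k < d := mem_range.1 hk
        calc R.card.choose k ≤ R.card ^ k := Nat.choose_le_pow _ _
          _ ≤ (R.card + 1) ^ k := Nat.pow_le_pow_left (Nat.le_succ _) _
          _ ≤ _ := Nat.pow_le_pow_right (Nat.succ_pos _) (by omega)
    _ = _ := by simp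

omit [Fintype κ] in
/-- The number of cells with a boundary point which is extreme on its flat. -/
lemma card_cells_le (h : κ → Pt d × ℝ) {R : Finset κ} {γ : Type*} [Fintype γ] (A : γ → Set (Pt d))
    (S : Finset (Finset κ)) (hSR : ∀ Q ∈ S, Q ⊆ R)
    (hS : ∀ Q ∈ S, ∃ k, ∃ w ∈ face h R ∅ Q, (zeros h R w).card < d ∧
      ∃ top, IsExtremeAt h R (A k) w top) :
    S.card ≤ Fintype.card γ * (2 * (2 ^ d * (d * (R.card + 1) ^ (d - 1)))) := by
  rcases S.eq_empty_or_nonempty with rfl | ⟨Q₀, hQ₀⟩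
  · simp
  have : Nonempty γ := ⟨(hS Q₀ hQ₀).choose⟩
  choose! k w hw hwZ top hext using hS
  set 𝒵 := R.powerset.filter fun Z => Z.card < d
  set W : Finset (γ × Bool × (Σ _ : Finset κ, Finset κ)) :=
    univ ×ˢ univ ×ˢ 𝒵.sigma fun Z => Z.powerset
  have hcardW : W.card ≤ Fintype.card γ * (2 * (2 ^ d * (d * (R.card + 1) ^ (d - 1)))) := by
    rw [card_product, card_product, card_univ, card_univ, Fintype.card_bool, card_sigma]
    gcongr
    calc ∑ Z ∈ 𝒵, Z.powerset.card ≤ ∑ Z ∈ 𝒵, 2 ^ d := by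
          refine sum_le_sum fun Z hZ => ?_
          rw [card_powerset]
          exact Nat.pow_le_pow_right two_pos (mem_filter.1 hZ).2.le
      _ = 2 ^ d * 𝒵.card := by simp [mul_comm]
      _ ≤ _ := by gcongr; exact card_small_subsets_le R
  refine (card_le_card_of_injOn (fun Q => (k Q, top Q, ⟨zeros h R (w Q), Q ∩ zeros h R (w Q)⟩))
    (fun Q hQ => ?_) ?_).trans hcardW
  · have hQ' : Q ∈ S := hQ
    simp only [W, 𝒵, coe_product, coe_univ, Set.mem_prod, Set.mem_univ, mem_coe, mem_sigma,
      mem_filter, mem_powerset, true_and]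
    exact ⟨⟨zeros_subset h R _, hwZ Q hQ'⟩, inter_subset_right⟩
  · intro Q hQ Q' hQ' heq
    have hQ : Q ∈ S := hQ
    have hQ' : Q' ∈ S := hQ'
    simp only [Prod.mk.injEq, Sigma.mk.injEq, heq_eq_eq] at heq
    obtain ⟨hk, ht, hZ, hU⟩ := heq
    have hww : w Q = w Q' := by
      have h1 := hext Q hQ
      have h2 := hext Q' hQ'
      unfold IsExtremeAt at h1 h2
      rw [← hk, ← ht, ← hZ] at h2
      split_ifs at h1 h2
      · exact h1.unique h2
      · exact h1.unique h2
    have key : ∀ Q₁ ∈ S, ∀ Q₂ ∈ S, w Q₁ = w Q₂ →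
        Q₁ ∩ zeros h R (w Q₁) = Q₂ ∩ zeros h R (w Q₂) → Q₁ ⊆ Q₂ := by
      intro Q₁ h₁ Q₂ h₂ hww hU i hi
      have hiR := hSR Q₁ h₁ hi
      by_cases h0 : ev h i (w Q₁) = 0
      · have : i ∈ Q₁ ∩ zeros h R (w Q₁) := by simp [hi, hiR, h0]
        rw [hU] at this
        exact (mem_inter.1 this).1
      · by_contra hi2
        have a1 := ((hw Q₁ h₁).2 i hiR).1 hi
        have a2 := ((hw Q₂ h₂).2 i hiR).2 hi2
        rw [← hww] at a2
        exact h0 (le_antisymm a2 a1)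
    exact (key Q hQ Q' hQ' hww hU).antisymm (key Q' hQ' Q hQ hww.symm hU.symm)

end

section

variable {d : ℕ} {κ : Type*}

/-! ### Cubes in set families of bounded shattering dimension -/

/-- `T`, `Q` describe a cube all of whose vertices belong to `𝒮`. -/
def IsCube (𝒮 : Finset (Finset κ)) (T Q : Finset κ) : Prop :=
  Disjoint T Q ∧ ∀ U ⊆ T, Q ∪ U ∈ 𝒮

/-- The cubes of `𝒮` with supports in `V`. -/
def cubes (V : Finset κ) (𝒮 : Finset (Finset κ)) : Finset (Finset κ × Finset κ) :=
  (V.powerset ×ˢ V.powerset).filter fun q => IsCube 𝒮 q.1 q.2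

lemma mem_cubes {V : Finset κ} {𝒮 : Finset (Finset κ)} {q : Finset κ × Finset κ} :
    q ∈ cubes V 𝒮 ↔ (q.1 ⊆ V ∧ q.2 ⊆ V) ∧ IsCube 𝒮 q.1 q.2 := by
  simp [cubes]

lemma card_cubes_insert_le {a : κ} {V : Finset κ} (𝒮 : Finset (Finset κ)) :
    (cubes (insert a V) 𝒮).card ≤ (cubes V (𝒮.memberSubfamily a)).card +
      (cubes V (𝒮.nonMemberSubfamily a)).card +
      (cubes V (𝒮.memberSubfamily a ∩ 𝒮.nonMemberSubfamily a)).card := by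
  have er : ∀ {T : Finset κ}, T ⊆ insert a V → T.erase a ⊆ V := fun h => by
    rwa [← subset_insert_iff]
  have e1 : ((cubes (insert a V) 𝒮).filter fun q => a ∈ q.1).card ≤
      (cubes V (𝒮.memberSubfamily a ∩ 𝒮.nonMemberSubfamily a)).card := by
    refine card_le_card_of_injOn (fun q => (q.1.erase a, q.2)) (fun q hq => ?_) ?_
    · simp only [coe_filter, Set.mem_ofPred_eq, mem_cubes] at hq
      obtain ⟨⟨⟨h1, h2⟩, h3, h4⟩, h5⟩ := hq
      have h6 : a ∉ q.2 := disjoint_left.1 h3 h5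
      rw [mem_coe, mem_cubes]
      refine ⟨⟨er h1, by rwa [subset_insert_iff_of_notMem h6] at h2⟩,
        h3.mono_left (erase_subset _ _), fun U hU => ?_⟩
      have h7 : a ∉ U := fun h => by simpa using hU h
      rw [mem_inter, mem_memberSubfamily, mem_nonMemberSubfamily, ← union_insert]
      have h8 : a ∉ q.2 ∪ U := by simp [h6, h7]
      exact ⟨⟨h4 _ (insert_subset h5 (hU.trans (erase_subset _ _))), h8⟩,
        h4 _ (hU.trans (erase_subset _ _)), h8⟩
    · rintro ⟨T, Q⟩ h ⟨T', Q'⟩ h' heq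
      simp only [coe_filter, Set.mem_ofPred_eq] at h h'
      simp only [Prod.mk.injEq] at heq ⊢
      exact ⟨by rw [← insert_erase h.2, heq.1, insert_erase h'.2], heq.2⟩
  have e2 : ((cubes (insert a V) 𝒮).filter fun q => a ∉ q.1 ∧ a ∈ q.2).card ≤
      (cubes V (𝒮.memberSubfamily a)).card := by
    refine card_le_card_of_injOn (fun q => (q.1, q.2.erase a)) (fun q hq => ?_) ?_
    · simp only [coe_filter, Set.mem_ofPred_eq, mem_cubes] at hq
      obtain ⟨⟨⟨h1, h2⟩, h3, h4⟩, h5, h6⟩ := hq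
      rw [mem_coe, mem_cubes]
      refine ⟨⟨by rwa [subset_insert_iff_of_notMem h5] at h1, er h2⟩,
        h3.mono_right (erase_subset _ _), fun U hU => ?_⟩
      have h7 : a ∉ U := fun h => h5 (hU h)
      rw [mem_memberSubfamily]
      refine ⟨?_, by simp [h7]⟩
      rw [← insert_union, insert_erase h6]
      exact h4 U hU
    · rintro ⟨T, Q⟩ h ⟨T', Q'⟩ h' heq
      simp only [coe_filter, Set.mem_ofPred_eq] at h h'
      simp only [Prod.mk.injEq] at heq ⊢
      exact ⟨heq.1, by rw [← insert_erase h.2.2, heq.2, insert_erase h'.2.2]⟩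
  have e3 : ((cubes (insert a V) 𝒮).filter fun q => a ∉ q.1 ∧ a ∉ q.2).card ≤
      (cubes V (𝒮.nonMemberSubfamily a)).card := by
    refine card_le_card fun q hq => ?_
    simp only [mem_filter, mem_cubes] at hq
    obtain ⟨⟨⟨h1, h2⟩, h3, h4⟩, h5, h6⟩ := hq
    rw [mem_cubes]
    refine ⟨⟨by rwa [subset_insert_iff_of_notMem h5] at h1,
      by rwa [subset_insert_iff_of_notMem h6] at h2⟩, h3, fun U hU => ?_⟩
    rw [mem_nonMemberSubfamily]
    have h7 : a ∉ U := fun h => h5 (hU h)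
    exact ⟨h4 U hU, by simp [h6, h7]⟩
  have hsub : cubes (insert a V) 𝒮 ⊆ ((cubes (insert a V) 𝒮).filter fun q => a ∈ q.1) ∪
      ((cubes (insert a V) 𝒮).filter fun q => a ∉ q.1 ∧ a ∈ q.2) ∪
      ((cubes (insert a V) 𝒮).filter fun q => a ∉ q.1 ∧ a ∉ q.2) := by
    intro q hq
    simp only [mem_union, mem_filter, hq, true_and]
    tauto
  have := (card_le_card hsub).trans (card_union_le _ _)
  have := card_union_le ((cubes (insert a V) 𝒮).filter fun q => a ∈ q.1)
    ((cubes (insert a V) 𝒮).filter fun q => a ∉ q.1 ∧ a ∈ q.2)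
  omega

lemma card_cubes_le (V : Finset κ) : ∀ (δ : ℕ) (𝒮 : Finset (Finset κ)), (∀ Q ∈ 𝒮, Q ⊆ V) →
    (∀ D, 𝒮.Shatters D → D.card ≤ δ) → (cubes V 𝒮).card ≤ 2 ^ δ * 𝒮.card := by
  induction V using Finset.induction_on with
  | empty =>
    intro δ 𝒮 _ _
    have : cubes ∅ 𝒮 ⊆ 𝒮.image fun Q => (∅, Q) := by
      rintro ⟨T, Q⟩ hq
      simp only [mem_cubes, subset_empty] at hq
      obtain ⟨⟨rfl, rfl⟩, -, h⟩ := hq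
      simpa using h ∅ subset_rfl
    calc _ ≤ _ := (card_le_card this).trans card_image_le
      _ ≤ _ := Nat.le_mul_of_pos_left _ (by positivity)
  | insert a V ha ih =>
    intro δ 𝒮 hV hδ
    set M := 𝒮.memberSubfamily a
    set N := 𝒮.nonMemberSubfamily a
    have hM : ∀ Q ∈ M, Q ⊆ V := fun Q hQ => by
      rw [mem_memberSubfamily] at hQ
      have := hV _ hQ.1
      exact (insert_subset_insert_iff hQ.2).1 this
    have hN : ∀ Q ∈ N, Q ⊆ V := fun Q hQ => by
      rw [mem_nonMemberSubfamily] at hQ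
      exact (subset_insert_iff_of_notMem hQ.2).1 (hV _ hQ.1)
    have h0 : (cubes (insert a V) 𝒮).card ≤
        (cubes V M).card + (cubes V N).card + (cubes V (M ∩ N)).card := card_cubes_insert_le 𝒮
    have h1 : (cubes V M).card + (cubes V N).card ≤
        (cubes V (M ∪ N)).card + (cubes V (M ∩ N)).card := by
      rw [← card_union_add_card_inter]
      refine add_le_add (card_le_card fun q hq => ?_) (card_le_card fun q hq => ?_)
      · rw [mem_union, mem_cubes, mem_cubes] at hq
        rw [mem_cubes]
        rcases hq with hq | hq
        · exact ⟨hq.1, hq.2.1, fun U hU => mem_union_left _ (hq.2.2 U hU)⟩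
        · exact ⟨hq.1, hq.2.1, fun U hU => mem_union_right _ (hq.2.2 U hU)⟩
      · rw [mem_inter, mem_cubes, mem_cubes] at hq
        rw [mem_cubes]
        exact ⟨hq.1.1, hq.1.2.1, fun U hU => mem_inter.2 ⟨hq.1.2.2 U hU, hq.2.2.2 U hU⟩⟩
    have h2 : (cubes V (M ∪ N)).card ≤ 2 ^ δ * (M ∪ N).card := by
      refine ih δ _ (fun Q hQ => ?_) fun D hD => hδ D fun t ht => ?_
      · rcases mem_union.1 hQ with h | h
        · exact hM Q h
        · exact hN Q h
      · have haD : a ∉ D := by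
          obtain ⟨u, hu, huD⟩ := hD subset_rfl
          intro h
          have hau : a ∈ u := by rw [inter_eq_left] at huD; exact huD h
          rcases mem_union.1 hu with h' | h'
          · exact ha (hM u h' hau)
          · exact ha (hN u h' hau)
        obtain ⟨u, hu, huD⟩ := hD ht
        rcases mem_union.1 hu with h | h
        · exact ⟨insert a u, (mem_memberSubfamily.1 h).1, by
            rw [inter_insert_of_notMem haD, huD]⟩
        · exact ⟨u, (mem_nonMemberSubfamily.1 h).1, huD⟩
    have h3 : 2 * (cubes V (M ∩ N)).card ≤ 2 ^ δ * (M ∩ N).card := by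
      have hsh : ∀ D, (M ∩ N).Shatters D → a ∉ D ∧ 𝒮.Shatters (insert a D) := by
        intro D hD
        have haD : a ∉ D := by
          obtain ⟨u, hu, huD⟩ := hD subset_rfl
          intro h
          have hau : a ∈ u := by rw [inter_eq_left] at huD; exact huD h
          exact ha (hM u (mem_inter.1 hu).1 hau)
        refine ⟨haD, fun t ht => ?_⟩
        obtain ⟨u, hu, huD⟩ := hD (t := t.erase a) (by rwa [← subset_insert_iff])
        rw [mem_inter, mem_memberSubfamily, mem_nonMemberSubfamily] at hu
        by_cases hat : a ∈ t
        · refine ⟨insert a u, hu.1.1, ?_⟩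
          rw [← insert_inter_distrib, huD, insert_erase hat]
        · refine ⟨u, hu.2.1, ?_⟩
          rw [insert_inter_of_notMem hu.1.2, huD, erase_eq_of_notMem hat]
      rcases Nat.eq_zero_or_pos δ with rfl | hpos
      · have hemp : M ∩ N = ∅ := by
          by_contra hne
          have hne : (M ∩ N).Nonempty := nonempty_iff_ne_empty.2 hne
          have h4 : (M ∩ N).Shatters ∅ := shatters_empty.2 hne
          have := hδ _ (hsh ∅ h4).2
          simp at this
        have : cubes V (M ∩ N) = ∅ := by
          rw [hemp, eq_empty_iff_forall_notMem]
          intro q hq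
          rw [mem_cubes] at hq
          simpa using hq.2.2 ∅ (empty_subset _)
        simp [this]
      · obtain ⟨δ, rfl⟩ : ∃ e, δ = e + 1 := ⟨δ - 1, by omega⟩
        have := ih δ (M ∩ N) (fun Q hQ => hM Q (mem_inter.1 hQ).1) fun D hD => by
          have h5 := hδ _ (hsh D hD).2
          rw [card_insert_of_notMem (hsh D hD).1] at h5
          omega
        rw [pow_succ]; linarith
    have h4 : (M ∪ N).card + (M ∩ N).card = 𝒮.card := by
      rw [card_union_add_card_inter, card_memberSubfamily_add_card_nonMemberSubfamily]
    rw [← h4, mul_add]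
    omega

/-- The cells of an arrangement in `ℝ^d` shatter no set of more than `d` hyperplanes. -/
lemma card_le_of_shatters (h : κ → Pt d × ℝ) (R : Finset κ) (P : Finset (Pt d))
    (hP : ∀ x ∈ P, ∀ i ∈ R, ev h i x ≠ 0) {D : Finset κ}
    (hD : (P.image (signs h R)).Shatters D) : D.card ≤ d := by
  by_contra hlt
  have hDR : D ⊆ R := by
    obtain ⟨u, hu, huD⟩ := hD subset_rfl
    obtain ⟨x, -, rfl⟩ := mem_image.1 hu
    exact (inter_eq_left.1 huD).trans (filter_subset _ _)
  have hdep : ¬ LinearIndependent ℝ fun i : D => (h i).1 := by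
    intro hli
    have := hli.fintype_card_le_finrank
    rw [finrank_euclideanSpace_fin, Fintype.card_coe] at this
    exact hlt this
  rw [Fintype.not_linearIndependent_iff] at hdep
  obtain ⟨g, hg, ⟨i₀, hi₀⟩⟩ := hdep
  have hD' : ∀ t ⊆ D, ∃ x ∈ P, ∀ i : D, (i : κ) ∈ t ↔ 0 < ev h i x := by
    intro t ht
    obtain ⟨u, hu, huD⟩ := hD ht
    obtain ⟨x, hx, rfl⟩ := mem_image.1 hu
    refine ⟨x, hx, fun i => ?_⟩
    rw [← huD, mem_inter, mem_signs]
    exact ⟨fun h => h.2.2, fun h => ⟨i.2, hDR i.2, h⟩⟩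
  have hconst : ∀ x, ∑ i : D, g i * ev h i x = - ∑ i : D, g i * (h i).2 := by
    intro x
    have : ∑ i : D, g i * ⟪x, (h i).1⟫ = 0 := by
      rw [← inner_zero_right x, ← hg, inner_sum]
      simp [real_inner_smul_right]
    simp only [ev, mul_sub, sum_sub_distrib, this, zero_sub]
  obtain ⟨x, hx, hx'⟩ := hD' (D.filter fun i => ∃ hi : i ∈ D, 0 < g ⟨i, hi⟩) (filter_subset _ _)
  obtain ⟨y, hy, hy'⟩ := hD' (D.filter fun i => ∃ hi : i ∈ D, g ⟨i, hi⟩ < 0) (filter_subset _ _)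
  simp only [mem_filter, coe_mem, true_and, Subtype.coe_eta, exists_true_left] at hx' hy'
  have key : 0 < ∑ i : D, g i * ev h i x - ∑ i : D, g i * ev h i y := by
    rw [← sum_sub_distrib]
    have hterm : ∀ i : D, g i ≠ 0 → 0 < g i * ev h i x - g i * ev h i y := by
      intro i hi
      have n1 := hP x hx i (hDR i.2)
      have n2 := hP y hy i (hDR i.2)
      rcases lt_or_gt_of_ne hi with hneg | hpos
      · have a1 : ¬ 0 < ev h i x := fun h' => by have := (hx' i).2 h'; linarith
        have a2 : 0 < ev h i y := (hy' i).1 hneg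
        have : ev h i x < 0 := lt_of_le_of_ne (not_lt.1 a1) n1
        nlinarith
      · have a1 : ¬ 0 < ev h i y := fun h' => by have := (hy' i).2 h'; linarith
        have a2 : 0 < ev h i x := (hx' i).1 hpos
        have : ev h i y < 0 := lt_of_le_of_ne (not_lt.1 a1) n2
        nlinarith
    refine sum_pos' (fun i _ => ?_) ⟨i₀, mem_univ _, hterm i₀ hi₀⟩
    by_cases hi : g i = 0
    · simp [hi]
    · exact (hterm i hi).le
  rw [hconst, hconst] at key
  simp at key

end

section

variable {d : ℕ} {κ : Type*}

/-! ### Borders -/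

/-- The cells of the arrangement of `R` containing a point of `P`. -/
def cells (h : κ → Pt d × ℝ) (P : Finset (Pt d)) (R : Finset κ) : Finset (Finset κ) :=
  P.image (signs h R)

/-- `x` lies in the relatively open face of the arrangement of `R` on the flat of `T` with
positive signs `Q`. -/
def InFace (h : κ → Pt d × ℝ) (R T Q : Finset κ) (x : Pt d) : Prop :=
  (∀ i ∈ T, ev h i x = 0) ∧ ∀ i ∈ R, i ∉ T → (i ∈ Q → 0 < ev h i x) ∧ (i ∉ Q → ev h i x < 0)

/-- `q = (T, T', Q)` describes a face on the flat of `T'` of a cell on the positive side of `Q`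
such that all cells obtained by crossing hyperplanes in `T ⊆ T'` are cells of `P`. -/
def IsBorder (h : κ → Pt d × ℝ) (P : Finset (Pt d)) (R : Finset κ)
    (q : Finset κ × Finset κ × Finset κ) : Prop :=
  q.1 ⊆ q.2.1 ∧ q.2.1 ⊆ R ∧ q.2.2 ⊆ R ∧ Disjoint q.1 q.2.2 ∧ (∃ x, InFace h R q.2.1 q.2.2 x) ∧
    ∀ U ⊆ q.1, q.2.2 ∪ U ∈ cells h P R

/-- The borders `(T, T', Q)` with `a` hyperplanes in `T` and `b` hyperplanes in `T'`. -/
def borders (h : κ → Pt d × ℝ) (P : Finset (Pt d)) (R : Finset κ) (a b : ℕ) :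
    Finset (Finset κ × Finset κ × Finset κ) :=
  (R.powerset ×ˢ R.powerset ×ˢ R.powerset).filter fun q =>
    IsBorder h P R q ∧ q.1.card = a ∧ q.2.1.card = b

variable {h : κ → Pt d × ℝ} {P : Finset (Pt d)} {R : Finset κ}

lemma mem_borders {a b : ℕ} {q : Finset κ × Finset κ × Finset κ} :
    q ∈ borders h P R a b ↔ IsBorder h P R q ∧ q.1.card = a ∧ q.2.1.card = b := by
  simp only [borders, mem_filter, mem_product, mem_powerset, and_iff_right_iff_imp]
  rintro ⟨⟨h1, h2, h3, -⟩, -⟩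
  exact ⟨h1.trans h2, h2, h3⟩

lemma signs_erase (i : κ) (x : Pt d) : signs h (R.erase i) x = (signs h R x).erase i := by
  ext j; simp [and_assoc]

lemma card_filter_borders_le {a b : ℕ} {i : κ} (hi : i ∈ R) :
    ((borders h P R a b).filter fun q => i ∉ q.2.1).card ≤ (borders h P (R.erase i) a b).card +
      ((borders h P R (a + 1) (b + 1)).filter fun q => i ∈ q.1).card := by
  set F := (borders h P R a b).filter fun q => i ∉ q.2.1
  set ψ : Finset κ × Finset κ × Finset κ → Finset κ × Finset κ × Finset κ :=
    fun q => (q.1, q.2.1, q.2.2.erase i)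
  set I₀ := F.filter fun q => i ∉ q.2.2
  set F₁ := F.filter fun q => i ∈ q.2.2
  have hI₁ : (F₁.image ψ).card = F₁.card := by
    refine card_image_of_injOn ?_
    rintro ⟨T, T', Q⟩ hq ⟨T₂, T₂', Q₂⟩ hq₂ heq
    simp only [F₁, coe_filter, Set.mem_ofPred_eq] at hq hq₂
    simp only [ψ, Prod.mk.injEq] at heq ⊢
    exact ⟨heq.1, heq.2.1, by rw [← insert_erase hq.2, heq.2.2, insert_erase hq₂.2]⟩
  have hF : F.card = (I₀ ∪ F₁.image ψ).card + (I₀ ∩ F₁.image ψ).card := by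
    rw [card_union_add_card_inter, hI₁, add_comm]
    exact (card_filter_add_card_filter_not (s := F) fun q => i ∈ q.2.2).symm
  have hψ : ∀ q ∈ F, ψ q ∈ borders h P (R.erase i) a b := by
    rintro ⟨T, T', Q⟩ hq
    simp only [F, mem_filter, mem_borders] at hq
    obtain ⟨⟨⟨h1, h2, h3, h4, ⟨x, hx⟩, h5⟩, ha, hb⟩, hiT⟩ := hq
    simp only at *
    rw [mem_borders]
    refine ⟨⟨h1, fun j hj => mem_erase.2 ⟨fun h' => hiT (h' ▸ hj), h2 hj⟩,
      erase_subset_erase _ h3, h4.mono_right (erase_subset _ _), ⟨x, hx.1, fun j hj hjT => ?_⟩,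
      fun U hU => ?_⟩, ha, hb⟩
    · have := hx.2 j (mem_of_mem_erase hj) hjT
      simpa [ψ, ne_of_mem_erase hj] using this
    · obtain ⟨p, hp, hpQ⟩ := mem_image.1 (h5 U hU)
      refine mem_image.2 ⟨p, hp, ?_⟩
      rw [signs_erase, hpQ, erase_union_distrib, erase_eq_of_notMem (s := U)]
      exact fun h' => hiT (h1 (hU h'))
  rw [hF]
  refine add_le_add (card_le_card fun q hq => ?_) ?_
  · rcases mem_union.1 hq with hq | hq
    · have hq' := mem_filter.1 hq
      have := hψ q hq'.1
      simpa [ψ, erase_eq_of_notMem hq'.2] using this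
    · obtain ⟨q', hq', rfl⟩ := mem_image.1 hq
      exact hψ q' (mem_filter.1 hq').1
  · refine card_le_card_of_injOn (fun q => (insert i q.1, insert i q.2.1, q.2.2)) ?_ ?_
    · rintro ⟨T, T', Q⟩ hq
      rw [mem_coe, mem_inter] at hq
      obtain ⟨hq0, hq1⟩ := hq
      obtain ⟨⟨T₂, T₂', Q₂⟩, hq₂, heq⟩ := mem_image.1 hq1
      simp only [ψ, Prod.mk.injEq] at heq
      obtain ⟨rfl, rfl, hQ⟩ := heq
      simp only [I₀, F₁, F, mem_filter, mem_borders] at hq0 hq₂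
      obtain ⟨⟨⟨⟨h1, h2, h3, h4, ⟨x, hx⟩, h5⟩, ha, hb⟩, hiT⟩, hiQ⟩ := hq0
      obtain ⟨⟨⟨⟨-, -, h3', h4', ⟨y, hy⟩, h5'⟩, -, -⟩, -⟩, hiQ'⟩ := hq₂
      simp only at *
      have hiT₂ : i ∉ T₂ := fun h' => hiT (h1 h')
      have hQ₂ : Q₂ = insert i Q := by rw [← hQ, insert_erase hiQ']
      rw [mem_coe, mem_filter, mem_borders]
      refine ⟨⟨⟨insert_subset_insert _ h1, insert_subset hi h2, h3, ?_, ?_, fun U hU => ?_⟩,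
        by rw [card_insert_of_notMem hiT₂, ha], by rw [card_insert_of_notMem hiT, hb]⟩,
        mem_insert_self _ _⟩
      · rw [disjoint_insert_left]
        exact ⟨hiQ, h4⟩
      · have n1 := (hx.2 i hi hiT).2 hiQ
        have n2 := (hy.2 i hi hiT).1 hiQ'
        set s := ev h i x
        set t := ev h i y
        have hst : 0 < t - s := by linarith
        refine ⟨(t / (t - s)) • x + (-s / (t - s)) • y, fun j hj => ?_, fun j hj hjT => ?_⟩
        · rw [ev_combo h j x y (by field_simp; ring)]
          rcases mem_insert.1 hj with rfl | hj
          · change _ * s + _ * t = 0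
            field_simp; ring
          · rw [hx.1 j hj, hy.1 j hj]; ring
        · have hji : j ≠ i := fun h' => hjT (h' ▸ mem_insert_self _ _)
          have hjT' : j ∉ T₂' := fun h' => hjT (mem_insert_of_mem h')
          rw [ev_combo h j x y (by field_simp; ring)]
          have c1 : 0 < t / (t - s) := div_pos n2 hst
          have c2 : 0 < -s / (t - s) := div_pos (by linarith) hst
          have a1 := hx.2 j hj hjT'
          have a2 := hy.2 j hj hjT'
          rw [hQ₂] at a2
          simp only [mem_insert, hji, false_or] at a2
          refine ⟨fun hQj => ?_, fun hQj => ?_⟩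
          · have := a1.1 hQj
            have := a2.1 hQj
            positivity
          · have := mul_neg_of_pos_of_neg c1 (a1.2 hQj)
            have := mul_neg_of_pos_of_neg c2 (a2.2 hQj)
            linarith
      · by_cases hiU : i ∈ U
        · have hU' : U.erase i ⊆ T₂ := by rwa [← subset_insert_iff]
          have := h5' _ hU'
          rw [hQ₂, insert_union, ← union_insert, insert_erase hiU] at this
          exact this
        · exact h5 U (by rwa [subset_insert_iff_of_notMem hiU] at hU)
    · rintro ⟨T, T', Q⟩ hq ⟨T₂, T₂', Q₂⟩ hq₂ heq
      rw [mem_coe, mem_inter] at hq hq₂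
      have key : ∀ q ∈ I₀, i ∉ q.1 ∧ i ∉ q.2.1 := by
        intro q hq
        simp only [I₀, F, mem_filter, mem_borders] at hq
        exact ⟨fun h' => hq.1.2 (hq.1.1.1.1 h'), hq.1.2⟩
      have k1 := key _ hq.1
      have k2 := key _ hq₂.1
      simp only [Prod.mk.injEq] at heq k1 k2 ⊢
      exact ⟨by rw [← erase_insert k1.1, heq.1, erase_insert k2.1],
        by rw [← erase_insert k1.2, heq.2.1, erase_insert k2.2], heq.2.2⟩

/-- The recurrence obtained by deleting one hyperplane at a time. -/
lemma borders_recurrence {a b : ℕ} {R₀ : Finset κ} (hR₀ : R₀ ⊆ R) :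
    (R₀.card - b) * (borders h P R a b).card ≤ ∑ i ∈ R₀, (borders h P (R.erase i) a b).card +
      (a + 1) * (borders h P R (a + 1) (b + 1)).card := by
  have e1 : (R₀.card - b) * (borders h P R a b).card ≤
      ∑ i ∈ R₀, ((borders h P R a b).filter fun q => i ∉ q.2.1).card := by
    simp only [card_filter]
    rw [sum_comm, mul_comm]
    simp only [← card_filter]
    refine card_nsmul_le_sum _ _ _ fun q hq => ?_
    rw [filter_notMem_eq_sdiff]
    have h1 := le_card_sdiff q.2.1 R₀
    rw [(mem_borders.1 hq).2.2] at h1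
    exact h1
  have e2 : ∑ i ∈ R₀, ((borders h P R (a + 1) (b + 1)).filter fun q => i ∈ q.1).card ≤
      (a + 1) * (borders h P R (a + 1) (b + 1)).card := by
    simp only [card_filter]
    rw [sum_comm, mul_comm]
    simp only [← card_filter]
    refine sum_le_card_nsmul _ _ _ fun q hq => ?_
    rw [filter_mem_eq_inter, ← (mem_borders.1 hq).2.1]
    exact card_le_card inter_subset_right
  refine e1.trans ((sum_le_sum fun i hi => card_filter_borders_le (hR₀ hi)).trans ?_)
  rw [sum_add_distrib]
  omega

lemma card_borders_diag_le (hP : ∀ x ∈ P, ∀ i ∈ R, ev h i x ≠ 0) (a : ℕ) :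
    (borders h P R a a).card ≤ 2 ^ d * (cells h P R).card := by
  refine le_trans ?_ (card_cubes_le R d (cells h P R) (fun Q hQ => ?_) fun D hD =>
    card_le_of_shatters h R P hP hD)
  · refine card_le_card_of_injOn (fun q => (q.1, q.2.2)) ?_ ?_
    · rintro ⟨T, T', Q⟩ hq
      obtain ⟨⟨h1, h2, h3, h4, -, h5⟩, -⟩ := mem_borders.1 hq
      exact mem_cubes.2 ⟨⟨h1.trans h2, h3⟩, h4, h5⟩
    · rintro ⟨T, T', Q⟩ hq ⟨T₂, T₂', Q₂⟩ hq₂ heq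
      obtain ⟨⟨h1, -⟩, ha, hb⟩ := mem_borders.1 hq
      obtain ⟨⟨h1', -⟩, ha', hb'⟩ := mem_borders.1 hq₂
      have e1 : T = T' := eq_of_subset_of_card_le h1 (by simp_all)
      have e2 : T₂ = T₂' := eq_of_subset_of_card_le h1' (by simp_all)
      simp_all
  · obtain ⟨x, -, rfl⟩ := mem_image.1 hQ
    exact filter_subset _ _

lemma card_borders_le_pow (a b : ℕ) : (borders h P R a b).card ≤ (2 ^ R.card) ^ 3 := by
  refine (card_filter_le _ _).trans ?_
  simp only [card_product, card_powerset]
  exact le_of_eq (by ring)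

lemma lexPos_sum {α : Type*} (s : Finset α) (c : α → ℝ) (e : α → Pt d) (hc : ∀ j ∈ s, 0 ≤ c j)
    (he : ∀ j ∈ s, LexPos (e j)) (hpos : ∃ j ∈ s, 0 < c j) : LexPos (∑ j ∈ s, c j • e j) := by
  have key : LexPos (∑ j ∈ s, c j • e j) ∨ ∀ j ∈ s, c j = 0 := by
    clear hpos
    induction s using Finset.induction_on with
    | empty => simp
    | insert a s ha ih =>
      have ih := ih (fun j hj => hc j (mem_insert_of_mem hj))
        fun j hj => he j (mem_insert_of_mem hj)
      rw [sum_insert ha]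
      rcases (hc a (mem_insert_self _ _)).eq_or_lt with h0 | h0
      · rw [← h0, zero_smul, zero_add]
        rcases ih with ih | ih
        · exact Or.inl ih
        · right
          intro j hj
          rcases mem_insert.1 hj with rfl | hj
          · exact h0.symm
          · exact ih j hj
      · left
        have h1 := (he a (mem_insert_self _ _)).smul h0
        rcases ih with ih | ih
        · exact h1.add ih
        · rw [sum_eq_zero fun j hj => by rw [ih j hj, zero_smul], add_zero]
          exact h1
  rcases key with h1 | h1
  · exact h1
  · obtain ⟨j, hj, hj'⟩ := hpos
    exact absurd (h1 j hj) hj'.ne'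

lemma InFace.mem_face {T Q : Finset κ} {x : Pt d} (hx : InFace h R T Q x) : x ∈ face h R T Q := by
  refine ⟨hx.1, fun i hi => ?_⟩
  by_cases hT : i ∈ T
  · simp [hx.1 i hT]
  · exact ⟨fun hQ => ((hx.2 i hi hT).1 hQ).le, fun hQ => ((hx.2 i hi hT).2 hQ).le⟩

lemma InFace.zeros_eq {T Q : Finset κ} {x : Pt d} (hT : T ⊆ R) (hx : InFace h R T Q x) :
    zeros h R x = T := by
  ext i
  rw [mem_zeros]
  refine ⟨fun ⟨hi, h0⟩ => ?_, fun hi => ⟨hT hi, hx.1 i hi⟩⟩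
  by_contra hiT
  by_cases hQ : i ∈ Q
  · exact ((hx.2 i hi hiT).1 hQ).ne' h0
  · exact ((hx.2 i hi hiT).2 hQ).ne h0

/-- A point of a closed face lies in the relatively open face of its zero set. -/
lemma inFace_zeros {T Q : Finset κ} {x : Pt d} (hx : x ∈ face h R T Q) :
    InFace h R (zeros h R x) Q x := by
  refine ⟨fun i hi => ((mem_zeros h).1 hi).2, fun i hi hz => ?_⟩
  have h0 : ev h i x ≠ 0 := fun h0 => hz ((mem_zeros h).2 ⟨hi, h0⟩)
  exact ⟨fun hQ => lt_of_le_of_ne ((hx.2 i hi).1 hQ) h0.symm,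
    fun hQ => lt_of_le_of_ne ((hx.2 i hi).2 hQ) h0⟩

variable [Fintype κ]

lemma eq_zero_of_orthogonal (hG : Generic h) {T : Finset κ} (hT : T.card = d) {e : Pt d}
    (he : ∀ i ∈ T, ⟪e, (h i).1⟫ = 0) : e = 0 := by
  have hli := hG.indep T hT.le
  have hspan := hli.span_eq_top_of_card_eq_finrank' (by simp [hT])
  have : e ∈ (Submodule.span ℝ (Set.range fun i : T => (h i).1))ᗮ := by
    rw [Submodule.mem_orthogonal]
    intro u hu
    induction hu using Submodule.span_induction with
    | mem x hx =>
      obtain ⟨i, rfl⟩ := hx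
      rw [real_inner_comm]
      exact he i i.2
    | zero => simp
    | add x y _ _ hx hy => rw [inner_add_left, hx, hy, add_zero]
    | smul c x _ hx => rw [real_inner_smul_left, hx, mul_zero]
  rwa [hspan, Submodule.top_orthogonal_eq_bot, Submodule.mem_bot] at this

lemma eq_of_ev_eq_zero (hG : Generic h) {T : Finset κ} (hT : T.card = d) {x y : Pt d}
    (hx : ∀ i ∈ T, ev h i x = 0) (hy : ∀ i ∈ T, ev h i y = 0) : x = y := by
  refine sub_eq_zero.1 (eq_zero_of_orthogonal hG hT fun i hi => ?_)
  have h1 := hx i hi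
  have h2 := hy i hi
  simp only [ev] at h1 h2
  rw [inner_sub_left]; linarith

/-- At a vertex with at least `2 * m - 1` free directions, the vertex is lexicographically extreme
on an incident face of dimension `m`. -/
lemma exists_extreme_face (hG : Generic h) {T T' Q : Finset κ} (hT' : T'.card = d)
    (hTR : T' ⊆ R) {v : Pt d} (hv : InFace h R T' Q v) {m : ℕ} (hm : 2 * m ≤ (T' \ T).card + 1) :
    ∃ J ⊆ T' \ T, J.card = m ∧ (∃ x, InFace h R (T' \ J) Q x) ∧
      ∃ top : Bool, if top then IsLexMax (face h R (T' \ J) Q) v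
        else IsLexMin (face h R (T' \ J) Q) v := by
  have hex : ∀ j, ∃ e : Pt d, ∀ i ∈ T', ⟪e, (h i).1⟫ =
      if i = j then (if j ∈ Q then (1 : ℝ) else -1) else 0 := fun j =>
    exists_inner_eq h (hG.indep T' hT'.le) fun i => if i = j then (if j ∈ Q then 1 else -1) else 0
  choose e he using hex
  have he0 : ∀ j ∈ T', e j ≠ 0 := by
    intro j hj h0
    have := he j j hj
    rw [h0, inner_zero_left, if_pos rfl] at this
    split_ifs at this <;> norm_num at this
  have hJ : ∃ J ⊆ T' \ T, J.card = m ∧ ∃ top : Bool, ∀ j ∈ J,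
      LexPos (if top then -e j else e j) := by
    have hsum := card_filter_add_card_filter_not (s := T' \ T) fun j => LexPos (e j)
    rcases le_or_gt m ((T' \ T).filter fun j => LexPos (e j)).card with h1 | h1
    · obtain ⟨J, hJ, hJc⟩ := exists_subset_card_eq h1
      exact ⟨J, hJ.trans (filter_subset _ _), hJc, false, fun j hj => (mem_filter.1 (hJ hj)).2⟩
    · have h2 : m ≤ ((T' \ T).filter fun j => ¬ LexPos (e j)).card := by omega
      obtain ⟨J, hJ, hJc⟩ := exists_subset_card_eq h2
      refine ⟨J, hJ.trans (filter_subset _ _), hJc, true, fun j hj => ?_⟩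
      have h3 := mem_filter.1 (hJ hj)
      exact (lexPos_or_neg (he0 j (Finset.mem_sdiff.1 h3.1).1)).resolve_left h3.2
  obtain ⟨J, hJsub, hJc, top, htop⟩ := hJ
  have hJT' : J ⊆ T' := hJsub.trans sdiff_subset
  refine ⟨J, hJsub, hJc, ?_, top, ?_⟩
  · set E := ∑ j ∈ J, e j
    have hE : ∀ i ∈ T', ⟪E, (h i).1⟫ = if i ∈ J then (if i ∈ Q then (1 : ℝ) else -1) else 0 := by
      intro i hi
      rw [sum_inner, sum_congr rfl fun j _ => he j i hi, sum_ite_eq]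
    have hev : ∀ᶠ t in 𝓝[>] (0 : ℝ), v + t • E ∈ face h R (T' \ J) Q := by
      refine eventually_mem_face h ⟨fun i hi => hv.1 i (Finset.mem_sdiff.1 hi).1, hv.mem_face.2⟩
        (fun i hi => ?_) fun i hi => ?_
      · rw [hE i (Finset.mem_sdiff.1 hi).1, if_neg (Finset.mem_sdiff.1 hi).2]
      · rw [hv.zeros_eq hTR] at hi
        rw [hE i hi]
        by_cases hQ : i ∈ Q <;> by_cases hiJ : i ∈ J <;> simp [hQ, hiJ]
    have hne : ∀ᶠ t in 𝓝[>] (0 : ℝ), ∀ i ∈ R, i ∉ T' → ev h i (v + t • E) ≠ 0 := by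
      rw [Filter.eventually_all]
      intro i
      rw [Filter.eventually_imp_distrib_left]
      intro hi
      rw [Filter.eventually_imp_distrib_left]
      intro hiT
      have hvi : ev h i v ≠ 0 := by
        intro h0
        have : i ∈ zeros h R v := (mem_zeros h).2 ⟨hi, h0⟩
        rw [hv.zeros_eq hTR] at this
        exact hiT this
      have hc : Continuous fun t : ℝ => ev h i (v + t • E) := (continuous_ev h i).comp (by fun_prop)
      have h1 := (hc.tendsto 0).mono_left (nhdsWithin_le_nhds (s := Set.Ioi 0))
      simp only [zero_smul, add_zero] at h1
      exact h1.eventually_ne hvi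
    obtain ⟨t, ⟨ht1, ht2⟩, ht0 : 0 < t⟩ := ((hev.and hne).and self_mem_nhdsWithin).exists
    have hz : zeros h R (v + t • E) = T' \ J := by
      ext i
      rw [mem_zeros, Finset.mem_sdiff]
      constructor
      · rintro ⟨hi, h0⟩
        have hiT : i ∈ T' := by
          by_contra hiT
          exact ht2 i hi hiT h0
        refine ⟨hiT, fun hiJ => ?_⟩
        rw [ev_add_smul, hv.1 i hiT, hE i hiT, if_pos hiJ, zero_add] at h0
        rcases mul_eq_zero.1 h0 with h' | h'
        · exact ht0.ne' h'
        · split_ifs at h' <;> norm_num at h'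
      · rintro ⟨hiT, hiJ⟩
        exact ⟨hTR hiT, ht1.1 i (Finset.mem_sdiff.2 ⟨hiT, hiJ⟩)⟩
    exact ⟨_, hz ▸ inFace_zeros ht1⟩
  · have hvmem : v ∈ face h R (T' \ J) Q :=
      ⟨fun i hi => hv.1 i (Finset.mem_sdiff.1 hi).1, hv.mem_face.2⟩
    have hexp : ∀ y ∈ face h R (T' \ J) Q, y - v = ∑ j ∈ J, |ev h j y| • e j := by
      intro y hy
      refine sub_eq_zero.1 (eq_zero_of_orthogonal hG hT' fun i hi => ?_)
      have h1 : ⟪y - v, (h i).1⟫ = ev h i y := by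
        have := hv.1 i hi
        simp only [ev] at this ⊢
        rw [inner_sub_left]; linarith
      have h2 : ⟪∑ j ∈ J, |ev h j y| • e j, (h i).1⟫ =
          if i ∈ J then |ev h i y| * (if i ∈ Q then 1 else -1) else 0 := by
        rw [sum_inner, sum_congr rfl fun j _ => by rw [real_inner_smul_left, he j i hi, mul_ite,
          mul_zero], sum_ite_eq]
      rw [inner_sub_left, h1, h2]
      split_ifs with c1 c2
      · rw [abs_of_nonneg ((hy.2 i (hTR hi)).1 c2)]; ring
      · rw [abs_of_nonpos ((hy.2 i (hTR hi)).2 c2)]; ring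
      · rw [hy.1 i (Finset.mem_sdiff.2 ⟨hi, c1⟩)]; ring
    have hpos : ∀ y ∈ face h R (T' \ J) Q, y ≠ v → ∃ j ∈ J, 0 < |ev h j y| := by
      intro y hy hne
      by_contra! hall
      apply hne
      rw [← sub_eq_zero, hexp y hy]
      refine sum_eq_zero fun j hj => ?_
      rw [le_antisymm (hall j hj) (abs_nonneg _), zero_smul]
    cases top with
    | true =>
      simp only [if_true] at htop ⊢
      refine ⟨hvmem, fun y hy hne => ?_⟩
      rw [← neg_sub, hexp y hy, ← sum_neg_distrib]
      simp only [← smul_neg]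
      exact lexPos_sum _ _ _ (fun j _ => abs_nonneg _) htop (hpos y hy hne)
    | false =>
      simp only [Bool.false_eq_true, if_false] at htop ⊢
      refine ⟨hvmem, fun y hy hne => ?_⟩
      rw [hexp y hy]
      exact lexPos_sum _ _ _ (fun j _ => abs_nonneg _) htop (hpos y hy hne)

lemma card_borders_vertex_le (hG : Generic h) {a m : ℕ} (hm : 2 * m ≤ d - a + 1) :
    (borders h P R a d).card ≤ 2 * (borders h P R a (d - m)).card := by
  have hex : ∀ q ∈ borders h P R a d, ∃ q' ∈ borders h P R a (d - m), q'.1 = q.1 ∧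
      q'.2.2 = q.2.2 ∧ ∃ v, zeros h R v = q.2.1 ∧ ∃ top : Bool,
        if top then IsLexMax (face h R q'.2.1 q'.2.2) v
        else IsLexMin (face h R q'.2.1 q'.2.2) v := by
    rintro ⟨T, T', Q⟩ hq
    obtain ⟨⟨h1, h2, h3, h4, ⟨v, hv⟩, h5⟩, ha, hb⟩ := mem_borders.1 hq
    simp only at *
    obtain ⟨J, hJ, hJc, hx, top, htop⟩ := exists_extreme_face hG (T := T) (m := m) hb h2 hv (by
      rw [card_sdiff_of_subset h1, hb, ha]; exact hm)
    refine ⟨(T, T' \ J, Q), mem_borders.2 ⟨⟨?_, sdiff_subset.trans h2, h3, h4, hx, h5⟩, ha, ?_⟩,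
      rfl, rfl, v, hv.zeros_eq h2, top, htop⟩
    · intro i hi
      exact Finset.mem_sdiff.2 ⟨h1 hi, fun hiJ => (Finset.mem_sdiff.1 (hJ hiJ)).2 hi⟩
    · simp only
      rw [card_sdiff_of_subset (hJ.trans sdiff_subset), hb, hJc]
  choose! f hf hf1 hf2 v hv top htop using hex
  have : (borders h P R a d).card ≤ ((univ : Finset Bool) ×ˢ borders h P R a (d - m)).card := by
    refine card_le_card_of_injOn (fun q => (top q, f q)) (fun q hq => ?_) ?_
    · simp only [coe_product, coe_univ, Set.mem_prod, Set.mem_univ, true_and]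
      exact hf q hq
    · intro q hq q' hq' heq
      simp only [Prod.mk.injEq] at heq
      have hvv : v q = v q' := by
        have t1 := htop q hq
        have t2 := htop q' hq'
        rw [← heq.1, ← heq.2] at t2
        split_ifs at t1 t2
        · exact t1.unique t2
        · exact t1.unique t2
      refine Prod.ext ?_ (Prod.ext ?_ ?_)
      · rw [← hf1 q hq, ← hf1 q' hq', heq.2]
      · rw [← hv q hq, ← hv q' hq', hvv]
      · rw [← hf2 q hq, ← hf2 q' hq', heq.2]
  simpa [card_product] using this

lemma card_borders_edge_le (hG : Generic h) (hd : 0 < d) {a : ℕ}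
    (hc : ∀ Q ∈ cells h P R, IsCompact (face h R ∅ Q)) :
    (borders h P R a (d - 1)).card ≤ d * (borders h P R a d).card := by
  have hex : ∀ q ∈ borders h P R a (d - 1), ∃ q' ∈ borders h P R a d, q'.1 = q.1 ∧
      q'.2.2 = q.2.2 ∧ q.2.1 ⊆ q'.2.1 := by
    rintro ⟨T, T', Q⟩ hq
    obtain ⟨⟨h1, h2, h3, h4, ⟨x, hx⟩, h5⟩, ha, hb⟩ := mem_borders.1 hq
    simp only at *
    have hcomp : IsCompact (face h R T' Q) := by
      refine (hc Q (by simpa using h5 ∅ (empty_subset _))).of_isClosed_subset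
        (face_closed h R T' Q) fun y hy => ⟨by simp, hy.2⟩
    obtain ⟨v, hv⟩ := exists_isLexMin hcomp ⟨x, hx.mem_face⟩
    have hsub : T' ⊆ zeros h R v := fun i hi => (mem_zeros h).2 ⟨h2 hi, hv.1.1 i hi⟩
    exact ⟨(T, zeros h R v, Q), mem_borders.2 ⟨⟨h1.trans hsub, zeros_subset h R v, h3, h4,
      ⟨v, inFace_zeros hv.1⟩, h5⟩, ha, card_zeros_of_isLexMin hG h2 hv⟩, rfl, rfl, hsub⟩
  choose! f hf hf1 hf2 hf3 using hex
  refine card_le_mul_card_image_of_maps_to (f := f) hf d fun q hq => ?_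
  have : ((borders h P R a (d - 1)).filter fun q' => f q' = q).card ≤
      (q.2.1.powersetCard (d - 1)).card := by
    refine card_le_card_of_injOn (fun q' => q'.2.1) (fun q' hq' => ?_) ?_
    · simp only [coe_filter, Set.mem_ofPred_eq] at hq'
      rw [mem_coe, mem_powersetCard, ← hq'.2]
      exact ⟨hf3 _ hq'.1, (mem_borders.1 hq'.1).2.2⟩
    · intro q₁ h₁ q₂ h₂ heq
      simp only [coe_filter, Set.mem_ofPred_eq] at h₁ h₂
      refine Prod.ext ?_ (Prod.ext heq ?_)
      · rw [← hf1 q₁ h₁.1, ← hf1 q₂ h₂.1, h₁.2, h₂.2]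
      · rw [← hf2 q₁ h₁.1, ← hf2 q₂ h₂.1, h₁.2, h₂.2]
  refine this.trans ?_
  rw [card_powersetCard, (mem_borders.1 hq).2.2, ← Nat.choose_symm (by omega),
    Nat.sub_sub_self (by omega), Nat.choose_one_right]

/-- A bound for the number of vertices of cells valid for arbitrary sets of cells. -/
lemma card_borders_vertex_le_choose (hG : Generic h) :
    (borders h P R 0 d).card ≤ R.card.choose d * 2 ^ d := by
  have : (borders h P R 0 d).card ≤ ((R.powersetCard d).sigma fun T' => T'.powerset).card := by
    refine card_le_card_of_injOn (fun q => ⟨q.2.1, q.2.2 ∩ q.2.1⟩) (fun q hq => ?_) ?_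
    · obtain ⟨⟨h1, h2, -⟩, ha, hb⟩ := mem_borders.1 hq
      simp only [mem_coe, mem_sigma, mem_powersetCard, mem_powerset]
      exact ⟨⟨h2, hb⟩, inter_subset_right⟩
    · rintro ⟨T, T', Q⟩ hq ⟨T₂, T₂', Q₂⟩ hq₂ heq
      obtain ⟨⟨h1, h2, h3, h4, ⟨v, hv⟩, h5⟩, ha, hb⟩ := mem_borders.1 hq
      obtain ⟨⟨g1, g2, g3, g4, ⟨w, hw⟩, g5⟩, ga, gb⟩ := mem_borders.1 hq₂
      simp only [Sigma.mk.injEq] at *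
      obtain ⟨rfl, hQ⟩ := heq
      simp only [heq_eq_eq] at hQ
      obtain rfl := eq_of_ev_eq_zero hG hb hv.1 hw.1
      have key : ∀ {Q₁ Q₂ : Finset κ}, Q₁ ⊆ R → InFace h R T' Q₁ v → InFace h R T' Q₂ v →
          Q₁ ∩ T' = Q₂ ∩ T' → Q₁ ⊆ Q₂ := by
        intro Q₁ Q₂ hR e1 e2 hQ i hi
        by_cases hiT : i ∈ T'
        · have : i ∈ Q₁ ∩ T' := mem_inter.2 ⟨hi, hiT⟩
          rw [hQ] at this
          exact (mem_inter.1 this).1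
        · by_contra hi2
          have := (e1.2 i (hR hi) hiT).1 hi
          have := (e2.2 i (hR hi) hiT).2 hi2
          linarith
      refine Prod.ext ?_ (Prod.ext rfl ?_)
      · rw [card_eq_zero.1 ha, card_eq_zero.1 ga]
      · exact (key h3 hv hw hQ).antisymm (key g3 hw hv hQ.symm)
  refine this.trans (le_of_eq ?_)
  rw [card_sigma, sum_congr rfl fun T' hT' => by rw [card_powerset, (mem_powersetCard.1 hT').2]]
  simp

end

section

variable {d : ℕ} {κ : Type*}

/-! ### The complexity of a zone -/

lemma pow_le_mul_choose (b : ℕ) : ∃ G : ℝ, 0 ≤ G ∧ ∀ n : ℕ, b < n →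
    ((n : ℝ) + 1) ^ (b + 1) ≤ G * (((n : ℝ) - b) * n.choose b) := by
  refine ⟨(b + 2) ^ (b + 1) * (b.factorial : ℝ), by positivity, fun n hn => ?_⟩
  have h1 := Nat.pow_le_choose (α := ℝ) (b + 1) n
  have h2 : ((n + 1 - (b + 1) : ℕ) : ℝ) = n - b := by
    rw [Nat.add_sub_add_right, Nat.cast_sub hn.le]
  have h3 : ((n : ℝ) - b) * n.choose b = (b + 1) * n.choose (b + 1) := by
    have := Nat.choose_succ_right_eq n b
    have h4 : ((n.choose (b + 1) * (b + 1) : ℕ) : ℝ) = (n.choose b * (n - b) : ℕ) := by rw [this]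
    push_cast [Nat.cast_sub hn.le] at h4
    linarith
  rw [h2, Nat.factorial_succ] at h1
  push_cast at h1
  rw [div_le_iff₀ (by positivity), mul_comm] at h1
  have hnb : (b : ℝ) + 1 ≤ n := by exact_mod_cast hn
  have h5 : (n : ℝ) + 1 ≤ (b + 2) * (n - b) := by nlinarith [(Nat.cast_nonneg b : (0 : ℝ) ≤ b)]
  calc ((n : ℝ) + 1) ^ (b + 1) ≤ ((b + 2) * (n - b)) ^ (b + 1) := by gcongr
    _ = (b + 2) ^ (b + 1) * ((n : ℝ) - b) ^ (b + 1) := by rw [mul_pow]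
    _ ≤ (b + 2) ^ (b + 1) * ((b + 1) * b.factorial * n.choose (b + 1)) := by gcongr
    _ = _ := by rw [h3]; ring

lemma recurrence_bound {R₀ : Finset κ} {N : Finset κ → ℝ} {g W : ℕ → ℝ} {A : ℝ} {b : ℕ}
    (hrec : ∀ R ⊆ R₀, b < R.card →
      ((R.card : ℝ) - b) * N R ≤ ∑ i ∈ R, N (R.erase i) + g R.card)
    (hbase : ∀ R ⊆ R₀, R.card = b → N R ≤ A) (hW₀ : 0 ≤ W b)
    (hW : ∀ n : ℕ, b < n → g n ≤ ((n : ℝ) - b) * n.choose b * (W n - W (n - 1))) :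
    ∀ n : ℕ, b ≤ n → ∀ R ⊆ R₀, R.card = n → N R ≤ n.choose b * (A + W n) := by
  intro n hn
  induction n, hn using Nat.le_induction with
  | base =>
    intro R hR hc
    have := hbase R hR hc
    simp only [Nat.choose_self, Nat.cast_one, one_mul]
    linarith
  | succ n hn ih =>
    intro R hR hc
    have h1 := hrec R hR (by omega)
    have h2 : ∑ i ∈ R, N (R.erase i) ≤ ∑ _i ∈ R, n.choose b * (A + W n) :=
      sum_le_sum fun i hi => ih _ ((erase_subset _ _).trans hR) (by
        rw [card_erase_of_mem hi]; omega)
    have h3 := hW (n + 1) (by omega)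
    rw [sum_const, nsmul_eq_mul] at h2
    rw [hc] at h1 h2
    simp only [Nat.add_sub_cancel] at h3
    have h4 : ((n + 1 : ℕ) : ℝ) * n.choose b = (((n + 1 : ℕ) : ℝ) - b) * (n + 1).choose b := by
      have h5 := Nat.choose_mul_succ_eq n b
      have h6 : ((n.choose b * (n + 1) : ℕ) : ℝ) = ((n + 1).choose b * (n + 1 - b) : ℕ) := by
        rw [h5]
      rw [Nat.cast_mul, Nat.cast_mul, Nat.cast_sub (by omega)] at h6
      linarith
    have hpos : 0 < (((n + 1 : ℕ) : ℝ) - b) := by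
      have : (b : ℝ) < (n + 1 : ℕ) := by exact_mod_cast Nat.lt_succ_of_le hn
      linarith
    refine le_of_mul_le_mul_left ?_ hpos
    rw [← mul_assoc, h4] at h2
    linarith

/-- A logarithmic factor. -/
def Λ (n : ℕ) : ℝ := 1 + ∑ k ∈ range n, 1 / ((k : ℝ) + 1)

lemma Λ_succ (n : ℕ) : Λ (n + 1) = Λ n + 1 / ((n : ℝ) + 1) := by
  rw [Λ, Λ, sum_range_succ]; ring

lemma Λ_mono : Monotone Λ := monotone_nat_of_le_succ fun n => by
  rw [Λ_succ]
  have : (0 : ℝ) ≤ 1 / ((n : ℝ) + 1) := by positivity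
  linarith

lemma one_le_Λ (n : ℕ) : 1 ≤ Λ n := by
  have := Λ_mono (Nat.zero_le n)
  simpa [Λ] using this

attribute [irreducible] Λ

/-- The assumptions under which the complexity of a zone is bounded: `P` is a set of points
representing cells, `B` is a bounded number of hyperplanes making these cells bounded. -/
structure ZoneData {d : ℕ} {κ : Type} [Fintype κ] (β c : ℕ) (h : κ → Pt d × ℝ) (P : Finset (Pt d))
    (B R₀ : Finset κ) : Prop where
  generic : Generic h
  off : ∀ x ∈ P, ∀ i, ev h i x ≠ 0
  disj : Disjoint R₀ B
  card_le : B.card ≤ β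
  compact : ∀ x ∈ P, IsCompact (face h B ∅ (signs h B x))
  cells_le : ∀ R ⊆ R₀, (cells h P (R ∪ B)).card ≤ c * (R.card + 1) ^ (d - 1)

/-- A uniform bound on the number of borders. -/
def BordersBound (d β c a b : ℕ) (L : ℕ → ℝ) : Prop :=
  ∃ C : ℝ, 0 ≤ C ∧ ∀ (κ : Type) [Fintype κ] (h : κ → Pt d × ℝ) (P : Finset (Pt d))
    (B R₀ : Finset κ), ZoneData β c h P B R₀ → ∀ R ⊆ R₀,
    ((borders h P (R ∪ B) a b).card : ℝ) ≤ C * ((R.card : ℝ) + 1) ^ (d - 1) * L R.card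

lemma ZoneData.compact_cells {κ : Type} [Fintype κ] {β c : ℕ} {h : κ → Pt d × ℝ}
    {P : Finset (Pt d)} {B R₀ : Finset κ} (hz : ZoneData β c h P B R₀) {R : Finset κ}
    (hB : B ⊆ R) : ∀ Q ∈ cells h P R, IsCompact (face h R ∅ Q) := by
  intro Q hQ
  obtain ⟨x, hx, rfl⟩ := mem_image.1 hQ
  refine (hz.compact x hx).of_isClosed_subset (face_closed _ _ _ _) fun y hy =>
    ⟨by simp, fun i hi => ?_⟩
  have := hy.2 i (hB hi)
  simpa [hi, hB hi] using this

lemma BordersBound.vertex {β c a b m : ℕ} {L : ℕ → ℝ} (hb : BordersBound d β c a b L)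
    (hbm : b + m = d) (hm : 2 * m ≤ d - a + 1) : BordersBound d β c a d L := by
  obtain rfl : b = d - m := by omega
  obtain ⟨C, hC, hb⟩ := hb
  refine ⟨2 * C, by positivity, fun κ _ h P B R₀ hz R hR => ?_⟩
  have h1 := hb κ h P B R₀ hz R hR
  have h2 : ((borders h P (R ∪ B) a d).card : ℝ) ≤ 2 * (borders h P (R ∪ B) a (d - m)).card := by
    exact_mod_cast card_borders_vertex_le hz.generic hm
  linarith

lemma BordersBound.edge {β c a b : ℕ} {L : ℕ → ℝ} (hb : BordersBound d β c a d L)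
    (hbd : b + 1 = d) : BordersBound d β c a b L := by
  obtain rfl : b = d - 1 := by omega
  have hd : 0 < d := by omega
  obtain ⟨C, hC, hb⟩ := hb
  refine ⟨d * C, by positivity, fun κ _ h P B R₀ hz R hR => ?_⟩
  have h1 := hb κ h P B R₀ hz R hR
  have h2 : ((borders h P (R ∪ B) a (d - 1)).card : ℝ) ≤ d * (borders h P (R ∪ B) a d).card := by
    exact_mod_cast card_borders_edge_le hz.generic hd (hz.compact_cells subset_union_right)
  refine h2.trans ?_
  rw [mul_assoc, mul_assoc, ← mul_assoc C]
  gcongr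

lemma BordersBound.diag (β c a : ℕ) : BordersBound d β c a a fun _ => 1 := by
  refine ⟨2 ^ d * c, by positivity, fun κ _ h P B R₀ hz R hR => ?_⟩
  have h1 := card_borders_diag_le (R := R ∪ B) (fun x hx i _ => hz.off x hx i) a
  have h2 := hz.cells_le R hR
  have h3 : (borders h P (R ∪ B) a a).card ≤ 2 ^ d * (c * (R.card + 1) ^ (d - 1)) :=
    h1.trans (by gcongr)
  have h4 : ((borders h P (R ∪ B) a a).card : ℝ) ≤
      ((2 ^ d * (c * (R.card + 1) ^ (d - 1)) : ℕ) : ℝ) := by exact_mod_cast h3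
  push_cast at h4
  linarith

/-- Solving the recurrence. -/
lemma BordersBound.recurrence {β c a b : ℕ} {L L' : ℕ → ℝ}
    (hb : BordersBound d β c (a + 1) (b + 1) L)
    (W : ℕ → ℝ) (hW₀ : ∀ n, 0 ≤ W n)
    (hW : ∃ G : ℝ, 0 ≤ G ∧ ∀ n : ℕ, b < n →
      ((n : ℝ) + 1) ^ (d - 1) * L n ≤ G * (((n : ℝ) - b) * n.choose b * (W n - W (n - 1))))
    (hL' : ∀ n, 1 ≤ L' n) (hbd : b ≤ d - 1)
    (hWL : ∀ n : ℕ, (n : ℝ) ^ b * W n ≤ ((n : ℝ) + 1) ^ (d - 1) * L' n) :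
    BordersBound d β c a b L' := by
  obtain ⟨C, hC, hb⟩ := hb
  obtain ⟨G, hG, hW⟩ := hW
  set A : ℝ := (((2 ^ (b + β)) ^ 3 : ℕ) : ℝ)
  refine ⟨A + (a + 1) * C * G, by positivity, fun κ _ h P B R₀ hz R hR => ?_⟩
  have hsmall : ∀ R ⊆ R₀, R.card ≤ b → ((borders h P (R ∪ B) a b).card : ℝ) ≤ A := by
    intro R hR hcard
    refine Nat.cast_le.2 (le_trans (card_borders_le_pow a b) ?_)
    gcongr
    · norm_num
    · exact (card_union_le _ _).trans (add_le_add hcard hz.card_le)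
  rcases lt_or_ge R.card b with hlt | hge
  · refine (hsmall R hR hlt.le).trans ?_
    have h1 : 1 ≤ ((R.card : ℝ) + 1) ^ (d - 1) :=
      one_le_pow₀ (by linarith [Nat.cast_nonneg (α := ℝ) R.card])
    have h2 := hL' R.card
    have h3 : 1 ≤ ((R.card : ℝ) + 1) ^ (d - 1) * L' R.card := one_le_mul_of_one_le_of_one_le h1 h2
    have h4 : 0 ≤ (a + 1) * C * G := by positivity
    rw [mul_assoc]
    calc A = A * 1 := (mul_one A).symm
      _ ≤ (A + (a + 1) * C * G) * (((R.card : ℝ) + 1) ^ (d - 1) * L' R.card) := by gcongr; linarith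
  · have key := recurrence_bound (R₀ := R₀) (N := fun R => ((borders h P (R ∪ B) a b).card : ℝ))
      (g := fun n => (a + 1) * (C * ((n : ℝ) + 1) ^ (d - 1) * L n))
      (W := fun n => (a + 1) * C * G * W n) (A := A) (b := b) ?_ (fun R hR hc => hsmall R hR hc.le)
      (by have := hW₀ b; positivity) ?_ R.card hge R hR rfl
    · refine key.trans ?_
      have h1 : ((R.card.choose b : ℕ) : ℝ) ≤ (R.card : ℝ) ^ b := by
        exact_mod_cast Nat.choose_le_pow _ _
      have h2 : (R.card : ℝ) ^ b ≤ ((R.card : ℝ) + 1) ^ (d - 1) * L' R.card := by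
        calc (R.card : ℝ) ^ b ≤ ((R.card : ℝ) + 1) ^ b := by gcongr; linarith
          _ ≤ ((R.card : ℝ) + 1) ^ (d - 1) := by
            gcongr
            linarith [Nat.cast_nonneg (α := ℝ) R.card]
          _ ≤ _ := le_mul_of_one_le_right (by positivity) (hL' _)
      calc (R.card.choose b : ℝ) * (A + (a + 1) * C * G * W R.card)
          ≤ (R.card : ℝ) ^ b * (A + (a + 1) * C * G * W R.card) := by
            have := hW₀ R.card
            gcongr
        _ = A * (R.card : ℝ) ^ b + (a + 1) * C * G * ((R.card : ℝ) ^ b * W R.card) := by ring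
        _ ≤ A * (((R.card : ℝ) + 1) ^ (d - 1) * L' R.card) +
            (a + 1) * C * G * (((R.card : ℝ) + 1) ^ (d - 1) * L' R.card) := by
            exact add_le_add (mul_le_mul_of_nonneg_left h2 (by positivity))
              (mul_le_mul_of_nonneg_left (hWL _) (by positivity))
        _ = _ := by ring
    · intro R hR hlt
      have h1 := borders_recurrence (h := h) (P := P) (a := a) (b := b)
        (subset_union_left (s₁ := R) (s₂ := B))
      have h2 : ((R.card - b : ℕ) : ℝ) * (borders h P (R ∪ B) a b).card ≤
          ∑ i ∈ R, ((borders h P ((R ∪ B).erase i) a b).card : ℝ) +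
          (a + 1) * (borders h P (R ∪ B) (a + 1) (b + 1)).card := by exact_mod_cast h1
      rw [Nat.cast_sub hlt.le] at h2
      have h3 : ∀ i ∈ R, (R ∪ B).erase i = R.erase i ∪ B := by
        intro i hi
        rw [erase_union_distrib, erase_eq_of_notMem (s := B)]
        exact disjoint_left.1 hz.disj (hR hi)
      rw [sum_congr rfl fun i hi => by rw [h3 i hi]] at h2
      refine h2.trans ?_
      gcongr
      exact hb κ h P B R₀ hz R hR
    · intro n hn
      have := hW n hn
      calc (a + 1) * (C * ((n : ℝ) + 1) ^ (d - 1) * L n)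
          = (a + 1) * C * (((n : ℝ) + 1) ^ (d - 1) * L n) := by ring
        _ ≤ (a + 1) * C * (G * (((n : ℝ) - b) * n.choose b * (W n - W (n - 1)))) := by gcongr
        _ = _ := by ring

/-- The number of vertices of the cells of a zone is `O(n^(d-1) log n)`. -/
theorem bordersBound_vertex (hd : 3 ≤ d) (β c : ℕ) : BordersBound d β c 0 d Λ := by
  obtain ⟨k, rfl⟩ : ∃ k, d = k + 3 := ⟨d - 3, by omega⟩
  have h1 : BordersBound (k + 3) β c (k + 2) (k + 3) fun _ => 1 :=
    (BordersBound.diag β c (k + 2)).vertex (m := 1) (by omega) (by omega)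
  have h2 : BordersBound (k + 3) β c (k + 1) (k + 2) Λ := by
    refine h1.recurrence (L' := Λ) Λ (fun n => zero_le_one.trans (one_le_Λ n)) ?_ one_le_Λ
      (by omega) fun n => ?_
    · obtain ⟨G, hG, hGn⟩ := pow_le_mul_choose (k + 2)
      refine ⟨G, hG, fun n hn => ?_⟩
      obtain ⟨m, rfl⟩ : ∃ m, n = m + 1 := ⟨n - 1, by omega⟩
      have h3 := hGn _ hn
      rw [Nat.add_sub_cancel, Λ_succ, add_sub_cancel_left, mul_one, mul_one_div, ← mul_div_assoc,
        le_div_iff₀ (by positivity)]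
      refine le_trans ?_ h3
      rw [pow_succ _ (k + 2)]
      push_cast
      gcongr
      linarith
    · have := one_le_Λ n
      rw [show k + 3 - 1 = k + 2 from rfl]
      gcongr
      linarith
  have h4 : ∀ j ≤ k, BordersBound (k + 3) β c (k - j + 1) (k + 2) Λ →
      BordersBound (k + 3) β c (k - j) (k + 3) Λ := by
    intro j hj hb
    refine BordersBound.vertex (m := 2) (hb.recurrence (L' := Λ) (fun n => n * Λ n)
      (fun n => mul_nonneg n.cast_nonneg (zero_le_one.trans (one_le_Λ n))) ?_ one_le_Λ
      (by omega) fun n => ?_) (by omega) (by omega)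
    · obtain ⟨G, hG, hGn⟩ := pow_le_mul_choose (k + 1)
      refine ⟨G, hG, fun n hn => ?_⟩
      obtain ⟨m, rfl⟩ : ∃ m, n = m + 1 := ⟨n - 1, by omega⟩
      have h3 := hGn _ hn
      have h5 : Λ (m + 1) ≤
          ((m + 1 : ℕ) : ℝ) * Λ (m + 1) - ((m + 1 - 1 : ℕ) : ℝ) * Λ (m + 1 - 1) := by
        have := Λ_mono (Nat.le_succ m)
        rw [Nat.add_sub_cancel]
        push_cast
        nlinarith [(Nat.cast_nonneg m : (0 : ℝ) ≤ m)]
      have h6 := one_le_Λ (m + 1)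
      calc (((m + 1 : ℕ) : ℝ) + 1) ^ (k + 3 - 1) * Λ (m + 1)
          ≤ G * ((((m + 1 : ℕ) : ℝ) - (k + 1 : ℕ)) * (m + 1).choose (k + 1)) * Λ (m + 1) := by
            gcongr
            exact h3
        _ = G * ((((m + 1 : ℕ) : ℝ) - (k + 1 : ℕ)) * (m + 1).choose (k + 1) * Λ (m + 1)) := by ring
        _ ≤ _ := by
            have : (0 : ℝ) ≤ ((m + 1 : ℕ) : ℝ) - (k + 1 : ℕ) := by
              rw [sub_nonneg]; exact_mod_cast hn.le
            gcongr
    · have := one_le_Λ n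
      rw [← mul_assoc, ← pow_succ, show k + 3 - 1 = k + 1 + 1 from rfl]
      gcongr
      linarith
  have h5 : ∀ j ≤ k, BordersBound (k + 3) β c (k - j) (k + 3) Λ := by
    intro j
    induction j with
    | zero => intro _; exact h4 0 (by omega) h2
    | succ j ih =>
      intro hj
      refine h4 (j + 1) hj ?_
      have := (ih (by omega)).edge (b := k + 2) (by omega)
      rwa [show k - j = k - (j + 1) + 1 by omega] at this
  simpa using h5 k le_rfl

end

section

variable {d : ℕ} {κ : Type*}

/-! ### Bottom-vertex triangulations -/

/-- The simplex with vertices `v` belongs to the bottom-vertex triangulation of the closed face of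
`T`, `Q`; its `k`-th facet flat is cut out by the hyperplane `j k`. -/
def IsSimplex (h : κ → Pt d × ℝ) (R Q : Finset κ) :
    (m : ℕ) → Finset κ → (Fin m → κ) → (Fin (m + 1) → Pt d) → Prop
  | 0, T, _, v => IsLexMin (face h R T Q) (v 0)
  | m + 1, T, j, v => IsLexMin (face h R T Q) (v 0) ∧ j 0 ∈ R ∧ ev h (j 0) (v 0) ≠ 0 ∧
      IsSimplex h R Q m (insert (j 0) T) (fun k => j k.succ) (fun k => v k.succ)

variable {h : κ → Pt d × ℝ} {R Q : Finset κ}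

lemma IsSimplex.isLexMin_zero {m : ℕ} {T : Finset κ} {j : Fin m → κ} {v : Fin (m + 1) → Pt d}
    (hv : IsSimplex h R Q m T j v) : IsLexMin (face h R T Q) (v 0) := by
  cases m with
  | zero => exact hv
  | succ m => exact hv.1

lemma face_subset {T T' : Finset κ} (hT : T ⊆ T') : face h R T' Q ⊆ face h R T Q :=
  fun _ hx => ⟨fun i hi => hx.1 i (hT hi), hx.2⟩

lemma IsSimplex.mem_face {m : ℕ} : ∀ {T : Finset κ} {j : Fin m → κ} {v : Fin (m + 1) → Pt d},
    IsSimplex h R Q m T j v → ∀ k, v k ∈ face h R T Q := by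
  induction m with
  | zero =>
    intro T j v hv k
    rw [Fin.fin_one_eq_zero k]
    exact hv.1
  | succ m ih =>
    intro T j v hv k
    refine Fin.cases hv.1.1 (fun k => ?_) k
    exact face_subset (subset_insert _ _) (ih hv.2.2.2 k)

lemma IsSimplex.unique {m : ℕ} : ∀ {T : Finset κ} {j : Fin m → κ} {v v' : Fin (m + 1) → Pt d},
    IsSimplex h R Q m T j v → IsSimplex h R Q m T j v' → v = v' := by
  induction m with
  | zero =>
    intro T j v v' hv hv'
    funext k
    rw [Fin.fin_one_eq_zero k]
    exact hv.isLexMin_zero.unique hv'.isLexMin_zero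
  | succ m ih =>
    intro T j v v' hv hv'
    have := ih hv.2.2.2 hv'.2.2.2
    funext k
    refine Fin.cases (hv.1.unique hv'.1) (fun k => ?_) k
    exact congrFun this k

lemma IsSimplex.not_mem {m : ℕ} {T : Finset κ} {j : Fin (m + 1) → κ} {v : Fin (m + 1 + 1) → Pt d}
    (hv : IsSimplex h R Q (m + 1) T j v) : j 0 ∉ T := fun h' => hv.2.2.1 (hv.1.1.1 _ h')

/-- Only the relevant part of the arrangement matters for a simplex. -/
lemma IsSimplex.restrict {R' Q' : Finset κ} (hR : R' ⊆ R) (hQ : Q' = Q ∩ R') {m : ℕ} :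
    ∀ {T : Finset κ} {j : Fin m → κ} {v : Fin (m + 1) → Pt d}, T ⊆ R' →
    IsSimplex h R Q m T j v → (∀ k, zeros h R (v k) ⊆ R') → (∀ k, j k ∈ R') →
    IsSimplex h R' Q' m T j v := by
  have hface : ∀ T, face h R T Q ⊆ face h R' T Q' := by
    refine fun T x hx => ⟨hx.1, fun i hi => ?_⟩
    have := hx.2 i (hR hi)
    simpa [hQ, hi] using this
  have hlex : ∀ {T : Finset κ} {w : Pt d}, IsLexMin (face h R T Q) w →
      zeros h R w ⊆ R' → IsLexMin (face h R' T Q') w := by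
    intro T w hw hz
    refine ⟨hface T hw.1, fun y hy hne => ?_⟩
    have hin : ∀ i, ev h i w = 0 → ⟪y - w, (h i).1⟫ = ev h i y := by
      intro i h0
      simp only [ev] at h0 ⊢
      rw [inner_sub_left]; linarith
    have hev := eventually_mem_face h hw.1 (e := y - w)
      (fun i hi => by rw [hin i (hw.1.1 i hi), hy.1 i hi]) fun i hi => by
        rw [hin i ((mem_zeros h).1 hi).2]
        have := hy.2 i (hz hi)
        simpa [hQ, hz hi] using this
    obtain ⟨t, ht, ht0 : 0 < t⟩ := (hev.and self_mem_nhdsWithin).exists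
    have := hw.2 _ ht (by simp [ht0.ne', sub_eq_zero, hne])
    rw [add_sub_cancel_left] at this
    have h2 := this.smul (inv_pos.2 ht0)
    rwa [smul_smul, inv_mul_cancel₀ ht0.ne', one_smul] at h2
  induction m with
  | zero => exact fun _ hv hz _ => hlex hv (hz 0)
  | succ m ih =>
    intro T j v hT hv hz hj
    exact ⟨hlex hv.1 (hz 0), hj 0, hv.2.2.1,
      ih (insert_subset (hj 0) hT) hv.2.2.2 (fun k => hz k.succ) fun k => hj k.succ⟩

lemma exists_exit {T : Finset κ} {w y : Pt d} (hc : IsCompact (face h R T Q))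
    (hw : w ∈ face h R T Q) (hy : y ∈ face h R T Q) (hne : y ≠ w) :
    ∃ s : ℝ, 1 ≤ s ∧ ∃ j ∈ R, ev h j w ≠ 0 ∧ w + s • (y - w) ∈ face h R (insert j T) Q := by
  set γ : ℝ → Pt d := fun s => w + s • (y - w)
  have hγ : Continuous γ := by fun_prop
  have hS : IsCompact (γ ⁻¹' face h R T Q ∩ Set.Ici 1) := by
    obtain ⟨r, hr⟩ := hc.isBounded.subset_closedBall w
    have hpos : 0 < ‖y - w‖ := norm_pos_iff.2 (sub_ne_zero.2 hne)
    refine (isCompact_Icc (a := (1 : ℝ)) (b := r / ‖y - w‖)).of_isClosed_subset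
      (((face_closed h R T Q).preimage hγ).inter isClosed_Ici) fun s hs => ⟨hs.2, ?_⟩
    have h1 := hr hs.1
    have h2 : (1 : ℝ) ≤ s := hs.2
    rw [Metric.mem_closedBall, dist_eq_norm, add_sub_cancel_left, norm_smul, Real.norm_eq_abs,
      abs_of_nonneg (by linarith)] at h1
    rwa [le_div_iff₀ hpos]
  obtain ⟨s, ⟨hs, hs1⟩, hmax⟩ := hS.exists_isMaxOn ⟨1, by simpa [γ] using hy, Set.mem_Ici.2 le_rfl⟩
    continuousOn_id
  have hs1 : (1 : ℝ) ≤ s := hs1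
  refine ⟨s, hs1, ?_⟩
  by_contra! hno
  have hz : ∀ i ∈ zeros h R (γ s), ⟪y - w, (h i).1⟫ = 0 := by
    intro i hi
    rw [mem_zeros] at hi
    by_contra h0
    have hevw : ev h i w ≠ 0 := by
      intro h1
      have h2 := hi.2
      simp only [γ] at h2
      rw [ev_add_smul, h1, zero_add] at h2
      rcases mul_eq_zero.1 h2 with h3 | h3
      · linarith
      · exact h0 h3
    refine hno i hi.1 hevw ⟨fun k hk => ?_, hs.2⟩
    rcases mem_insert.1 hk with rfl | hk
    · exact hi.2
    · exact hs.1 k hk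
  have hev := eventually_mem_face h hs (e := y - w) (fun i hi => by
      have h1 := hw.1 i hi
      have h2 := hy.1 i hi
      simp only [ev] at h1 h2
      rw [inner_sub_left]; linarith) (fun i hi => by simp [hz i hi])
  obtain ⟨t, ht, ht0 : 0 < t⟩ := (hev.and self_mem_nhdsWithin).exists
  have hst : γ (s + t) = γ s + t • (y - w) := by simp only [γ]; module
  have : s + t ≤ s := hmax ⟨by rw [Set.mem_preimage, hst]; exact ht, by
    change (1 : ℝ) ≤ s + t; linarith⟩
  linarith

variable [Fintype κ]


/-- The simplices cover a bounded face. -/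
lemma exists_isSimplex (hG : Generic h) {m : ℕ} : ∀ {T : Finset κ}, T ⊆ R → T.card + m = d →
    IsCompact (face h R T Q) → ∀ y ∈ face h R T Q,
    ∃ j v, IsSimplex h R Q m T j v ∧ y ∈ convexHull ℝ (Set.range v) := by
  induction m with
  | zero =>
    intro T hT hcard hc y hy
    obtain ⟨w, hw⟩ := exists_isLexMin hc ⟨y, hy⟩
    have : y = w := eq_of_ev_eq_zero hG (by omega) hy.1 hw.1.1
    refine ⟨Fin.elim0, fun _ => w, hw, subset_convexHull _ _ ⟨0, this.symm⟩⟩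
  | succ m ih =>
    intro T hT hcard hc y hy
    obtain ⟨w, hw⟩ := exists_isLexMin hc ⟨y, hy⟩
    have main : ∀ y ∈ face h R T Q, y ≠ w →
        ∃ j v, IsSimplex h R Q (m + 1) T j v ∧ y ∈ convexHull ℝ (Set.range v) ∧ v 0 = w := by
      intro y hy hne
      obtain ⟨s, hs, j₀, hj₀, hjw, hmem⟩ := exists_exit hc hw.1 hy hne
      have hj₀T : j₀ ∉ T := fun h' => hjw (hw.1.1 _ h')
      obtain ⟨j, v, hv, hy'⟩ := ih (T := insert j₀ T) (insert_subset hj₀ hT)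
        (by rw [card_insert_of_notMem hj₀T]; omega)
        (hc.of_isClosed_subset (face_closed _ _ _ _) (face_subset (subset_insert _ _))) _ hmem
      refine ⟨Fin.cons j₀ j, Fin.cons w v, ⟨hw, by simpa using hj₀, by simpa using hjw,
        by simpa using hv⟩, ?_, by simp⟩
      have h1 : w ∈ convexHull ℝ (Set.range (Fin.cons w v : Fin (m + 1 + 1) → Pt d)) :=
        subset_convexHull _ _ ⟨0, by simp⟩
      have h2 : w + s • (y - w) ∈
          convexHull ℝ (Set.range (Fin.cons w v : Fin (m + 1 + 1) → Pt d)) :=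
        convexHull_mono (by rw [Fin.range_cons]; exact Set.subset_insert _ _) hy'
      have hs0 : s ≠ 0 := by linarith
      have h3 := (convex_convexHull ℝ _).add_smul_sub_mem h1 h2
        (t := s⁻¹) ⟨by positivity, inv_le_one_of_one_le₀ hs⟩
      rwa [add_sub_cancel_left, smul_smul, inv_mul_cancel₀ hs0, one_smul, add_sub_cancel] at h3
    by_cases hyw : y = w
    · have hZ := card_zeros_of_isLexMin hG hT hw
      obtain ⟨e, he⟩ := exists_inner_eq h (hG.indep _ hZ.le)
        fun i => if i ∈ T then 0 else if i ∈ Q then 1 else -1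
      have he0 : e ≠ 0 := by
        rintro rfl
        obtain ⟨i, hi, hiT⟩ := exists_mem_notMem_of_card_lt_card
          (show T.card < (zeros h R w).card by omega)
        have := he i hi
        rw [inner_zero_left, if_neg hiT] at this
        split_ifs at this <;> norm_num at this
      have hTz : T ⊆ zeros h R w := fun i hi => (mem_zeros h).2 ⟨hT hi, hw.1.1 i hi⟩
      have hev := eventually_mem_face h hw.1 (e := e) (fun i hi => by rw [he i (hTz hi), if_pos hi])
        fun i hi => by
          rw [he i hi]
          by_cases h1 : i ∈ T <;> by_cases h2 : i ∈ Q <;> simp [h1, h2]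
      obtain ⟨t, ht, ht0 : 0 < t⟩ := (hev.and self_mem_nhdsWithin).exists
      obtain ⟨j, v, hv, -, hv0⟩ := main _ ht (by simp [ht0.ne', he0])
      exact ⟨j, v, hv, subset_convexHull _ _ ⟨0, by rw [hv0, hyw]⟩⟩
    · obtain ⟨j, v, hv, hy', -⟩ := main y hy hyw
      exact ⟨j, v, hv, hy'⟩

lemma IsSimplex.mem_of_forall_ev_eq_zero (hG : Generic h) {m : ℕ} :
    ∀ {T : Finset κ} {j : Fin m → κ} {v : Fin (m + 1) → Pt d}, T ⊆ R → T.card + m = d →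
    IsSimplex h R Q m T j v → ∀ i ∈ R, (∀ k, ev h i (v k) = 0) → i ∈ T := by
  induction m with
  | zero =>
    intro T j v hT hcard hv i hi h0
    have hsub : T ⊆ zeros h R (v 0) := fun k hk => (mem_zeros h).2 ⟨hT hk, hv.1.1 k hk⟩
    have := eq_of_subset_of_card_le hsub (by have := card_zeros_le hG R (v 0); omega)
    rw [this]
    exact (mem_zeros h).2 ⟨hi, h0 0⟩
  | succ m ih =>
    intro T j v hT hcard hv i hi h0
    have := ih (insert_subset hv.2.1 hT) (by rw [card_insert_of_notMem hv.not_mem]; omega)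
      hv.2.2.2 i hi fun k => h0 k.succ
    rcases mem_insert.1 this with rfl | h'
    · exact absurd (h0 0) hv.2.2.1
    · exact h'

/-- Points with positive barycentric coordinates lie in the relative interior of the face. -/
lemma IsSimplex.inFace (hG : Generic h) {m : ℕ} {T : Finset κ} {j : Fin m → κ}
    {v : Fin (m + 1) → Pt d} (hT : T ⊆ R) (hcard : T.card + m = d) (hv : IsSimplex h R Q m T j v)
    {w : Fin (m + 1) → ℝ} (hw : ∀ k, 0 < w k) (hw1 : ∑ k, w k = 1) :
    InFace h R T Q (∑ k, w k • v k) := by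
  refine ⟨fun i hi => ?_, fun i hi hiT => ?_⟩
  · rw [ev_sum h _ _ _ hw1]
    exact sum_eq_zero fun k _ => by rw [(hv.mem_face k).1 i hi, mul_zero]
  · have hex : ∃ k, ev h i (v k) ≠ 0 := by
      by_contra! hall
      exact hiT (hv.mem_of_forall_ev_eq_zero hG hT hcard i hi hall)
    obtain ⟨k, hk⟩ := hex
    rw [ev_sum h _ _ _ hw1]
    refine ⟨fun hQ => ?_, fun hQ => ?_⟩
    · exact sum_pos' (fun l _ => mul_nonneg (hw l).le (((hv.mem_face l).2 i hi).1 hQ))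
        ⟨k, mem_univ _, mul_pos (hw k) (lt_of_le_of_ne (((hv.mem_face k).2 i hi).1 hQ) hk.symm)⟩
    · exact sum_neg' (fun l _ => mul_nonpos_of_nonneg_of_nonpos (hw l).le
        (((hv.mem_face l).2 i hi).2 hQ))
        ⟨k, mem_univ _, mul_neg_of_pos_of_neg (hw k)
          (lt_of_le_of_ne (((hv.mem_face k).2 i hi).2 hQ) hk)⟩

/-- Distinct simplices of the triangulation of a face are disjoint. -/
lemma IsSimplex.eq_of_mem (hG : Generic h) {m : ℕ} :
    ∀ {T : Finset κ} {j j' : Fin m → κ} {v v' : Fin (m + 1) → Pt d}, T ⊆ R → T.card + m = d →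
    IsSimplex h R Q m T j v → IsSimplex h R Q m T j' v' → ∀ {w w' : Fin (m + 1) → ℝ},
    (∀ k, 0 < w k) → (∀ k, 0 < w' k) → ∑ k, w k = 1 → ∑ k, w' k = 1 →
    ∑ k, w k • v k = ∑ k, w' k • v' k → v = v' := by
  induction m with
  | zero =>
    intro T j j' v v' hT hcard hv hv' w w' hw hw' hw1 hw1' heq
    funext k
    rw [Fin.fin_one_eq_zero k]
    exact hv.isLexMin_zero.unique hv'.isLexMin_zero
  | succ m ih =>
    intro T j j' v v' hT hcard hv hv' w w' hw hw' hw1 hw1' heq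
    have h0 : v 0 = v' 0 := hv.1.unique hv'.1
    have reduce : ∀ {j : Fin (m + 1) → κ} {v : Fin (m + 1 + 1) → Pt d} {w : Fin (m + 1 + 1) → ℝ},
        IsSimplex h R Q (m + 1) T j v → (∀ k, 0 < w k) → ∑ k, w k = 1 →
        ∃ c : ℝ, 0 < c ∧ ∃ u : Fin (m + 1) → ℝ, (∀ k, 0 < u k) ∧ ∑ k, u k = 1 ∧
          ∑ k, w k • v k - v 0 = c • (∑ k, u k • v k.succ - v 0) ∧
          InFace h R (insert (j 0) T) Q (∑ k, u k • v k.succ) := by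
      intro j v w hv hw hw1
      set c := ∑ k : Fin (m + 1), w k.succ
      have hc : 0 < c := sum_pos (fun k _ => hw _) univ_nonempty
      have hu1 : ∑ k : Fin (m + 1), w k.succ / c = 1 := by
        rw [← sum_div]; exact div_self hc.ne'
      refine ⟨c, hc, fun k => w k.succ / c, fun k => div_pos (hw _) hc, hu1, ?_,
        hv.2.2.2.inFace hG (insert_subset hv.2.1 hT)
          (by rw [card_insert_of_notMem hv.not_mem]; omega) (fun k => div_pos (hw _) hc) hu1⟩
      rw [Fin.sum_univ_succ] at hw1
      rw [Fin.sum_univ_succ, smul_sub, smul_sum]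
      have hcw : ∀ k : Fin (m + 1), c * (w k.succ / c) = w k.succ := fun k => by field_simp
      simp only [smul_smul, hcw]
      have : w 0 = 1 - c := by linarith
      rw [this]; module
    obtain ⟨c, hc, u, hu, hu1, hcu, hf⟩ := reduce hv hw hw1
    obtain ⟨c', hc', u', hu', hu1', hcu', hf'⟩ := reduce hv' hw' hw1'
    set z := ∑ k, u k • v k.succ
    set z' := ∑ k, u' k • v' k.succ
    rw [heq, h0, hcu'] at hcu
    have hle : ∀ {j : Fin (m + 1) → κ} {z z' p : Pt d} {c c' : ℝ} {T' : Finset κ}, 0 < c → 0 < c' →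
        p ∈ face h R T Q → j 0 ∈ R → ev h (j 0) p ≠ 0 → InFace h R (insert (j 0) T) Q z →
        InFace h R T' Q z' → c' • (z' - p) = c • (z - p) → c ≤ c' := by
      intro j z z' p c c' T' hc hc' hp hj hjp hz hz' heq
      have h1 : c' * (ev h (j 0) z' - ev h (j 0) p) = c * (ev h (j 0) z - ev h (j 0) p) := by
        have := congrArg (fun x : Pt d => ⟪x, (h (j 0)).1⟫) heq
        simp only [real_inner_smul_left, inner_sub_left] at this
        simp only [ev]
        linarith
      rw [hz.1 _ (mem_insert_self _ _)] at h1
      have h2 := hz'.mem_face.2 _ hj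
      have h3 := hp.2 _ hj
      by_cases hQ : j 0 ∈ Q
      · have a1 := h2.1 hQ
        have a2 := lt_of_le_of_ne (h3.1 hQ) hjp.symm
        by_contra! hlt
        nlinarith [mul_nonneg hc'.le a1]
      · have a1 := h2.2 hQ
        have a2 := lt_of_le_of_ne (h3.2 hQ) hjp
        by_contra! hlt
        nlinarith [mul_nonpos_of_nonneg_of_nonpos hc'.le a1]
    have hcc : c = c' := le_antisymm
      (hle hc hc' hv'.1.1 hv.2.1 (h0 ▸ hv.2.2.1) hf hf' hcu)
      (hle hc' hc hv'.1.1 hv'.2.1 hv'.2.2.1 hf' hf hcu.symm)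
    have hzz : z = z' := by
      rw [hcc] at hcu
      have := smul_right_injective _ hc'.ne' hcu
      simpa using this.symm
    have hT1 := hf.zeros_eq (insert_subset hv.2.1 hT)
    have hT2 := hf'.zeros_eq (insert_subset hv'.2.1 hT)
    rw [hzz, hT2] at hT1
    have hj : j 0 = j' 0 := by
      have : j' 0 ∈ insert (j 0) T := hT1 ▸ mem_insert_self _ _
      rcases mem_insert.1 this with h' | h'
      · exact h'.symm
      · exact absurd h' hv'.not_mem
    have htail := ih (insert_subset hv.2.1 hT)
      (by rw [card_insert_of_notMem hv.not_mem]; omega) hv.2.2.2 (hj ▸ hv'.2.2.2)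
        hu hu' hu1 hu1' hzz
    funext k
    exact Fin.cases h0 (fun k => congrFun htail k) k

omit [Fintype κ] in
lemma IsSimplex.eq_zero_of_sum {m : ℕ} :
    ∀ {T : Finset κ} {j : Fin m → κ} {v : Fin (m + 1) → Pt d}, IsSimplex h R Q m T j v →
    ∀ w : Fin (m + 1) → ℝ, ∑ k, w k = 0 → ∑ k, w k • v k = 0 → ∀ k, w k = 0 := by
  induction m with
  | zero =>
    intro T j v hv w hw _ k
    rw [Fin.fin_one_eq_zero k]
    simpa using hw
  | succ m ih =>
    intro T j v hv w hw hwv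
    have hj : ∀ k : Fin (m + 1), ev h (j 0) (v k.succ) = 0 := fun k =>
      (hv.2.2.2.mem_face k).1 _ (mem_insert_self _ _)
    have h0 : w 0 = 0 := by
      have h1 : ∑ k, w k * ev h (j 0) (v k) = 0 := by
        have h2 : ∑ k, w k * ⟪v k, (h (j 0)).1⟫ = 0 := by
          have := congrArg (fun x : Pt d => ⟪x, (h (j 0)).1⟫) hwv
          simpa [sum_inner, real_inner_smul_left] using this
        simp only [ev, mul_sub, sum_sub_distrib, ← sum_mul, hw, h2]
        simp
      rw [Fin.sum_univ_succ, sum_eq_zero (fun k _ => by rw [hj k, mul_zero]), add_zero] at h1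
      exact (mul_eq_zero.1 h1).resolve_right hv.2.2.1
    rw [Fin.sum_univ_succ, h0, zero_add] at hw
    rw [Fin.sum_univ_succ, h0, zero_smul, zero_add] at hwv
    intro k
    exact Fin.cases h0 (fun k => ih hv.2.2.2 _ hw hwv k) k

omit [Fintype κ] in
lemma IsSimplex.affineIndependent {m : ℕ} {T : Finset κ} {j : Fin m → κ} {v : Fin (m + 1) → Pt d}
    (hv : IsSimplex h R Q m T j v) : AffineIndependent ℝ v := by
  rw [affineIndependent_iff_of_fintype]
  intro w hw hwv
  refine hv.eq_zero_of_sum w hw ?_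
  rwa [Finset.weightedVSub_eq_linear_combination _ hw] at hwv

end

section

variable {d : ℕ} {κ : Type*}

/-! ### Polyhedra -/

/-- The polyhedron cut out by the halfspaces `⟪x, a⟫ ≤ b` for `(a, b)` in the family `q`. -/
def poly {α : Type*} (q : α → Pt d × ℝ) : Set (Pt d) := {x | ∀ k, ⟪x, (q k).1⟫ ≤ (q k).2}


lemma poly_closed {α : Type*} (q : α → Pt d × ℝ) : IsClosed (poly q) := by
  rw [poly, Set.ofPred_forall]
  exact isClosed_iInter fun k => isClosed_le (by fun_prop) continuous_const

lemma norm_eq_one_cases {q : Pt d × ℝ} (hq : ‖q‖ = 1) (h0 : q.1 = 0) : q.2 = 1 ∨ q.2 = -1 := by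
  have : max ‖q.1‖ ‖q.2‖ = 1 := hq
  rw [h0, norm_zero, max_eq_right (norm_nonneg _), Real.norm_eq_abs] at this
  exact eq_or_eq_neg_of_abs_eq this

lemma isOpen_strict_poly {α : Type*} [Finite α] (q : α → Pt d × ℝ) :
    IsOpen {x : Pt d | ∀ k, ⟪x, (q k).1⟫ < (q k).2} := by
  rw [Set.ofPred_forall]
  exact isOpen_iInter_of_finite fun k => isOpen_lt (by fun_prop) continuous_const

lemma interior_poly {α : Type*} [Finite α] {q : α → Pt d × ℝ} (hq : ∀ k, ‖q k‖ = 1) :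
    interior (poly q) = {x | ∀ k, ⟪x, (q k).1⟫ < (q k).2} := by
  refine subset_antisymm (fun x hx k => ?_)
    (interior_maximal (fun x hx k => (hx k).le) (isOpen_strict_poly q))
  by_cases h0 : (q k).1 = 0
  · have h1 := interior_subset hx k
    rw [h0, inner_zero_right] at h1 ⊢
    rcases norm_eq_one_cases (hq k) h0 with h2 | h2 <;> linarith
  · have hlim : Tendsto (fun t : ℝ => x + t • (q k).1) (𝓝[>] 0) (𝓝 x) := by
      have : Continuous fun t : ℝ => x + t • (q k).1 := by fun_prop
      simpa using (this.tendsto 0).mono_left nhdsWithin_le_nhds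
    obtain ⟨t, ht, ht0 : 0 < t⟩ :=
      ((hlim.eventually (mem_interior_iff_mem_nhds.1 hx)).and self_mem_nhdsWithin).exists
    have h1 := ht k
    rw [inner_add_left, real_inner_smul_left] at h1
    have h2 : 0 < ⟪(q k).1, (q k).1⟫ := real_inner_self_pos.2 h0
    nlinarith [mul_pos ht0 h2]

/-- A nondegenerate simplex is an intersection of `d + 1` halfspaces. -/
lemma exists_poly_eq_convexHull {v : Fin (d + 1) → Pt d}
    (hv : AffineIndependent ℝ v) :
    ∃ q : Fin (d + 1) → Pt d × ℝ, (∀ k, ‖q k‖ = 1) ∧ poly q = convexHull ℝ (Set.range v) ∧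
      ∀ x, x ∈ interior (poly q) →
        ∃ w : Fin (d + 1) → ℝ, (∀ k, 0 < w k) ∧ ∑ k, w k = 1 ∧ ∑ k, w k • v k = x := by
  have hspan : affineSpan ℝ (Set.range v) = ⊤ :=
    hv.affineSpan_eq_top_iff_card_eq_finrank_add_one.2 (by simp)
  set b : AffineBasis (Fin (d + 1)) ℝ (Pt d) := ⟨v, hv, hspan⟩
  have hbv : ∀ k, b k = v k := fun k => rfl
  have hex : ∀ k, ∃ q : Pt d × ℝ, ‖q‖ = 1 ∧ ∃ c : ℝ, 0 < c ∧
      ∀ x, q.2 - ⟪x, q.1⟫ = c * b.coord k x := by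
    intro k
    set L := (b.coord k).linear
    set a : Pt d := (InnerProductSpace.toDual ℝ (Pt d)).symm (LinearMap.toContinuousLinearMap L)
    have ha : ∀ x, ⟪x, a⟫ = L x := fun x => by
      rw [real_inner_comm, InnerProductSpace.toDual_symm_apply]; rfl
    have hL : ∀ x, b.coord k x = ⟪x, a⟫ + b.coord k 0 := fun x => by
      rw [ha]
      have := (b.coord k).map_vadd 0 x
      rwa [vadd_eq_add, add_zero, vadd_eq_add] at this
    set q₀ : Pt d × ℝ := (-a, b.coord k 0)
    have hq₀ : q₀ ≠ 0 := by
      intro h0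
      have h1 : -a = 0 := congrArg Prod.fst h0
      have h2 : b.coord k 0 = 0 := congrArg Prod.snd h0
      have h3 := hL (b k)
      rw [b.coord_apply_eq, neg_eq_zero.1 h1, h2] at h3
      simp at h3
    have hpos : 0 < ‖q₀‖ := norm_pos_iff.2 hq₀
    refine ⟨‖q₀‖⁻¹ • q₀, ?_, ‖q₀‖⁻¹, inv_pos.2 hpos, fun x => ?_⟩
    · rw [norm_smul, norm_inv, norm_norm, inv_mul_cancel₀ hpos.ne']
    · rw [hL]
      simp only [q₀, Prod.smul_fst, Prod.smul_snd, smul_eq_mul, real_inner_smul_right,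
        inner_neg_right]
      ring
  choose q hq c hc hqc using hex
  have hpoly : poly q = convexHull ℝ (Set.range v) := by
    have h1 := b.convexHull_eq_nonneg_coord
    change convexHull ℝ (Set.range v) = _ at h1
    rw [h1]
    ext x
    refine forall_congr' fun k => ?_
    rw [← sub_nonneg, hqc, mul_nonneg_iff_of_pos_left (hc k)]
  refine ⟨q, hq, hpoly, fun x hx => ⟨fun k => b.coord k x, fun k => ?_,
    b.sum_coord_apply_eq_one x, b.linear_combination_coord_eq_self x⟩⟩
  rw [interior_poly hq] at hx
  have := hx k
  rw [← sub_pos, hqc] at this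
  exact (mul_pos_iff_of_pos_left (hc k)).1 this

/-- The hyperplanes of `R` with points of `S` strictly on both sides. -/
def crossing (h : κ → Pt d × ℝ) (R : Finset κ) (S : Set (Pt d)) : Finset κ :=
  R.filter fun i => ∃ x ∈ S, ∃ y ∈ S, 0 < ev h i x ∧ ev h i y < 0

/-! ### The simplices of a set of cells -/

section

variable {h : κ → Pt d × ℝ} {R Q : Finset κ}

lemma IsSimplex.mem_zeros_last {m : ℕ} : ∀ {T : Finset κ} {j : Fin m → κ} {v : Fin (m + 1) → Pt d},
    IsSimplex h R Q m T j v → ∀ k, j k ∈ zeros h R (v (Fin.last m)) := by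
  induction m with
  | zero => exact fun _ k => k.elim0
  | succ m ih =>
    intro T j v hv k
    refine Fin.cases ?_ (fun k => ?_) k
    · rw [mem_zeros]
      exact ⟨hv.2.1, (hv.2.2.2.mem_face (Fin.last m)).1 _ (mem_insert_self _ _)⟩
    · exact ih hv.2.2.2 k

lemma IsSimplex.card_zeros [Fintype κ] (hG : Generic h) {m : ℕ} :
    ∀ {T : Finset κ} {j : Fin m → κ} {v : Fin (m + 1) → Pt d}, T ⊆ R →
    IsSimplex h R Q m T j v → ∀ k, (zeros h R (v k)).card = d := by
  induction m with
  | zero =>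
    intro T j v hT hv k
    rw [Fin.fin_one_eq_zero k]
    exact card_zeros_of_isLexMin hG hT hv
  | succ m ih =>
    intro T j v hT hv k
    exact Fin.cases (card_zeros_of_isLexMin hG hT hv.1)
      (fun k => ih (insert_subset hv.2.1 hT) hv.2.2.2 k) k

end

lemma finite_simplices [Finite κ] (h : κ → Pt d × ℝ) (P : Finset (Pt d)) (R : Finset κ) :
    {v : Fin (d + 1) → Pt d | ∃ Q ∈ cells h P R, ∃ j, IsSimplex h R Q d ∅ j v}.Finite := by
  have : {v : Fin (d + 1) → Pt d | ∃ Q ∈ cells h P R, ∃ j, IsSimplex h R Q d ∅ j v} =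
      ⋃ Q ∈ cells h P R, ⋃ j, {v | IsSimplex h R Q d ∅ j v} := by ext; simp
  rw [this]
  exact (cells h P R).finite_toSet.biUnion fun Q _ => Set.finite_iUnion fun j =>
    Set.Subsingleton.finite fun v hv v' hv' => hv.unique hv'

/-- The simplices of the bottom-vertex triangulations of the cells of `P`. -/
def simplices [Finite κ] (h : κ → Pt d × ℝ) (P : Finset (Pt d)) (R : Finset κ) :
    Finset (Fin (d + 1) → Pt d) := (finite_simplices h P R).toFinset

/-- The hyperplanes through the vertices of a simplex. -/
def defining [Fintype κ] (h : κ → Pt d × ℝ) (v : Fin (d + 1) → Pt d) : Finset κ :=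
  univ.biUnion fun k => zeros h univ (v k)

section

variable [Fintype κ] {h : κ → Pt d × ℝ} {P : Finset (Pt d)} {R : Finset κ}

lemma mem_simplices {v : Fin (d + 1) → Pt d} :
    v ∈ simplices h P R ↔ ∃ Q ∈ cells h P R, ∃ j, IsSimplex h R Q d ∅ j v := by
  simp [simplices]

lemma card_simplices_le (hG : Generic h) :
    (simplices h P R).card ≤ (borders h P R 0 d).card * d ^ d := by
  have hex : ∀ v ∈ simplices h P R, ∃ x : (_ : Finset κ × Finset κ × Finset κ) × (Fin d → κ),
      x ∈ (borders h P R 0 d).sigma (fun q => Fintype.piFinset fun _ : Fin d => q.2.1) ∧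
      IsSimplex h R x.1.2.2 d ∅ x.2 v := by
    intro v hv
    obtain ⟨Q, hQ, j, hj⟩ := mem_simplices.1 hv
    refine ⟨⟨(∅, zeros h R (v (Fin.last d)), Q), j⟩, ?_, hj⟩
    rw [mem_sigma, mem_borders, Fintype.mem_piFinset]
    refine ⟨⟨⟨empty_subset _, zeros_subset _ _ _, ?_, disjoint_empty_left _,
      ⟨_, inFace_zeros (hj.mem_face _)⟩, fun U hU => ?_⟩, card_empty,
      hj.card_zeros hG (empty_subset _) _⟩, fun k => hj.mem_zeros_last k⟩
    · obtain ⟨x, -, rfl⟩ := mem_image.1 hQ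
      exact filter_subset _ _
    · rw [subset_empty.1 hU, union_empty]
      exact hQ
  rcases (simplices h P R).eq_empty_or_nonempty with h0 | ⟨v₀, hv₀⟩
  · simp [h0]
  have : Nonempty ((_ : Finset κ × Finset κ × Finset κ) × (Fin d → κ)) :=
    ⟨(hex v₀ hv₀).choose⟩
  choose! f hf hfv using hex
  refine (card_le_card_of_injOn f hf fun v hv v' hv' heq => ?_).trans ?_
  · have h1 := hfv v hv
    rw [heq] at h1
    exact h1.unique (hfv v' hv')
  · rw [card_sigma]
    refine sum_le_card_nsmul _ _ _ fun q hq => ?_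
    rw [Fintype.card_piFinset_const, (mem_borders.1 hq).2.2]

lemma card_defining_le (hG : Generic h) (v : Fin (d + 1) → Pt d) :
    (defining h v).card ≤ (d + 1) * d := by
  refine card_biUnion_le.trans ((sum_le_card_nsmul _ _ d fun k _ => hG.card_zeros _).trans ?_)
  simp

lemma defining_subset (hG : Generic h) {v : Fin (d + 1) → Pt d} (hv : v ∈ simplices h P R) :
    defining h v ⊆ R := by
  obtain ⟨Q, -, j, hj⟩ := mem_simplices.1 hv
  refine biUnion_subset.2 fun k _ => ?_
  have h1 : zeros h R (v k) ⊆ zeros h univ (v k) := fun i hi => by simp_all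
  rw [← eq_of_subset_of_card_le h1
    ((hG.card_zeros _).trans (hj.card_zeros hG (empty_subset _) k).ge)]
  exact zeros_subset _ _ _

lemma mem_simplices_of_subset {v : Fin (d + 1) → Pt d} (hv : v ∈ simplices h P R)
    {R' : Finset κ} (hR : R' ⊆ R) (hD : defining h v ⊆ R') : v ∈ simplices h P R' := by
  obtain ⟨Q, hQ, j, hj⟩ := mem_simplices.1 hv
  obtain ⟨x, hx, rfl⟩ := mem_image.1 hQ
  have hz : ∀ k, zeros h R (v k) ⊆ R' := fun k i hi => hD (mem_biUnion.2 ⟨k, mem_univ _, by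
    simp only [mem_zeros] at hi ⊢; exact ⟨mem_univ _, hi.2⟩⟩)
  refine mem_simplices.2 ⟨_, mem_image_of_mem _ hx, j, hj.restrict hR ?_ (empty_subset _) hz
    fun k => hz _ (hj.mem_zeros_last k)⟩
  ext i
  simp only [mem_signs, mem_inter]
  exact ⟨fun hi => ⟨⟨hR hi.1, hi.2⟩, hi.1⟩, fun hi => ⟨hi.2, hi.1.2⟩⟩

lemma disjoint_crossing {v : Fin (d + 1) → Pt d} (hv : v ∈ simplices h P R) (U : Finset κ) :
    Disjoint (crossing h U (convexHull ℝ (Set.range v))) R := by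
  obtain ⟨Q, hQ, j, hj⟩ := mem_simplices.1 hv
  have hsub : convexHull ℝ (Set.range v) ⊆ face h R ∅ Q := by
    refine convexHull_min ?_ (face_convex _ _ _ _)
    rintro _ ⟨k, rfl⟩
    exact hj.mem_face k
  rw [disjoint_left]
  intro i hi hiR
  obtain ⟨x, hx, y, hy, h1, h2⟩ := (mem_filter.1 hi).2
  by_cases hQi : i ∈ Q
  · linarith [((hsub hy).2 i hiR).1 hQi]
  · linarith [((hsub hx).2 i hiR).2 hQi]

lemma eq_of_mem_simplices (hG : Generic h) {v v' : Fin (d + 1) → Pt d}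
    (hv : v ∈ simplices h P R) (hv' : v' ∈ simplices h P R) {w w' : Fin (d + 1) → ℝ}
    (hw : ∀ k, 0 < w k) (hw' : ∀ k, 0 < w' k) (hw1 : ∑ k, w k = 1) (hw1' : ∑ k, w' k = 1)
    (heq : ∑ k, w k • v k = ∑ k, w' k • v' k) : v = v' := by
  obtain ⟨Q, hQ, j, hj⟩ := mem_simplices.1 hv
  obtain ⟨Q', hQ', j', hj'⟩ := mem_simplices.1 hv'
  have hsigns : ∀ {Q j} {v : Fin (d + 1) → Pt d} {w : Fin (d + 1) → ℝ}, Q ∈ cells h P R →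
      IsSimplex h R Q d ∅ j v → (∀ k, 0 < w k) → ∑ k, w k = 1 →
      signs h R (∑ k, w k • v k) = Q := by
    intro Q j v w hQ hj hw hw1
    have hin := hj.inFace hG (empty_subset _) (by simp) hw hw1
    obtain ⟨x, -, hxQ⟩ := mem_image.1 hQ
    ext i
    rw [mem_signs]
    refine ⟨fun ⟨hi, hpos⟩ => ?_, fun hi => ?_⟩
    · by_contra hiQ
      linarith [(hin.2 i hi (notMem_empty i)).2 hiQ]
    · have hiR : i ∈ R := by rw [← hxQ] at hi; exact ((mem_signs h).1 hi).1
      exact ⟨hiR, (hin.2 i hiR (notMem_empty i)).1 hi⟩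
  have hQQ : Q = Q' := by
    rw [← hsigns hQ hj hw hw1, heq, hsigns hQ' hj' hw' hw1']
  subst hQQ
  exact hj.eq_of_mem hG (empty_subset _) (by simp) hj' hw hw' hw1 hw1' heq

end

end

section

variable {d : ℕ} {κ : Type*}

/-! ### Clarkson–Shor moment bounds -/

lemma choose_add_mul_pow_le (n r p : ℕ) : n.choose (r + p) * r ^ p ≤ n ^ p * n.choose r := by
  induction p with
  | zero => simp
  | succ p ih =>
    have h1 : n.choose (r + p + 1) * r ≤ n * n.choose (r + p) := by
      calc n.choose (r + p + 1) * r ≤ n.choose (r + p + 1) * (r + p + 1) := by gcongr; omega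
        _ = n.choose (r + p) * (n - (r + p)) := Nat.choose_succ_right_eq _ _
        _ ≤ n.choose (r + p) * n := by gcongr; omega
        _ = _ := mul_comm _ _
    calc n.choose (r + (p + 1)) * r ^ (p + 1) = n.choose (r + p + 1) * r * r ^ p := by
          rw [← add_assoc]; ring
      _ ≤ n * n.choose (r + p) * r ^ p := by gcongr
      _ = n * (n.choose (r + p) * r ^ p) := by ring
      _ ≤ n * (n ^ p * n.choose r) := by gcongr
      _ = n ^ (p + 1) * n.choose r := by ring

/-- For `M`, the objects defined by `M` minus their conflicts in `M` are at most a constant factor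
more than the objects in an average subset of `M`. -/
lemma card_conflict_le {τ : Type*} {U : Finset κ} {S : Finset κ → Finset τ} {D K : τ → Finset κ}
    {b p r : ℕ} {Φ : ℝ} (hD : ∀ R ⊆ U, ∀ v ∈ S R, D v ⊆ R) (hDb : ∀ v, (D v).card ≤ b)
    (hloc : ∀ R ⊆ U, ∀ v ∈ S R, ∀ R' ⊆ R, D v ⊆ R' → v ∈ S R')
    (hΦ : ∀ R ⊆ U, R.card ≤ r + p → ((S R).card : ℝ) ≤ Φ) {M : Finset κ} (hM : M ⊆ U)
    (hMc : M.card = r + p) (V : Finset τ)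
    (hV : ∀ v ∈ V, v ∈ S (M \ K v) ∧ (K v ∩ M).card = p) :
    (V.card : ℝ) ≤ 2 ^ (b + p) * Φ := by
  have h1 : V.card * 2 ^ r ≤ 2 ^ b * ∑ R ∈ M.powerset, (S R).card := by
    have h2 : V.card * 2 ^ r ≤ 2 ^ b * ∑ v ∈ V, (M.powerset.filter fun R => v ∈ S R).card := by
      rw [mul_sum, ← smul_eq_mul]
      refine card_nsmul_le_sum _ _ _ fun v hv => ?_
      obtain ⟨hvS, hvc⟩ := hV v hv
      have hDM := hD _ (sdiff_subset.trans hM) v hvS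
      have hsub : (Icc (D v) (M \ K v)) ⊆ M.powerset.filter fun R => v ∈ S R := by
        intro R hR
        rw [mem_Icc] at hR
        exact mem_filter.2 ⟨mem_powerset.2 (hR.2.trans sdiff_subset),
          hloc _ (sdiff_subset.trans hM) v hvS R hR.2 hR.1⟩
      have hcard : (M \ K v).card = r := by
        have := card_sdiff_add_card_inter M (K v)
        rw [inter_comm, hvc] at this
        omega
      have h3 := card_le_card hsub
      rw [card_Icc_finset hDM, hcard] at h3
      calc 2 ^ r ≤ 2 ^ (b + (r - (D v).card)) :=
            Nat.pow_le_pow_right (by norm_num) (by have := hDb v; omega)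
        _ = 2 ^ b * 2 ^ (r - (D v).card) := pow_add _ _ _
        _ ≤ _ := by gcongr
    refine h2.trans (Nat.mul_le_mul_left _ ?_)
    simp only [card_filter]
    rw [sum_comm]
    refine sum_le_sum fun R _ => ?_
    rw [← card_filter]
    exact card_le_card fun v hv => (mem_filter.1 hv).2
  have h4 : (∑ R ∈ M.powerset, ((S R).card : ℝ)) ≤ 2 ^ (r + p) * Φ := by
    refine (sum_le_card_nsmul _ _ Φ fun R hR => ?_).trans ?_
    · have := mem_powerset.1 hR
      exact hΦ R (this.trans hM) ((card_le_card this).trans hMc.le)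
    · rw [card_powerset, hMc, nsmul_eq_mul]; push_cast; rfl
  have h5 : (V.card : ℝ) * 2 ^ r ≤ 2 ^ b * ∑ R ∈ M.powerset, ((S R).card : ℝ) := by
    exact_mod_cast h1
  have h6 : (V.card : ℝ) * 2 ^ r ≤ (2 ^ (b + p) * Φ) * 2 ^ r := by
    calc (V.card : ℝ) * 2 ^ r ≤ 2 ^ b * (2 ^ (r + p) * Φ) := h5.trans (by gcongr)
      _ = _ := by ring
  exact le_of_mul_le_mul_right h6 (by positivity)

/-- There is a subset for which the conflict sets have small `p`-th moment. -/
theorem exists_small_moment {τ : Type*} {U : Finset κ} {S : Finset κ → Finset τ}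
    {D K : τ → Finset κ} {b p r : ℕ} {Φ : ℝ} (hΦ0 : 0 ≤ Φ)
    (hD : ∀ R ⊆ U, ∀ v ∈ S R, D v ⊆ R) (hDb : ∀ v, (D v).card ≤ b)
    (hloc : ∀ R ⊆ U, ∀ v ∈ S R, ∀ R' ⊆ R, D v ⊆ R' → v ∈ S R')
    (hK : ∀ R ⊆ U, ∀ v ∈ S R, Disjoint (K v) R) (hKU : ∀ v, K v ⊆ U)
    (hΦ : ∀ R ⊆ U, R.card ≤ r + p → ((S R).card : ℝ) ≤ Φ) (hr : r ≤ U.card) :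
    ∃ R ⊆ U, R.card = r ∧
      (∑ v ∈ S R, ((K v).card.choose p : ℝ)) * r ^ p ≤ 2 ^ (b + p) * U.card ^ p * Φ := by
  set n := U.card
  set X : Finset (Σ _ : Finset κ, Σ _ : τ, Finset κ) :=
    (U.powersetCard r).sigma fun R => (S R).sigma fun v => (K v).powersetCard p
  set A : ℝ := ∑ R ∈ U.powersetCard r, ∑ v ∈ S R, ((K v).card.choose p : ℝ)
  have hXA : (X.card : ℝ) = A := by
    simp only [X, A, card_sigma, card_powersetCard]
    push_cast; rfl
  have hX : ∀ x ∈ X, x.1 ⊆ U ∧ x.1.card = r ∧ x.2.1 ∈ S x.1 ∧ x.2.2 ⊆ K x.2.1 ∧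
      x.2.2.card = p ∧ K x.2.1 ∩ (x.1 ∪ x.2.2) = x.2.2 ∧ (x.1 ∪ x.2.2) \ K x.2.1 = x.1 ∧
      (x.1 ∪ x.2.2).card = r + p ∧ x.1 ∪ x.2.2 ⊆ U := by
    rintro ⟨R, v, W⟩ hx
    simp only [X, mem_sigma, mem_powersetCard] at hx
    obtain ⟨⟨hRU, hRc⟩, hv, hW, hWc⟩ := hx
    have hdis := hK R hRU v hv
    simp only
    refine ⟨hRU, hRc, hv, hW, hWc, ?_, ?_, ?_, union_subset hRU (hW.trans (hKU v))⟩
    · rw [inter_union_distrib_left, disjoint_iff_inter_eq_empty.1 hdis, empty_union,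
        inter_eq_right.2 hW]
    · rw [union_sdiff_distrib, sdiff_eq_self_of_disjoint hdis.symm, sdiff_eq_empty_iff_subset.2 hW,
        union_empty]
    · rw [card_union_of_disjoint (disjoint_of_subset_right hW hdis.symm), hRc, hWc]
  have hcount : (X.card : ℝ) ≤ n.choose (r + p) * (2 ^ (b + p) * Φ) := by
    have hfib := card_eq_sum_card_fiberwise (f := fun x => x.1 ∪ x.2.2) (s := X)
      (t := U.powersetCard (r + p)) fun x hx => by
        have := hX x hx
        exact mem_powersetCard.2 ⟨this.2.2.2.2.2.2.2.2, this.2.2.2.2.2.2.2.1⟩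
    rw [hfib]
    push_cast
    refine (sum_le_card_nsmul _ _ (2 ^ (b + p) * Φ) fun M hM => ?_).trans ?_
    · obtain ⟨hMU, hMc⟩ := mem_powersetCard.1 hM
      have hinj : Set.InjOn (fun x : Σ _ : Finset κ, Σ _ : τ, Finset κ => x.2.1)
          (X.filter fun x => x.1 ∪ x.2.2 = M : Finset _) := by
        rintro ⟨R, v, W⟩ hx ⟨R', v', W'⟩ hx' heq
        simp only at heq
        subst heq
        obtain ⟨hx, hxM⟩ := mem_filter.1 hx
        obtain ⟨hx', hxM'⟩ := mem_filter.1 hx'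
        have h1 := hX _ hx
        have h2 := hX _ hx'
        simp only at hxM hxM' h1 h2
        rw [hxM] at h1
        rw [hxM'] at h2
        obtain ⟨-, -, -, -, -, hW, hR, -⟩ := h1
        obtain ⟨-, -, -, -, -, hW', hR', -⟩ := h2
        rw [← hW, ← hR, ← hW', ← hR']
      rw [← card_image_of_injOn hinj]
      refine card_conflict_le (K := K) hD hDb hloc hΦ hMU hMc _ fun v hv => ?_
      obtain ⟨x, hx, rfl⟩ := mem_image.1 hv
      obtain ⟨hx, hxM⟩ := mem_filter.1 hx
      have h1 := hX x hx
      rw [hxM] at h1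
      obtain ⟨-, -, hvS, -, hWc, hW, hR, -⟩ := h1
      rw [hR, hW]
      exact ⟨hvS, hWc⟩
    · rw [card_powersetCard, nsmul_eq_mul]
  by_contra! hcon
  have hne : (U.powersetCard r).Nonempty := powersetCard_nonempty.2 hr
  have h1 : (n.choose r : ℝ) * (2 ^ (b + p) * n ^ p * Φ) < A * r ^ p := by
    have h2 : ∑ R ∈ U.powersetCard r, (2 ^ (b + p) * n ^ p * Φ : ℝ) <
        ∑ R ∈ U.powersetCard r, (∑ v ∈ S R, ((K v).card.choose p : ℝ)) * (r : ℝ) ^ p :=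
      sum_lt_sum_of_nonempty hne fun R hR => by
        obtain ⟨h3, h4⟩ := mem_powersetCard.1 hR
        exact hcon R h3 h4
    rw [sum_const, card_powersetCard, nsmul_eq_mul, ← sum_mul] at h2
    exact h2
  have h3 : (n.choose (r + p) : ℝ) * r ^ p ≤ n ^ p * n.choose r := by
    exact_mod_cast choose_add_mul_pow_le n r p
  rw [← hXA] at h1
  have h4 : (X.card : ℝ) * r ^ p ≤ n.choose (r + p) * (2 ^ (b + p) * Φ) * r ^ p := by gcongr
  have h5 : (n.choose (r + p) : ℝ) * (2 ^ (b + p) * Φ) * r ^ p ≤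
      n ^ p * n.choose r * (2 ^ (b + p) * Φ) := by
    calc _ = (n.choose (r + p) : ℝ) * r ^ p * (2 ^ (b + p) * Φ) := by ring
      _ ≤ _ := by gcongr
  linarith

lemma crossing_mono (h : κ → Pt d × ℝ) (U : Finset κ) {S S' : Set (Pt d)} (hS : S ⊆ S') :
    crossing h U S ⊆ crossing h U S' := by
  intro i hi
  obtain ⟨hU, x, hx, y, hy, h1⟩ := mem_filter.1 hi
  exact mem_filter.2 ⟨hU, x, hS hx, y, hS hy, h1⟩

/-! ### Families of polyhedra with a moment bound -/

/-- `f` is a family of polyhedra with disjoint interiors which cover `Z`, and `Y` bounds the `p`-th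
moment of the numbers of hyperplanes crossing them. -/
structure IsMomentCover (h : κ → Pt d × ℝ) (U : Finset κ) (Z : Set (Pt d)) (p : ℕ) (Y : ℝ) {M : ℕ}
    (f : Fin M → Fin (d + 1) → Pt d × ℝ) : Prop where
  norm_eq : ∀ i k, ‖f i k‖ = 1
  disjoint : ∀ i j, i ≠ j → ∀ x ∈ interior (poly (f i)), x ∉ interior (poly (f j))
  cover : Z ⊆ ⋃ i, poly (f i)
  moment : ∑ i, ((crossing h U (interior (poly (f i)))).card.choose p : ℝ) ≤ Y

theorem exists_isMomentCover [Fintype κ] {h : κ → Pt d × ℝ} (hG : Generic h) {P : Finset (Pt d)}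
    {B U : Finset κ} (hc : ∀ x ∈ P, IsCompact (face h B ∅ (signs h B x))) {p r M : ℕ} (hp : 0 < p)
    {Φ : ℝ} (hΦ : ∀ R ⊆ U, R.card ≤ r + p → ((borders h P (R ∪ B) 0 d).card : ℝ) ≤ Φ)
    (hr : r ≤ U.card) (hr0 : 0 < r) (hM : Φ * d ^ d ≤ M) :
    ∃ f : Fin M → Fin (d + 1) → Pt d × ℝ, IsMomentCover h U
      (⋃ x ∈ P, face h univ ∅ (signs h univ x)) p
      (2 ^ ((d + 1) * d + p) * (U.card / r) ^ p * (Φ * d ^ d)) f := by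
  have hS : ∀ R ⊆ U, R.card ≤ r + p → ((simplices h P (R ∪ B)).card : ℝ) ≤ Φ * d ^ d := by
    intro R hR hRc
    have h1 : ((simplices h P (R ∪ B)).card : ℝ) ≤
        (borders h P (R ∪ B) 0 d).card * (d : ℝ) ^ d := by
      exact_mod_cast card_simplices_le hG
    exact h1.trans (by gcongr; exact hΦ R hR hRc)
  have hΦ0 : 0 ≤ Φ * d ^ d := (Nat.cast_nonneg _).trans (hS ∅ (empty_subset _) (by simp))
  obtain ⟨R, hRU, hRc, hmom⟩ := exists_small_moment (U := U) (S := fun R => simplices h P (R ∪ B))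
    (D := fun v => defining h v \ B) (K := fun v => crossing h U (convexHull ℝ (Set.range v)))
    (b := (d + 1) * d) (p := p) (r := r) hΦ0
    (fun R _ v hv i hi => by
      obtain ⟨h1, h2⟩ := Finset.mem_sdiff.1 hi
      exact (mem_union.1 (defining_subset hG hv h1)).resolve_right h2)
    (fun v => (card_le_card sdiff_subset).trans (card_defining_le hG v))
    (fun R _ v hv R' hR' hD => mem_simplices_of_subset hv (union_subset_union_left hR')
        fun i hi => by
      by_cases hiB : i ∈ B
      · exact mem_union_right _ hiB
      · exact mem_union_left _ (hD (Finset.mem_sdiff.2 ⟨hi, hiB⟩)))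
    (fun R _ v hv => disjoint_of_subset_right subset_union_left (disjoint_crossing hv U))
    (fun v => filter_subset _ _) hS hr
  set V := simplices h P (R ∪ B)
  have hVM : Fintype.card V ≤ Fintype.card (Fin M) := by
    rw [Fintype.card_coe, Fintype.card_fin]
    exact_mod_cast (hS R hRU (by omega)).trans hM
  obtain ⟨g⟩ := Function.Embedding.nonempty_of_card_le hVM
  have hq : ∀ v : V, ∃ q : Fin (d + 1) → Pt d × ℝ, (∀ k, ‖q k‖ = 1) ∧
      poly q = convexHull ℝ (Set.range v.1) ∧ ∀ x, x ∈ interior (poly q) →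
        ∃ w : Fin (d + 1) → ℝ, (∀ k, 0 < w k) ∧ ∑ k, w k = 1 ∧ ∑ k, w k • v.1 k = x := by
    rintro ⟨v, hv⟩
    obtain ⟨Q, -, j, hj⟩ := mem_simplices.1 hv
    exact exists_poly_eq_convexHull hj.affineIndependent
  choose q hq1 hq2 hq3 using hq
  set e : Fin (d + 1) → Pt d × ℝ := fun _ => (0, -1)
  have he : poly e = ∅ := by
    ext x
    simp [poly, e]
  set f := Function.extend g q fun _ => e
  have hfg : ∀ v, f (g v) = q v := fun v => g.injective.extend_apply _ _ _
  have hf : ∀ i, (∃ v, g v = i ∧ f i = q v) ∨ ((¬ ∃ v, g v = i) ∧ f i = e) := by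
    intro i
    by_cases hi : ∃ v, g v = i
    · obtain ⟨v, rfl⟩ := hi
      exact Or.inl ⟨v, rfl, hfg v⟩
    · exact Or.inr ⟨hi, Function.extend_apply' _ _ _ hi⟩
  refine ⟨f, fun i k => ?_, fun i j hij x hxi hxj => ?_, fun y hy => ?_, ?_⟩
  · rcases hf i with ⟨v, -, h1⟩ | ⟨-, h1⟩ <;> rw [h1]
    · exact hq1 v k
    · simp [e, Prod.norm_def]
  · rcases hf i with ⟨v, hv, h1⟩ | ⟨-, h1⟩
    swap
    · rw [h1, he, interior_empty] at hxi
      exact hxi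
    rcases hf j with ⟨v', hv', h2⟩ | ⟨-, h2⟩
    swap
    · rw [h2, he, interior_empty] at hxj
      exact hxj
    rw [h1] at hxi
    rw [h2] at hxj
    obtain ⟨w, hw, hw1, hwx⟩ := hq3 v x hxi
    obtain ⟨w', hw', hw1', hwx'⟩ := hq3 v' x hxj
    have := eq_of_mem_simplices hG v.2 v'.2 hw hw' hw1 hw1' (hwx.trans hwx'.symm)
    exact hij (by rw [← hv, ← hv', Subtype.ext this])
  · simp only [Set.mem_iUnion] at hy ⊢
    obtain ⟨x, hx, hy⟩ := hy
    have hface : ∀ R : Finset κ, y ∈ face h R ∅ (signs h R x) := fun R => ⟨by simp, fun i hi => by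
      have := hy.2 i (mem_univ _)
      simpa [hi] using this⟩
    have hcR : IsCompact (face h (R ∪ B) ∅ (signs h (R ∪ B) x)) := by
      refine (hc x hx).of_isClosed_subset (face_closed _ _ _ _)
        fun z hz => ⟨by simp, fun i hi => ?_⟩
      have := hz.2 i (mem_union_right _ hi)
      simpa [hi] using this
    obtain ⟨j, v, hv, hyv⟩ := exists_isSimplex (m := d) hG (empty_subset _) (by simp) hcR y
      (hface _)
    have hvV : v ∈ V := mem_simplices.2 ⟨_, mem_image_of_mem _ hx, j, hv⟩
    exact ⟨g ⟨v, hvV⟩, by rw [hfg, hq2]; exact hyv⟩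
  · have h1 : ∑ i, ((crossing h U (poly (f i))).card.choose p : ℝ) =
        ∑ v ∈ V, ((crossing h U (convexHull ℝ (Set.range v))).card.choose p : ℝ) := by
      rw [← sum_coe_sort V, ← sum_subset (subset_univ (univ.map g)), sum_map]
      · exact sum_congr rfl fun v _ => by rw [hfg, hq2]
      · intro i _ hi
        rcases hf i with ⟨v, hv, -⟩ | ⟨-, h2⟩
        · exact absurd (mem_map.2 ⟨v, mem_univ _, hv⟩) hi
        · have : crossing h U (poly e) = ∅ := by simp [crossing, he]
          rw [h2, this, card_empty, Nat.choose_eq_zero_of_lt hp, Nat.cast_zero]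
    refine (sum_le_sum fun i _ => Nat.cast_le.2 <| Nat.choose_le_choose p <|
      card_le_card (crossing_mono h U interior_subset)).trans ?_
    rw [h1, div_pow, mul_div_assoc', div_mul_eq_mul_div, le_div_iff₀ (by positivity)]
    exact hmom

end

section

variable {d : ℕ} {κ : Type*}

/-! ### Limits of families of polyhedra -/

/-- Families with a moment bound pass to the limit. -/
theorem exists_isMomentCover_of_tendsto {h : κ → Pt d × ℝ} {hs : ℕ → κ → Pt d × ℝ} {U : Finset κ}
    (hlim : ∀ i ∈ U, Tendsto (fun n => hs n i) atTop (𝓝 (h i))) {Z : Set (Pt d)}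
    {Zs : ℕ → Set (Pt d)} (hZ : ∀ z ∈ Z, ∀ᶠ n in atTop, z ∈ Zs n) {p M : ℕ} {Y : ℝ}
    {f : ℕ → Fin M → Fin (d + 1) → Pt d × ℝ}
    (hf : ∀ n, IsMomentCover (hs n) U (Zs n) p Y (f n)) :
    ∃ g : Fin M → Fin (d + 1) → Pt d × ℝ, IsMomentCover h U Z p Y g := by
  set 𝒰 : Ultrafilter ℕ := hyperfilter ℕ
  have h𝒰 : (𝒰 : Filter ℕ) ≤ atTop := Nat.hyperfilter_le_atTop
  have hex : ∀ i k, ∃ q : Pt d × ℝ, ‖q‖ = 1 ∧ Tendsto (fun n => f n i k) 𝒰 (𝓝 q) := by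
    intro i k
    obtain ⟨q, hq, hq'⟩ := (isCompact_sphere (0 : Pt d × ℝ) 1).ultrafilter_le_nhds'
      (𝒰.map fun n => f n i k) (by
        rw [Ultrafilter.mem_map]
        exact Filter.univ_mem' fun n => by simp [(hf n).norm_eq i k])
    exact ⟨q, by simpa using hq, hq'⟩
  choose g hg1 hg using hex
  have hint : ∀ i, ∀ x ∈ interior (poly (g i)), ∀ᶠ n in (𝒰 : Filter ℕ),
      x ∈ interior (poly (f n i)) := by
    intro i x hx
    rw [interior_poly (hg1 i)] at hx
    have : ∀ k, ∀ᶠ n in (𝒰 : Filter ℕ), ⟪x, (f n i k).1⟫ < (f n i k).2 := fun k =>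
      (((continuous_const.inner continuous_fst).tendsto _).comp (hg i k)).eventually_lt
        ((continuous_snd.tendsto _).comp (hg i k)) (hx k)
    filter_upwards [Filter.eventually_all.2 this] with n hn
    rw [interior_poly ((hf n).norm_eq i)]
    exact hn
  refine ⟨g, hg1, fun i j hij x hxi hxj => ?_, fun x hx => ?_, ?_⟩
  · obtain ⟨n, h1, h2⟩ := ((hint i x hxi).and (hint j x hxj)).exists
    exact (hf n).disjoint i j hij x h1 h2
  · have h1 : ∀ᶠ n in (𝒰 : Filter ℕ), ∃ i, x ∈ poly (f n i) := by
      filter_upwards [h𝒰 (hZ x hx)] with n hn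
      simpa using (hf n).cover hn
    rw [Ultrafilter.eventually_exists_iff] at h1
    obtain ⟨i, hi⟩ := h1
    refine Set.mem_iUnion.2 ⟨i, fun k => ?_⟩
    exact le_of_tendsto_of_tendsto
      (((continuous_const.inner continuous_fst).tendsto _).comp (hg i k))
      ((continuous_snd.tendsto _).comp (hg i k)) (hi.mono fun n hn => hn k)
  · have hcr : ∀ᶠ n in (𝒰 : Filter ℕ), ∀ i, ∀ l ∈ crossing h U (interior (poly (g i))),
        l ∈ crossing (hs n) U (interior (poly (f n i))) := by
      refine Filter.eventually_all.2 fun i => (Filter.eventually_all_finset _).2 fun l hl => ?_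
      obtain ⟨hU, x, hx, y, hy, h1, h2⟩ := mem_filter.1 hl
      have hev : ∀ z, Tendsto (fun n => ev (hs n) l z) 𝒰 (𝓝 (ev h l z)) := by
        intro z
        have hcont : Continuous fun q : Pt d × ℝ => ⟪z, q.1⟫ - q.2 := by fun_prop
        exact (hcont.tendsto _).comp ((hlim l hU).mono_left h𝒰)
      filter_upwards [hint i x hx, hint i y hy, (hev x).eventually_const_lt h1,
        (hev y).eventually_lt_const h2] with n a1 a2 a3 a4
      exact mem_filter.2 ⟨hU, x, a1, y, a2, a3, a4⟩
    obtain ⟨n, hn⟩ := hcr.exists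
    refine le_trans (sum_le_sum fun i _ => ?_) (hf n).moment
    exact_mod_cast Nat.choose_le_choose p (card_le_card (hn i))

/-! ### Generic perturbations -/

lemma eventually_det_ne_zero {α : Type*} [Fintype α] [DecidableEq α] (A V : Matrix α α ℝ)
    (hV : V.det ≠ 0) : ∀ᶠ s : ℝ in 𝓝[≠] 0, (A + s • V).det ≠ 0 := by
  set p := (-(A * V⁻¹)).charpoly
  have hp : p ≠ 0 := (Matrix.charpoly_monic _).ne_zero
  have hdet : ∀ s : ℝ, (A + s • V).det = p.eval s * V.det := by
    intro s
    have hVu : IsUnit V.det := isUnit_iff_ne_zero.2 hV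
    have : A + s • V = (Matrix.scalar α s - -(A * V⁻¹)) * V := by
      rw [sub_neg_eq_add, Matrix.add_mul, Matrix.mul_assoc, Matrix.nonsing_inv_mul _ hVu,
        Matrix.mul_one, add_comm, Matrix.scalar_apply, ← Matrix.smul_one_eq_diagonal,
        Matrix.smul_mul, Matrix.one_mul]
    rw [this, Matrix.det_mul, Matrix.eval_charpoly]
  have hfin : {s : ℝ | p.IsRoot s}.Finite := Polynomial.finite_setOfPred_isRoot hp
  filter_upwards [nhdsNE_le_cofinite 0 hfin.eventually_cofinite_notMem] with s hs
  rw [hdet]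
  exact mul_ne_zero hs hV

/-- The `i`-th member of a family of hyperplanes in general position. -/
def momentCurve (d : ℕ) (t : ℝ) : Pt d × ℝ := (WithLp.toLp 2 fun k : Fin d => t ^ (k : ℕ), t ^ d)

lemma linearIndependent_of_det_ne_zero {α : Type*} [Fintype α] (e : Fin d ≃ α) {a : α → Pt d}
    (ha : (Matrix.of fun k l => a (e k) l).det ≠ 0) : LinearIndependent ℝ a := by
  rw [← linearIndependent_equiv e]
  exact LinearIndependent.of_comp (WithLp.linearEquiv 2 ℝ (Fin d → ℝ)).toLinearMap
    (Matrix.linearIndependent_rows_of_det_ne_zero ha)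

lemma det_eq_zero_of_ev_eq_zero (h : Fin (d + 1) → Pt d × ℝ) {x : Pt d} (hx : ∀ k, ev h k x = 0) :
    (Matrix.of fun k => Fin.snoc (fun l => (h k).1 l) (h k).2 :
      Matrix (Fin (d + 1)) (Fin (d + 1)) ℝ).det = 0 := by
  refine Matrix.exists_mulVec_eq_zero_iff.1 ⟨Fin.snoc (fun l => x l) (-1), fun h0 => ?_, ?_⟩
  · have := congrFun h0 (Fin.last d)
    simp at this
  · ext k
    have h6 := hx k
    simp only [ev, PiLp.inner_apply, RCLike.inner_apply, conj_trivial] at h6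
    simp only [Matrix.mulVec, dotProduct, Fin.sum_univ_castSucc, Matrix.of_apply,
      Fin.snoc_castSucc, Fin.snoc_last, Pi.zero_apply]
    linarith

lemma of_add_smul_momentCurve (h : Fin (d + 1) → Pt d × ℝ) (t : Fin (d + 1) → ℝ) (s : ℝ) :
    (Matrix.of fun k => Fin.snoc (fun l => (h k + s • momentCurve d (t k)).1 l)
      (h k + s • momentCurve d (t k)).2 : Matrix (Fin (d + 1)) (Fin (d + 1)) ℝ) =
    (Matrix.of fun k => Fin.snoc (fun l => (h k).1 l) (h k).2) + s • Matrix.vandermonde t := by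
  ext k l
  refine Fin.lastCases ?_ (fun l => ?_) l
  · simp [momentCurve, Matrix.vandermonde_apply]
  · simp [momentCurve, Matrix.vandermonde_apply]

lemma eventually_linear_ne_zero (h : Fin d → Pt d × ℝ) {t : Fin d → ℝ}
    (ht : Function.Injective t) : ∀ᶠ s : ℝ in 𝓝[≠] 0,
      (Matrix.of fun k l => (h k + s • momentCurve d (t k)).1 l).det ≠ 0 := by
  filter_upwards [eventually_det_ne_zero (Matrix.of fun k l => (h k).1 l) (Matrix.vandermonde t)
    (Matrix.det_vandermonde_ne_zero_iff.2 ht)] with s hs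
  have h1 : (Matrix.of fun k l => (h k + s • momentCurve d (t k)).1 l) =
      (Matrix.of fun k l => (h k).1 l) + s • Matrix.vandermonde t := by
    ext k l
    simp [momentCurve, Matrix.vandermonde_apply]
  rwa [h1]

lemma eventually_ev_ne_zero (h : Fin (d + 1) → Pt d × ℝ) {t : Fin (d + 1) → ℝ}
    (ht : Function.Injective t) : ∀ᶠ s : ℝ in 𝓝[≠] 0, ∀ x,
      ∃ k, ev (fun k => h k + s • momentCurve d (t k)) k x ≠ 0 := by
  filter_upwards [eventually_det_ne_zero
    (Matrix.of fun k => Fin.snoc (fun l => (h k).1 l) (h k).2 :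
      Matrix (Fin (d + 1)) (Fin (d + 1)) ℝ) (Matrix.vandermonde t)
    (Matrix.det_vandermonde_ne_zero_iff.2 ht)] with s hs x
  by_contra! hx
  have h4 := det_eq_zero_of_ev_eq_zero _ hx
  rw [of_add_smul_momentCurve] at h4
  exact hs h4

/-- Every family of hyperplanes has generic families arbitrarily close to it. -/
theorem exists_generic_close [Fintype κ] (hd : d ≤ Fintype.card κ) (h : κ → Pt d × ℝ) {δ : ℝ}
    (hδ : 0 < δ) : ∃ h' : κ → Pt d × ℝ, Generic h' ∧ ∀ i, ‖h' i - h i‖ ≤ δ := by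
  obtain ⟨t, ht⟩ : ∃ t : κ → ℝ, Function.Injective t :=
    ⟨fun i => (Fintype.equivFin κ i : ℕ), fun i j hij => by
      have : ((Fintype.equivFin κ i : ℕ) : ℝ) = (Fintype.equivFin κ j : ℕ) := hij
      exact (Fintype.equivFin κ).injective (Fin.ext (by exact_mod_cast this))⟩
  have hclose : ∀ i, ∀ᶠ s : ℝ in 𝓝[≠] 0, ‖h i + s • momentCurve d (t i) - h i‖ ≤ δ := by
    intro i
    have hc : Continuous fun s : ℝ => ‖h i + s • momentCurve d (t i) - h i‖ := by fun_prop
    have h1 := (hc.tendsto 0).mono_left (nhdsWithin_le_nhds (s := {0}ᶜ))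
    simp only [zero_smul, add_zero, sub_self, norm_zero] at h1
    exact h1.eventually_le_const hδ
  have hlin : ∀ᶠ s : ℝ in 𝓝[≠] 0, ∀ e : Fin d ↪ κ,
      (Matrix.of fun k l => (h (e k) + s • momentCurve d (t (e k))).1 l).det ≠ 0 :=
    Filter.eventually_all.2 fun e =>
      eventually_linear_ne_zero (fun k => h (e k)) (ht.comp e.injective)
  have haff : ∀ᶠ s : ℝ in 𝓝[≠] 0, ∀ e : Fin (d + 1) ↪ κ, ∀ x,
      ∃ k, ev (fun k => h (e k) + s • momentCurve d (t (e k))) k x ≠ 0 :=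
    Filter.eventually_all.2 fun e =>
      eventually_ev_ne_zero (fun k => h (e k)) (ht.comp e.injective)
  obtain ⟨s, h1, h2, h3⟩ := ((Filter.eventually_all.2 hclose).and (hlin.and haff)).exists
  refine ⟨fun i => h i + s • momentCurve d (t i), ⟨fun D hD => ?_, fun x => ?_⟩, h1⟩
  · obtain ⟨D', hDD', -, hD'⟩ := exists_subsuperset_card_eq (subset_univ D) hD
      (by rwa [card_univ])
    have e : Fin d ≃ D' := (Fintype.equivFinOfCardEq (by simpa using hD')).symm
    have h5 : LinearIndependent ℝ fun i : D' => (h i + s • momentCurve d (t i)).1 := by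
      refine linearIndependent_of_det_ne_zero e ?_
      exact h2 (e.toEmbedding.trans (Function.Embedding.subtype _))
    exact h5.comp (fun i : D => (⟨i, hDD' i.2⟩ : D')) fun i j hij => Subtype.ext (by
      simpa using hij)
  · by_contra! hlt
    obtain ⟨D, hD, hDc⟩ := exists_subset_card_eq (Nat.succ_le_of_lt hlt)
    have e : Fin (d + 1) ≃ D := (Fintype.equivFinOfCardEq (by simpa using hDc)).symm
    obtain ⟨k, hk⟩ := h3 (e.toEmbedding.trans (Function.Embedding.subtype _)) x
    exact hk ((mem_zeros _).1 (hD (e k).2)).2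

end

section

variable {d : ℕ} {ι : Type*}

/-! ### Families in a large box -/

lemma norm_le_sum_abs (y : Pt d) : ‖y‖ ≤ ∑ j, |y j| := by
  have h1 : y = ∑ j, y j • EuclideanSpace.single j (1 : ℝ) := by
    ext k
    simp [Pi.single_apply]
  calc ‖y‖ = ‖∑ j, y j • EuclideanSpace.single j (1 : ℝ)‖ := by rw [← h1]
    _ ≤ ∑ j, ‖y j • EuclideanSpace.single j (1 : ℝ)‖ := norm_sum_le _ _
    _ = _ := by simp [norm_smul]

/-- The family `h` and the hyperplanes at infinity which take the place of the sides of a box. -/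
def extend (h : ι → Pt d × ℝ) : ι ⊕ (Fin d × Bool) → Pt d × ℝ := Sum.elim h fun _ => (0, 1)

/-- The box bounded by the additional hyperplanes of a family. -/
def box (h : ι ⊕ (Fin d × Bool) → Pt d × ℝ) : Set (Pt d) := {y | ∀ b, ev h (Sum.inr b) y ≤ 0}

lemma isCompact_box {h : ι ⊕ (Fin d × Bool) → Pt d × ℝ} {s δ : ℝ} (hs : 0 < s)
    (hδ : d * δ ≤ s / 2) (hh : ∀ b : Fin d × Bool, ‖h (Sum.inr b) -
      ((if b.2 then s else -s) • EuclideanSpace.single b.1 (1 : ℝ), 1)‖ ≤ δ) :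
    IsCompact (box h) := by
  have hclosed : IsClosed (box h) := by
    have : box h = ⋂ b, {y | ev h (Sum.inr b) y ≤ 0} := by
      ext y; simp [box]
    rw [this]
    exact isClosed_iInter fun b => isClosed_le (continuous_ev h _) continuous_const
  refine (isCompact_closedBall (0 : Pt d) (2 * d * (1 + δ) / s)).of_isClosed_subset hclosed
    fun y hy => ?_
  have h1 : ∀ b : Fin d × Bool, (if b.2 then s else -s) * y b.1 ≤ 1 + δ + δ * ‖y‖ := by
    intro b
    have h2 := hy b
    have h3 := hh b
    rw [Prod.norm_def, max_le_iff] at h3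
    have h4 := (abs_le.1 h3.2).2
    have h5 := (abs_real_inner_le_norm y ((h (Sum.inr b)).1 -
      (if b.2 then s else -s) • EuclideanSpace.single b.1 (1 : ℝ)))
    have h6 : ‖y‖ * ‖(h (Sum.inr b)).1 -
      (if b.2 then s else -s) • EuclideanSpace.single b.1 (1 : ℝ)‖ ≤ ‖y‖ * δ := by
        gcongr; exact h3.1
    have h7 := (abs_le.1 (h5.trans h6)).1
    rw [inner_sub_right, real_inner_smul_right, EuclideanSpace.inner_single_right] at h7
    simp only [ev, Prod.snd_sub] at h2 h4
    simp only [one_mul, conj_trivial] at h7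
    linarith
  have h2 : ∀ j, |y j| * s ≤ 1 + δ + δ * ‖y‖ := by
    intro j
    have ht := h1 (j, true)
    have hf := h1 (j, false)
    simp only [if_true, Bool.false_eq_true, if_false] at ht hf
    rcases abs_cases (y j) with ⟨h', -⟩ | ⟨h', -⟩ <;> rw [h'] <;> linarith
  have h3 : ‖y‖ * s ≤ d * (1 + δ + δ * ‖y‖) := by
    calc ‖y‖ * s ≤ (∑ j, |y j|) * s := by gcongr; exact norm_le_sum_abs y
      _ = ∑ j, |y j| * s := sum_mul _ _ _
      _ ≤ ∑ _j : Fin d, (1 + δ + δ * ‖y‖) := sum_le_sum fun j _ => h2 j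
      _ = _ := by rw [sum_const, card_univ, Fintype.card_fin, nsmul_eq_mul]
  rw [mem_closedBall_zero_iff, le_div_iff₀ hs]
  have := mul_le_mul_of_nonneg_right hδ (norm_nonneg y)
  linarith

/-- Every family is a limit of generic families with an additional large box. -/
lemma exists_generic_tendsto [Fintype ι] (h : ι → Pt d × ℝ) :
    ∃ hs : ℕ → ι ⊕ (Fin d × Bool) → Pt d × ℝ, (∀ n, Generic (hs n)) ∧
      (∀ n, IsCompact (box (hs n))) ∧ ∀ k, Tendsto (fun n => hs n k) atTop (𝓝 (extend h k)) := by
  set s : ℕ → ℝ := fun n => 1 / ((n : ℝ) + 1)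
  have hs0 : ∀ n, 0 < s n := fun n => by positivity
  have hslim : Tendsto s atTop (𝓝 0) := tendsto_one_div_add_atTop_nhds_zero_nat
  set δ : ℕ → ℝ := fun n => s n / (2 * (d + 1))
  have hδlim : Tendsto δ atTop (𝓝 0) := by simpa using hslim.div_const (2 * ((d : ℝ) + 1))
  set g : ℕ → ι ⊕ (Fin d × Bool) → Pt d × ℝ := fun n => Sum.elim h fun b =>
    ((if b.2 then s n else -s n) • EuclideanSpace.single b.1 (1 : ℝ), 1)
  have hcard : d ≤ Fintype.card (ι ⊕ (Fin d × Bool)) := by simp; omega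
  choose hs hG hclose using fun n => exists_generic_close hcard (g n)
    (δ := δ n) (by have := hs0 n; positivity)
  refine ⟨hs, hG, fun n => isCompact_box (hs0 n) (δ := δ n) ?_ fun b => hclose n (Sum.inr b),
    fun k => ?_⟩
  · have h1 := (hs0 n).le
    simp only [δ]
    rw [← mul_div_assoc, div_le_div_iff₀ (by positivity) (by norm_num)]
    nlinarith
  · have hg : Tendsto (fun n => g n k) atTop (𝓝 (extend h k)) := by
      rcases k with i | b
      · exact tendsto_const_nhds
      · have h1 : Tendsto (fun n => if b.2 then s n else -s n) atTop (𝓝 0) := by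
          split_ifs
          · exact hslim
          · simpa using hslim.neg
        have h2 := (h1.smul_const (EuclideanSpace.single b.1 (1 : ℝ) : Pt d)).prodMk_nhds
          (tendsto_const_nhds (x := (1 : ℝ)))
        rw [zero_smul] at h2
        exact h2
    have h3 : Tendsto (fun n => hs n k - g n k) atTop (𝓝 0) :=
      squeeze_zero_norm (fun n => hclose n k) hδlim
    simpa using h3.add hg

lemma crossing_extend [Fintype ι] (h : ι → Pt d × ℝ) (S : Set (Pt d)) :
    (crossing (extend h) (univ.map Function.Embedding.inl) S).card = (crossing h univ S).card := by
  have : crossing (extend h) (univ.map Function.Embedding.inl) S =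
      (crossing h univ S).map Function.Embedding.inl := by
    ext k
    rcases k with i | b <;> simp [crossing, ev, extend]
  rw [this, card_map]

lemma signs_eq_of_mul_pos {κ : Type*} {h h' : κ → Pt d × ℝ} {x : Pt d} (R : Finset κ)
    (hx : ∀ k, 0 < ev h' k x * ev h k x) : signs h' R x = signs h R x := by
  ext k
  have := hx k
  rw [mem_signs, mem_signs, and_congr_right]
  intro _
  exact ⟨fun h1 => pos_of_mul_pos_right this h1.le, fun h1 => pos_of_mul_pos_left this h1.le⟩

/-- The points of the cells of the arrangement which have a point in `P`. -/
def cellsUnion [Fintype ι] (h : ι → Pt d × ℝ) (P : Finset (Pt d)) : Set (Pt d) :=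
  {z | (∀ i, ev h i z ≠ 0) ∧ ∃ x ∈ P, signs h univ x = signs h univ z}

lemma eventually_ev_mul_pos [Fintype ι] {h : ι → Pt d × ℝ}
    {hs : ℕ → ι ⊕ (Fin d × Bool) → Pt d × ℝ}
    (hlim : ∀ k, Tendsto (fun n => hs n k) atTop (𝓝 (extend h k))) {x : Pt d}
    (hx : ∀ i, ev h i x ≠ 0) : ∀ᶠ n in atTop, ∀ k, 0 < ev (hs n) k x * ev (extend h) k x := by
  refine Filter.eventually_all.2 fun k => ?_
  have hcont : Continuous fun q : Pt d × ℝ => (⟪x, q.1⟫ - q.2) * ev (extend h) k x := by fun_prop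
  have h1 := (hcont.tendsto _).comp (hlim k)
  refine h1.eventually_const_lt (mul_self_pos.2 ?_)
  rcases k with i | b
  · exact hx i
  · simp [extend]

/-- A bound on the number of vertices of cells of generic families gives a family of polyhedra with
a moment bound for arbitrary families of hyperplanes. -/
theorem exists_isMomentCover_cellsUnion [Fintype ι] {h : ι → Pt d × ℝ} {P F : Finset (Pt d)}
    (hPF : P ⊆ F) (hF : ∀ x ∈ F, ∀ i, ev h i x ≠ 0) {p r M : ℕ} (hp : 0 < p) {Φ : ℝ}
    (hΦ : ∀ h' : ι ⊕ (Fin d × Bool) → Pt d × ℝ, Generic h' → IsCompact (box h') →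
      (∀ x ∈ F, ∀ k, 0 < ev h' k x * ev (extend h) k x) → ∀ R : Finset ι, R.card ≤ r + p →
      ((borders h' P (R.disjSum univ) 0 d).card : ℝ) ≤ Φ)
    (hr : r ≤ Fintype.card ι) (hr0 : 0 < r) (hM : Φ * d ^ d ≤ M) :
    ∃ f : Fin M → Fin (d + 1) → Pt d × ℝ, IsMomentCover h univ (cellsUnion h P) p
      (2 ^ ((d + 1) * d + p) * (Fintype.card ι / r) ^ p * (Φ * d ^ d)) f := by
  obtain ⟨hs, hG, hbox, hlim⟩ := exists_generic_tendsto h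
  obtain ⟨N, hN⟩ := eventually_atTop.1 ((Filter.eventually_all_finset F).2 fun x hx =>
    eventually_ev_mul_pos hlim (hF x hx))
  have hU : (univ.map Function.Embedding.inl : Finset (ι ⊕ (Fin d × Bool))).card =
      Fintype.card ι := by
    simp
  have hex := fun n => exists_isMomentCover (P := P) (B := univ.map Function.Embedding.inr)
    (U := univ.map Function.Embedding.inl) (M := M) (r := r)
    (hG (n + N)) (fun x hx => by
      refine (hbox (n + N)).of_isClosed_subset (face_closed _ _ _ _) fun y hy b => ?_
      refine (hy.2 (Sum.inr b) (by simp)).2 fun hb => ?_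
      have h1 := hN (n + N) (by omega) x (hPF hx) (Sum.inr b)
      have h2 := ((mem_signs _).1 hb).2
      have h3 : ev (extend h) (Sum.inr b) x = -1 := by simp [ev, extend]
      rw [h3] at h1
      linarith) hp
    (fun R hR hRc => by
      obtain ⟨R', -, rfl⟩ := (subset_map_iff).1 hR
      have h2 := hΦ _ (hG (n + N)) (hbox (n + N)) (hN (n + N) (by omega)) R' (by simpa using hRc)
      convert h2 using 4
      ext k
      rcases k with i | b <;> simp) (by rwa [hU]) hr0 hM
  choose f hf using hex
  obtain ⟨g, hg⟩ := exists_isMomentCover_of_tendsto (h := extend h) (Z := cellsUnion h P)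
    (fun k _ => (hlim k).comp (tendsto_add_atTop_nat N)) (fun z hz => by
      obtain ⟨hz0, x, hx, hxz⟩ := hz
      filter_upwards [(tendsto_add_atTop_nat N).eventually (eventually_ev_mul_pos hlim hz0)]
          with n hn
      refine Set.mem_iUnion₂.2 ⟨x, hx, ?_⟩
      have h1 : signs (hs (n + N)) univ x = signs (hs (n + N)) univ z := by
        rw [signs_eq_of_mul_pos univ hn,
            signs_eq_of_mul_pos univ (hN (n + N) (by omega) x (hPF hx))]
        ext k
        rcases k with i | b
        · have := Finset.ext_iff.1 hxz i
          simpa [ev, extend] using this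
        · simp [ev, extend]
      rw [h1]
      exact mem_face_signs _ _ _) hf
  refine ⟨g, hg.norm_eq, hg.disjoint, hg.cover, ?_⟩
  have := hg.moment
  simp only [crossing_extend, hU] at this
  exact this

end

section

variable {d : ℕ}

/-! ### The zone of a convex set -/

/-- The levels of `φ` are the boundaries of closed convex sets. -/
def Dividing (φ : Pt d → ℝ) : Prop :=
  ∀ ε > 0, ∃ A : Set (Pt d), IsClosed A ∧ Convex ℝ A ∧ frontier A ⊆ {x | φ x = ε} ∧
    ∀ x y, φ x < ε → ε < φ y → (x ∈ interior A ∧ y ∉ A) ∨ (y ∈ interior A ∧ x ∉ A)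

lemma dividing_infDist {K : Set (Pt d)} (hK : Convex ℝ K) :
    Dividing fun x => Metric.infDist x K := by
  intro ε hε
  rcases K.eq_empty_or_nonempty with rfl | hne
  · exact ⟨Set.univ, isClosed_univ, convex_univ, by simp, fun x y _ hy =>
      absurd hy (by simpa using hε.le)⟩
  have hA : Metric.cthickening ε K = {x | Metric.infDist x K ≤ ε} := by
    rw [Metric.cthickening_eq_preimage_infEDist]
    ext x
    simp only [Set.mem_preimage, Set.mem_Iic, Set.mem_ofPred_eq, Metric.infDist]
    exact ENNReal.le_ofReal_iff_toReal_le (Metric.infEDist_ne_top hne) hε.le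
  have hcont : Continuous fun x => Metric.infDist x K := Metric.continuous_infDist_pt K
  refine ⟨{x | Metric.infDist x K ≤ ε}, isClosed_le hcont continuous_const,
    hA ▸ hK.cthickening ε, frontier_le_subset_eq hcont continuous_const, fun x y hx hy =>
    Or.inl ⟨?_, not_le.2 hy⟩⟩
  exact interior_maximal (fun z (hz : Metric.infDist z K < ε) => hz.le)
    (isOpen_lt hcont continuous_const) hx

lemma dividing_infDist_compl {K : Set (Pt d)} (hK : Convex ℝ K) :
    Dividing fun x => Metric.infDist x Kᶜ := by
  intro ε hε
  have hcont : Continuous fun x => Metric.infDist x Kᶜ := Metric.continuous_infDist_pt Kᶜ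
  refine ⟨{x | ε ≤ Metric.infDist x Kᶜ}, isClosed_le continuous_const hcont, ?_,
    fun x hx => (frontier_le_subset_eq continuous_const hcont hx).symm, fun x y hx hy =>
    Or.inr ⟨?_, not_le.2 hx⟩⟩
  · intro x hx y hy a b ha hb hab
    rcases Kᶜ.eq_empty_or_nonempty with hemp | hne
    · simp only [hemp, Metric.infDist_empty, Set.mem_ofPred_eq] at hx
      linarith
    by_contra hlt
    obtain ⟨w, hw, hdist⟩ := (Metric.infDist_lt_iff hne).1 (not_le.1 hlt)
    have hball : ∀ p, ε ≤ Metric.infDist p Kᶜ → p + (w - (a • x + b • y)) ∈ K := by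
      intro p hp
      by_contra hpK
      have h1 := Metric.infDist_le_dist_of_mem (x := p) (Set.mem_compl hpK)
      rw [dist_self_add_right, ← dist_eq_norm, dist_comm] at h1
      linarith
    refine hw ?_
    have := hK (hball x hx) (hball y hy) ha hb hab
    convert this using 1
    have hb' : b = 1 - a := by linarith
    subst hb'
    module
  · exact interior_maximal (fun z (hz : ε < Metric.infDist z Kᶜ) => hz.le)
      (isOpen_lt continuous_const hcont) hy

/-- A bound on the number of cells divided by a convex set. -/
lemma card_cells_of_dividing {κ γ : Type*} [Fintype κ] [Fintype γ] {h : κ → Pt d × ℝ}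
    (hG : Generic h) {P : Finset (Pt d)} {R : Finset κ} {φ : γ → Pt d → ℝ}
    (hφ : ∀ j, Dividing (φ j)) {a b : ℝ} (ha : 0 < a) (hab : a < b)
    (hc : ∀ x ∈ P, IsCompact (face h R ∅ (signs h R x)))
    (hP : ∀ x ∈ P, ∃ j, ∃ p ∈ face h R ∅ (signs h R x), ∃ q ∈ face h R ∅ (signs h R x),
      φ j p ≤ a ∧ b ≤ φ j q) :
    (cells h P R).card ≤ Fintype.card γ * (2 * (2 ^ d * (d * (R.card + 1) ^ (d - 1)))) := by
  have hfin : {w : Pt d | (zeros h univ w).card = d}.Finite := by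
    refine Set.Finite.of_finite_image (f := zeros h univ) (Set.toFinite _) ?_
    intro w hw w' hw' heq
    refine eq_of_ev_eq_zero hG hw (fun i hi => ((mem_zeros h).1 hi).2) fun i hi => ?_
    rw [heq] at hi
    exact ((mem_zeros h).1 hi).2
  have hbad : (⋃ j, φ j '' {w : Pt d | (zeros h univ w).card = d}).Finite :=
    Set.finite_iUnion fun j => hfin.image _
  obtain ⟨ε, hε, hεbad⟩ := ((Set.Ioo_infinite hab).sdiff hbad).nonempty
  choose A hA hA' hfr hAsep using fun j => hφ j ε (ha.trans hε.1)
  refine card_cells_le h A _ (fun Q hQ => ?_) fun Q hQ => ?_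
  · obtain ⟨x, -, rfl⟩ := mem_image.1 hQ
    exact filter_subset _ _
  · obtain ⟨x, hx, rfl⟩ := mem_image.1 hQ
    obtain ⟨j, p, hp, q, hq, hpa, hqb⟩ := hP x hx
    have hvert : ∀ w, (zeros h R w).card = d → w ∉ frontier (A j) := by
      intro w hw hwA
      refine hεbad (Set.mem_iUnion.2 ⟨j, w, ?_, hfr j hwA⟩)
      refine le_antisymm (card_zeros_le hG _ _) (hw.ge.trans (card_le_card ?_))
      exact filter_subset_filter _ (subset_univ _)
    refine ⟨j, ?_⟩
    rcases hAsep j p q (hpa.trans_lt hε.1) (hε.2.trans_le hqb) with ⟨h1, h2⟩ | ⟨h1, h2⟩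
    · exact exists_isExtremeAt hG (hc x hx) (hA j) (hA' j) hvert hp h1 hq h2
    · exact exists_isExtremeAt hG (hc x hx) (hA j) (hA' j) hvert hq h1 hp h2

/-- The distances to a set and to its complement. -/
def dists (K : Set (Pt d)) (j : Bool) (x : Pt d) : ℝ :=
  if j then Metric.infDist x K else Metric.infDist x Kᶜ

lemma exists_dists_of_zone {K S : Set (Pt d)} (hK : Convex ℝ K) (hS : IsOpen S)
    (hSK : (closure S ∩ frontier K).Nonempty) :
    ∃ j, (∃ q ∈ S, 0 < dists (closure K) j q) ∧ ∀ ε > 0, ∃ p ∈ S, dists (closure K) j p < ε := by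
  obtain ⟨z, hzS, hzK⟩ := hSK
  have hKne : K.Nonempty := closure_nonempty_iff.1 ⟨z, hzK.1⟩
  have hnear : ∀ X : Set (Pt d), z ∈ closure X → ∀ ε > 0, ∃ p ∈ S, Metric.infDist p X < ε := by
    intro X hX ε hε
    have h1 : Metric.infDist z X = 0 := Metric.infDist_zero_of_mem_closure hX
    have hopen : IsOpen {p | Metric.infDist p X < ε} :=
      isOpen_lt (Metric.continuous_infDist_pt X) continuous_const
    obtain ⟨p, hp, hpS⟩ := mem_closure_iff.1 hzS _ hopen (by simpa [h1] using hε)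
    exact ⟨p, hpS, hp⟩
  by_cases hsub : S ⊆ closure K
  · have hSint : S ⊆ interior (closure K) := interior_maximal hsub hS
    obtain ⟨x, hx⟩ : S.Nonempty := closure_nonempty_iff.1 ⟨z, hzS⟩
    have hint : (interior K).Nonempty := by
      rw [hK.interior_nonempty_iff_affineSpan_eq_top]
      have h1 := hK.closure.interior_nonempty_iff_affineSpan_eq_top.1 ⟨x, hSint hx⟩
      have h2 : closure K ⊆ affineSpan ℝ K :=
        closure_minimal (subset_affineSpan ℝ K) (AffineSubspace.closed_of_finiteDimensional _)
      exact top_le_iff.1 (h1 ▸ affineSpan_le.2 h2)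
    have hz : z ∈ closure (closure K)ᶜ := by
      rw [closure_compl, hK.interior_closure_eq_interior_of_nonempty_interior hint]
      exact hzK.2
    refine ⟨false, ⟨x, hx, ?_⟩, fun ε hε => ?_⟩
    · have : x ∉ closure (closure K)ᶜ := by
        rw [closure_compl]
        exact fun h => h (hSint hx)
      simpa [dists] using (Metric.infDist_pos_iff_notMem_closure (closure_nonempty_iff.1 ⟨z, hz⟩)).1
        this
    · simpa [dists] using hnear _ hz ε hε
  · obtain ⟨y, hyS, hyK⟩ := Set.not_subset.1 hsub
    refine ⟨true, ⟨y, hyS, ?_⟩, fun ε hε => ?_⟩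
    · have : y ∉ closure (closure K) := by rwa [closure_closure]
      simpa [dists] using (Metric.infDist_pos_iff_notMem_closure hKne.closure).1 this
    · simpa [dists] using hnear _ (subset_closure hzK.1) ε hε

end

section

variable {d : ℕ}

/-! ### Moment covers of arrangements and of zones -/

/-- The cell of the arrangement of `h` which contains `z`. -/
def cellOf {κ : Type*} (h : κ → Pt d × ℝ) (z : Pt d) : Set (Pt d) :=
  {y | ∀ i, 0 < ev h i z * ev h i y}

lemma isOpen_cellOf {κ : Type*} [Finite κ] (h : κ → Pt d × ℝ) (z : Pt d) : IsOpen (cellOf h z) := by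
  have : cellOf h z = ⋂ i, {y | 0 < ev h i z * ev h i y} := by
    ext; simp [cellOf]
  rw [this]
  exact isOpen_iInter_of_finite fun i =>
    isOpen_lt continuous_const (continuous_const.mul (continuous_ev h i))

lemma mem_cellOf_self {κ : Type*} {h : κ → Pt d × ℝ} {z : Pt d} (hz : ∀ i, ev h i z ≠ 0) :
    z ∈ cellOf h z := fun i => mul_self_pos.2 (hz i)

lemma pos_iff_of_mul_pos {a b : ℝ} (h : 0 < a * b) : 0 < a ↔ 0 < b :=
  ⟨fun h1 => (pos_iff_pos_of_mul_pos h).1 h1, fun h1 => (pos_iff_pos_of_mul_pos h).2 h1⟩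

lemma signs_eq_of_mem_cellOf {κ : Type*} {h : κ → Pt d × ℝ} {z y : Pt d} (hy : y ∈ cellOf h z)
    (R : Finset κ) : signs h R y = signs h R z := by
  ext k
  simp [pos_iff_of_mul_pos (hy k)]

lemma ev_ne_zero_of_mem_cellOf {κ : Type*} {h : κ → Pt d × ℝ} {z y : Pt d} (hy : y ∈ cellOf h z)
    (i : κ) : ev h i y ≠ 0 := fun h0 => by
  have := hy i
  simp [h0] at this


lemma cellOf_eq_of_mem {κ : Type*} {h : κ → Pt d × ℝ} {z y : Pt d} (hy : y ∈ cellOf h z) :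
    cellOf h y = cellOf h z := by
  ext w
  refine forall_congr' fun i => ?_
  have h1 := hy i
  rcases mul_pos_iff.1 h1 with ⟨h2, h3⟩ | ⟨h2, h3⟩
  · rw [mul_pos_iff_of_pos_left h2, mul_pos_iff_of_pos_left h3]
  · rw [mul_pos_iff, mul_pos_iff]
    simp [h2, h3, h2.not_gt, h3.not_gt]

lemma exists_representatives {κ : Type*} [Fintype κ] (h : κ → Pt d × ℝ) (Z : Set (Pt d)) :
    ∃ P : Finset (Pt d), (P : Set (Pt d)) ⊆ Z ∧
      ∀ z ∈ Z, ∃ x ∈ P, signs h univ x = signs h univ z := by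
  obtain ⟨P, hP, himg⟩ := subset_set_image_iff.1
    (Set.Finite.coe_toFinset (Set.toFinite (signs h univ '' Z))).le
  refine ⟨P, hP, fun z hz => ?_⟩
  have : signs h univ z ∈ P.image (signs h univ) := by
    rw [himg]
    simpa using ⟨z, hz, rfl⟩
  simpa using this

/-- Moment covers of all cells. -/
theorem exists_isMomentCover_all (d : ℕ) {p : ℕ} (hp : 0 < p) : ∃ C : ℝ, 0 ≤ C ∧
    ∀ (ι : Type) [Fintype ι] (h : ι → Pt d × ℝ) (r : ℕ), 0 < r → r ≤ Fintype.card ι →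
    ∃ (M : ℕ) (f : Fin M → Fin (d + 1) → Pt d × ℝ), (M : ℝ) ≤ C * r ^ d ∧
      IsMomentCover h univ {z | ∀ i, ev h i z ≠ 0} p (C * (Fintype.card ι / r) ^ p * r ^ d) f := by
  set G : ℝ := ((p : ℝ) + 2 * d + 1) ^ d * 2 ^ d * d ^ d
  have hG0 : 0 ≤ G := by positivity
  refine ⟨2 ^ ((d + 1) * d + p) * G + G + 1, by positivity, fun ι _ h r hr0 hr => ?_⟩
  obtain ⟨P, hP, hPz⟩ := exists_representatives h {z | ∀ i, ev h i z ≠ 0}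
  have hr1 : (1 : ℝ) ≤ r := by exact_mod_cast hr0
  set Φ : ℝ := ((r : ℝ) + p + 2 * d) ^ d * 2 ^ d
  have hΦG : Φ * d ^ d ≤ G * r ^ d := by
    have : ((r : ℝ) + p + 2 * d) ≤ ((p : ℝ) + 2 * d + 1) * r := by
      have h1 : (p : ℝ) + 2 * d ≤ (p + 2 * d) * r := le_mul_of_one_le_right (by positivity) hr1
      linarith
    calc Φ * d ^ d ≤ (((p : ℝ) + 2 * d + 1) * r) ^ d * 2 ^ d * d ^ d := by
          simp only [Φ]; gcongr
      _ = _ := by simp only [G]; rw [mul_pow]; ring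
  have hr1d : (1 : ℝ) ≤ r ^ d := one_le_pow₀ hr1
  obtain ⟨f, hf⟩ := exists_isMomentCover_cellsUnion (h := h) (P := P) (F := P) (p := p) (r := r)
    (M := ⌈Φ * d ^ d⌉₊) subset_rfl (fun x hx => hP hx) hp (Φ := Φ) (fun h' hG _ _ R hR => by
      have h1 := card_borders_vertex_le_choose hG (P := P) (R := R.disjSum univ)
      have h2 : (R.disjSum (univ : Finset (Fin d × Bool))).card ≤ r + p + 2 * d := by
        rw [card_disjSum, card_univ, Fintype.card_prod, Fintype.card_fin, Fintype.card_bool]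
        omega
      have h3 := h1.trans (Nat.mul_le_mul_right _ ((Nat.choose_le_pow _ _).trans
        (Nat.pow_le_pow_left h2 d)))
      simp only [Φ]
      exact_mod_cast h3) hr hr0 (Nat.le_ceil _)
  refine ⟨_, f, ?_, hf.norm_eq, hf.disjoint, fun z hz => hf.cover ⟨hz, hPz z hz⟩,
    hf.moment.trans ?_⟩
  · have h1 := (Nat.ceil_lt_add_one (a := Φ * d ^ d) (by positivity)).le
    have h2 : (0 : ℝ) ≤ 2 ^ ((d + 1) * d + p) * G * r ^ d := by positivity
    linarith
  · calc (2 : ℝ) ^ ((d + 1) * d + p) * (Fintype.card ι / r) ^ p * (Φ * d ^ d)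
        ≤ 2 ^ ((d + 1) * d + p) * (Fintype.card ι / r) ^ p * (G * r ^ d) := by gcongr
      _ = 2 ^ ((d + 1) * d + p) * G * ((Fintype.card ι / r) ^ p * r ^ d) := by ring
      _ ≤ (2 ^ ((d + 1) * d + p) * G + G + 1) * ((Fintype.card ι / r) ^ p * r ^ d) := by
          gcongr; linarith
      _ = _ := by ring

/-- The zone of a set in the arrangement of `h`. -/
def zone {κ : Type*} (h : κ → Pt d × ℝ) (σ : Set (Pt d)) : Set (Pt d) :=
  {z | (∀ i, ev h i z ≠ 0) ∧ (closure (cellOf h z) ∩ σ).Nonempty}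

/-- Test points which show that the cells of a zone are divided by convex sets. -/
lemma exists_test_points {κ : Type*} [Fintype κ] (h : κ → Pt d × ℝ) {K : Set (Pt d)}
    (hK : Convex ℝ K) : ∃ (P F : Finset (Pt d)) (a b : ℝ), P ⊆ F ∧ 0 < a ∧ a < b ∧
      (∀ x ∈ F, ∀ i, ev h i x ≠ 0) ∧ zone h (frontier K) ⊆ cellsUnion h P ∧
      ∀ x ∈ P, ∃ j, ∃ p ∈ F, ∃ q ∈ F, p ∈ cellOf h x ∧ q ∈ cellOf h x ∧
        dists (closure K) j p ≤ a ∧ b ≤ dists (closure K) j q := by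
  obtain ⟨P, hP, hPz⟩ := exists_representatives h (zone h (frontier K))
  choose! j hj using fun x (hx : x ∈ zone h (frontier K)) =>
    exists_dists_of_zone hK (isOpen_cellOf h x) hx.2
  choose! q hq hqpos using fun x hx => (hj x hx).1
  obtain ⟨b, hb0, hb⟩ : ∃ b > 0, ∀ x ∈ P, b ≤ dists (closure K) (j x) (q x) := by
    rcases P.eq_empty_or_nonempty with rfl | hne
    · exact ⟨1, one_pos, by simp⟩
    · obtain ⟨x, hx, hmin⟩ := P.exists_min_image (fun x => dists (closure K) (j x) (q x)) hne
      exact ⟨_, hqpos x (hP hx), hmin⟩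
  choose! p hp hpa using fun x hx => (hj x hx).2 (b / 2) (half_pos hb0)
  refine ⟨P, P ∪ P.image p ∪ P.image q, b / 2, b, fun x hx => ?_, half_pos hb0, half_lt_self hb0,
    fun x hx => ?_, fun z hz => ⟨hz.1, hPz z hz⟩, fun x hx => ?_⟩
  · simp [hx]
  · simp only [mem_union, mem_image] at hx
    rcases hx with (hx | ⟨y, hy, rfl⟩) | ⟨y, hy, rfl⟩
    · exact (hP hx).1
    · exact ev_ne_zero_of_mem_cellOf (hp y (hP hy))
    · exact ev_ne_zero_of_mem_cellOf (hq y (hP hy))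
  · refine ⟨j x, p x, ?_, q x, ?_, hp x (hP hx), hq x (hP hx), (hpa x (hP hx)).le, hb x hx⟩
    · simp only [mem_union, mem_image]
      exact Or.inl (Or.inr ⟨x, hx, rfl⟩)
    · simp only [mem_union, mem_image]
      exact Or.inr ⟨x, hx, rfl⟩

lemma card_union_add_one_le {κ : Type*} (R : Finset κ) {B : Finset κ} {b : ℕ} (hB : B.card ≤ b) :
    (R ∪ B).card + 1 ≤ (b + 1) * (R.card + 1) := by
  have := card_union_le R B
  nlinarith

/-- The cells of the zone of a convex set, in a nearby generic family. -/
lemma zoneData_of_close {ι : Type} [Fintype ι] {h : ι → Pt d × ℝ} {K : Set (Pt d)}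
    (hK : Convex ℝ K) {P F : Finset (Pt d)} {a b : ℝ} (hPF : P ⊆ F) (ha : 0 < a) (hab : a < b)
    (hdist : ∀ x ∈ P, ∃ j, ∃ p ∈ F, ∃ q ∈ F, p ∈ cellOf h x ∧ q ∈ cellOf h x ∧
        dists (closure K) j p ≤ a ∧ b ≤ dists (closure K) j q)
    {h' : ι ⊕ (Fin d × Bool) → Pt d × ℝ} (hG : Generic h') (hbox : IsCompact (box h'))
    (hF : ∀ x ∈ F, ∀ k, 0 < ev h' k x * ev (extend h) k x) :
    ZoneData (2 * d) (2 * (2 * (2 ^ d * (d * (2 * d + 1) ^ (d - 1))))) h' P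
      (univ.map Function.Embedding.inr) (univ.map Function.Embedding.inl) := by
  have hcell : ∀ x ∈ F, ∀ y ∈ F, y ∈ cellOf h x → y ∈ cellOf h' x := by
    intro x hx y hy hxy k
    have h1 := hF x hx k
    have h2 := hF y hy k
    have h3 : 0 < ev (extend h) k x * ev (extend h) k y := by
      rcases k with i | c
      · exact hxy i
      · simp [ev, extend]
    have h4 : 0 < (ev h' k x * ev h' k y) * (ev (extend h) k x * ev (extend h) k y) := by
      have := mul_pos h1 h2
      linarith
    exact (pos_iff_of_mul_pos h4).2 h3
  have hcompact : ∀ x ∈ P, ∀ R, (∀ c, Sum.inr c ∈ R) → IsCompact (face h' R ∅ (signs h' R x)) := by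
    intro x hx R hR
    refine hbox.of_isClosed_subset (face_closed _ _ _ _) fun y hy c => ?_
    refine (hy.2 (Sum.inr c) (hR c)).2 fun hc => ?_
    have h1 := hF x (hPF hx) (Sum.inr c)
    have h2 := ((mem_signs _).1 hc).2
    have h3 : ev (extend h) (Sum.inr c) x = -1 := by simp [ev, extend]
    rw [h3] at h1
    linarith
  refine ⟨hG, fun x hx k h0 => ?_, ?_, by simp [mul_comm], fun x hx => hcompact x hx _ (by simp),
    fun R hR => ?_⟩
  · have := hF x (hPF hx) k
    simp [h0] at this
  · rw [Finset.disjoint_left]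
    simp
  · refine (card_cells_of_dividing (φ := dists (closure K)) hG ?_ ha hab
      (fun x hx => hcompact x hx _ (by simp)) fun x hx => ?_).trans ?_
    · rintro (_ | _)
      · rw [show dists (closure K) false = fun x => Metric.infDist x (closure K)ᶜ by
          ext; simp [dists]]
        exact dividing_infDist_compl hK.closure
      · rw [show dists (closure K) true = fun x => Metric.infDist x (closure K) by
          ext; simp [dists]]
        exact dividing_infDist hK.closure
    · obtain ⟨j, p, hp, q, hq, hpx, hqx, h1, h2⟩ := hdist x hx
      refine ⟨j, p, ?_, q, ?_, h1, h2⟩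
      · rw [← signs_eq_of_mem_cellOf (hcell x (hPF hx) p hp hpx)]
        exact mem_face_signs _ _ _
      · rw [← signs_eq_of_mem_cellOf (hcell x (hPF hx) q hq hqx)]
        exact mem_face_signs _ _ _
    · rw [Fintype.card_bool]
      calc _ ≤ 2 * (2 * (2 ^ d * (d * ((2 * d + 1) * (R.card + 1)) ^ (d - 1)))) := by
            gcongr
            exact card_union_add_one_le _ (by simp [mul_comm])
        _ = _ := by rw [mul_pow]; ring

/-- Moment covers of the zone of a convex set. -/
theorem exists_isMomentCover_zone (hd : 3 ≤ d) {p : ℕ} (hp : 0 < p) : ∃ C : ℝ, 0 ≤ C ∧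
    ∀ (ι : Type) [Fintype ι] (h : ι → Pt d × ℝ) (K : Set (Pt d)), Convex ℝ K → ∀ r : ℕ, 0 < r →
    r ≤ Fintype.card ι →
    ∃ (M : ℕ) (f : Fin M → Fin (d + 1) → Pt d × ℝ), (M : ℝ) ≤ C * (r ^ (d - 1) * Λ (r + p)) ∧
      IsMomentCover h univ (zone h (frontier K)) p
        (C * (Fintype.card ι / r) ^ p * (r ^ (d - 1) * Λ (r + p))) f := by
  obtain ⟨C₀, hC₀, hb⟩ := bordersBound_vertex hd (2 * d)
    (2 * (2 * (2 ^ d * (d * (2 * d + 1) ^ (d - 1)))))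
  set G : ℝ := C₀ * ((p : ℝ) + 2) ^ (d - 1) * d ^ d
  have hG0 : 0 ≤ G := by positivity
  refine ⟨2 ^ ((d + 1) * d + p) * G + G + 1, by positivity, fun ι _ h K hK r hr0 hr => ?_⟩
  have hr1 : (1 : ℝ) ≤ r := by exact_mod_cast hr0
  have hΛ := one_le_Λ (r + p)
  obtain ⟨P, F, a, b, hPF, ha, hab, hF, hzone, hdist⟩ := exists_test_points h hK
  set Φ : ℝ := C₀ * ((r : ℝ) + p + 1) ^ (d - 1) * Λ (r + p)
  have hΦ0 : 0 ≤ Φ := by positivity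
  have hΦG : Φ * d ^ d ≤ G * (r ^ (d - 1) * Λ (r + p)) := by
    have : ((r : ℝ) + p + 1) ≤ ((p : ℝ) + 2) * r := by
      have h1 : (p : ℝ) + 1 ≤ (p + 1) * r := le_mul_of_one_le_right (by positivity) hr1
      linarith
    calc Φ * d ^ d ≤ C₀ * (((p : ℝ) + 2) * r) ^ (d - 1) * Λ (r + p) * d ^ d := by
          simp only [Φ]; gcongr
      _ = _ := by simp only [G]; rw [mul_pow]; ring
  have hr1d : (1 : ℝ) ≤ r ^ (d - 1) * Λ (r + p) :=
    one_le_mul_of_one_le_of_one_le (one_le_pow₀ hr1) hΛ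
  obtain ⟨f, hf⟩ := exists_isMomentCover_cellsUnion (h := h) (P := P) (F := F) (p := p) (r := r)
    (M := ⌈Φ * d ^ d⌉₊) hPF hF hp (Φ := Φ) (fun h' hG hbox hF' R hR => by
      have h1 := hb _ h' P _ _ (zoneData_of_close hK hPF ha hab hdist hG hbox hF')
        (R.map Function.Embedding.inl) (map_subset_map.2 (subset_univ R))
      rw [card_map] at h1
      have h2 : ((borders h' P (R.disjSum univ) 0 d).card : ℝ) ≤
          C₀ * ((R.card : ℝ) + 1) ^ (d - 1) * Λ R.card := by
        convert h1 using 4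
        ext k
        rcases k with i | c <;> simp
      refine h2.trans ?_
      have h3 : (R.card : ℝ) ≤ r + p := by exact_mod_cast hR
      have h4 := one_le_Λ R.card
      simp only [Φ]
      gcongr
      exact Λ_mono hR) hr hr0 (Nat.le_ceil _)
  refine ⟨_, f, ?_, hf.norm_eq, hf.disjoint, hzone.trans hf.cover, hf.moment.trans ?_⟩
  · have h1 := (Nat.ceil_lt_add_one (a := Φ * d ^ d) (by positivity)).le
    have h2 : (0 : ℝ) ≤ 2 ^ ((d + 1) * d + p) * G * (r ^ (d - 1) * Λ (r + p)) := by positivity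
    linarith
  · calc (2 : ℝ) ^ ((d + 1) * d + p) * (Fintype.card ι / r) ^ p * (Φ * d ^ d)
        ≤ 2 ^ ((d + 1) * d + p) * (Fintype.card ι / r) ^ p * (G * (r ^ (d - 1) * Λ (r + p))) := by
          gcongr
      _ = 2 ^ ((d + 1) * d + p) * G * ((Fintype.card ι / r) ^ p * (r ^ (d - 1) * Λ (r + p))) := by
        ring
      _ ≤ (2 ^ ((d + 1) * d + p) * G + G + 1) * ((Fintype.card ι / r) ^ p *
          (r ^ (d - 1) * Λ (r + p))) := by
          gcongr; linarith
      _ = _ := by ring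

end

section

variable {d : ℕ}

/-! ### Cuttings -/

lemma pow_le_mul_choose_add_one {p : ℕ} (hp : 0 < p) :
    ∃ A : ℝ, 1 ≤ A ∧ ∀ g : ℕ, (g : ℝ) ^ p ≤ A * ((g.choose p : ℝ) + 1) := by
  have hf : (1 : ℝ) ≤ p.factorial := by exact_mod_cast Nat.succ_le_of_lt p.factorial_pos
  have hpp : (1 : ℝ) ≤ (p : ℝ) ^ p := one_le_pow₀ (by exact_mod_cast hp)
  refine ⟨(p : ℝ) ^ p * p.factorial, one_le_mul_of_one_le_of_one_le hpp hf, fun g => ?_⟩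
  rcases lt_or_ge g p with hg | hg
  · calc (g : ℝ) ^ p ≤ (p : ℝ) ^ p := by gcongr
      _ ≤ (p : ℝ) ^ p * p.factorial := le_mul_of_one_le_right (by positivity) hf
      _ ≤ _ := le_mul_of_one_le_right (by positivity) (by simp)
  · have h1 := Nat.pow_le_choose (α := ℝ) p g
    rw [div_le_iff₀ (by positivity)] at h1
    have h2 : (g : ℝ) ≤ p * (g + 1 - p : ℕ) := by
      obtain ⟨k, rfl⟩ := Nat.exists_eq_add_of_le hg
      rw [show p + k + 1 - p = k + 1 by omega]
      have hp' : (1 : ℝ) ≤ p := by exact_mod_cast hp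
      push_cast
      nlinarith [(k.cast_nonneg : (0 : ℝ) ≤ k)]
    calc (g : ℝ) ^ p ≤ (p * (g + 1 - p : ℕ)) ^ p := by gcongr
      _ = (p : ℝ) ^ p * ((g + 1 - p : ℕ) : ℝ) ^ p := mul_pow _ _ _
      _ ≤ (p : ℝ) ^ p * (g.choose p * p.factorial) := by gcongr
      _ ≤ _ := by
        have : (0 : ℝ) ≤ (p : ℝ) ^ p * p.factorial := by positivity
        linarith

lemma dense_ev_ne_zero {κ : Type*} [Finite κ] {h : κ → Pt d × ℝ} (hh : ∀ i, h i ≠ 0) :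
    Dense {z | ∀ i, ev h i z ≠ 0} := by
  rw [Set.ofPred_forall]
  refine dense_iInter_of_isOpen (fun i => isOpen_ne_fun (continuous_ev h i) continuous_const)
    fun i z => ?_
  by_cases hz : ev h i z = 0
  · have ha : (h i).1 ≠ 0 := by
      intro ha
      have hb : (h i).2 = 0 := by simpa [ev, ha] using hz
      exact hh i (Prod.ext ha hb)
    have hcont : Continuous fun t : ℝ => z + t • (h i).1 := by fun_prop
    have h1 := (hcont.tendsto 0).mono_left (nhdsWithin_le_nhds (s := {0}ᶜ))
    simp only [zero_smul, add_zero] at h1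
    refine mem_closure_of_tendsto h1 ?_
    filter_upwards [self_mem_nhdsWithin] with t ht
    rw [ev_add_smul, hz, zero_add]
    exact mul_ne_zero ht (inner_self_ne_zero.2 ha)
  · exact subset_closure hz

/-- An open set covered by finitely many closed sets meets the interior of one of them. -/
lemma exists_interior_inter {J : Type*} [Finite J] {A : J → Set (Pt d)} (hA : ∀ j, IsClosed (A j))
    {O : Set (Pt d)} (hO : IsOpen O) (hne : O.Nonempty) (hsub : O ⊆ ⋃ j, A j) :
    ∃ j, (interior (A j) ∩ O).Nonempty := by
  have h1 := dense_iUnion_interior_of_closed (f := fun o : Option J => o.elim Oᶜ A)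
    (fun o => by cases o <;> simp [hA, hO]) (by
      refine Set.eq_univ_of_forall fun x => ?_
      by_cases hx : x ∈ O
      · obtain ⟨j, hj⟩ := Set.mem_iUnion.1 (hsub hx)
        exact Set.mem_iUnion.2 ⟨some j, hj⟩
      · exact Set.mem_iUnion.2 ⟨none, hx⟩)
  obtain ⟨x, hxO, hx⟩ := h1.inter_open_nonempty O hO hne
  obtain ⟨o, ho⟩ := Set.mem_iUnion.1 hx
  cases o with
  | none => exact absurd hxO (interior_subset ho)
  | some j => exact ⟨j, x, ho, hxO⟩

lemma crossing_fst {κ : Type*} [Fintype κ] (h : κ → Pt d × ℝ) (m : ℕ) (S : Set (Pt d)) :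
    (crossing (fun i : κ × Fin m => h i.1) univ S).card = (crossing h univ S).card * m := by
  have : crossing (fun i : κ × Fin m => h i.1) univ S = crossing h univ S ×ˢ univ := by
    ext ⟨i, k⟩
    simp [crossing, ev]
  rw [this, card_product, card_univ, Fintype.card_fin]

/-- Cuttings whose size is polynomial in the parameter. -/
theorem exists_cutting (hd : 0 < d) : ∃ C : ℝ, 0 ≤ C ∧
    ∀ (ι : Type) [Fintype ι] (h : ι → Pt d × ℝ), (∀ i, h i ≠ 0) → 0 < Fintype.card ι →
    ∀ t : ℝ, 1 ≤ t →
    ∃ (M : ℕ) (f : Fin M → Fin (d + 1) → Pt d × ℝ), (M : ℝ) ≤ C * t ^ (2 * d) ∧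
      (∀ i k, ‖f i k‖ = 1) ∧
      (∀ i j, i ≠ j → ∀ x ∈ interior (poly (f i)), x ∉ interior (poly (f j))) ∧
      (∀ x, ∃ i, x ∈ poly (f i)) ∧
      ∀ i, ((crossing h univ (interior (poly (f i)))).card : ℝ) ≤ Fintype.card ι / t := by
  obtain ⟨A, hA1, hA⟩ := pow_le_mul_choose_add_one (p := 2 * d) (by omega)
  obtain ⟨C, hC, hcover⟩ := exists_isMomentCover_all d (p := 2 * d) (by omega)
  set B : ℝ := 2 * A * (C + 1)
  have hB1 : 1 ≤ B := by simp only [B]; nlinarith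
  have hBA : 2 * A ≤ B := by simp only [B]; nlinarith
  have hBC : 2 * A * C ≤ B := by simp only [B]; nlinarith
  refine ⟨C * (B + 1) ^ d, by positivity, fun ι _ h hh hι t ht => ?_⟩
  have ht2 : 1 ≤ t ^ 2 := one_le_pow₀ ht
  set r := ⌈B * t ^ 2⌉₊
  have hBt : 1 ≤ B * t ^ 2 := one_le_mul_of_one_le_of_one_le hB1 ht2
  have hr : B * t ^ 2 ≤ r := Nat.le_ceil _
  have hr0 : 0 < r := by
    have : (0 : ℝ) < r := by linarith
    exact_mod_cast this
  have hr' : (r : ℝ) ≤ (B + 1) * t ^ 2 := by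
    have := (Nat.ceil_lt_add_one (a := B * t ^ 2) (by positivity)).le
    linarith
  set N := Fintype.card ι
  have hN' : Fintype.card (ι × Fin r) = N * r := by simp [N]
  obtain ⟨M, f, hM, hf⟩ := hcover (ι × Fin r) (fun i => h i.1) r hr0
    (by rw [hN']; exact Nat.le_mul_of_pos_left _ hι)
  refine ⟨M, f, ?_, hf.norm_eq, hf.disjoint, fun x => ?_, fun i => ?_⟩
  · calc (M : ℝ) ≤ C * r ^ d := hM
      _ ≤ C * ((B + 1) * t ^ 2) ^ d := by gcongr
      _ = _ := by rw [mul_pow, ← pow_mul]; ring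
  · have h1 : IsClosed (⋃ i, poly (f i)) := isClosed_iUnion_of_finite fun i => poly_closed _
    have h2 := (dense_ev_ne_zero (h := fun i : ι × Fin r => h i.1) fun i => hh i.1).mono hf.cover
    have h3 := h2 x
    rw [h1.closure_eq] at h3
    exact Set.mem_iUnion.1 h3
  · set g := (crossing h univ (interior (poly (f i)))).card
    have h1 : ((g * r).choose (2 * d) : ℝ) ≤ C * (N * r / r) ^ (2 * d) * r ^ d := by
      have h2 := (single_le_sum (f := fun i => ((crossing (fun i : ι × Fin r => h i.1) univ
        (interior (poly (f i)))).card.choose (2 * d) : ℝ)) (fun i _ => Nat.cast_nonneg _)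
        (mem_univ i)).trans hf.moment
      simp only [crossing_fst, hN'] at h2
      push_cast at h2
      exact h2
    have hr0' : (0 : ℝ) < r := by exact_mod_cast hr0
    have hN0 : (1 : ℝ) ≤ N := by exact_mod_cast hι
    have ht0 : 0 < t := by linarith
    rw [mul_div_cancel_right₀ _ hr0'.ne'] at h1
    have h2 := hA (g * r)
    have h3 : ((g : ℝ) * r) ^ (2 * d) ≤ A * C * (N ^ (2 * d) * r ^ d) + A := by
      push_cast at h2
      refine h2.trans ?_
      have := mul_le_mul_of_nonneg_left h1 (zero_le_one.trans hA1)
      linarith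
    rw [le_div_iff₀ ht0]
    refine (pow_le_pow_iff_left₀ (by positivity) (by positivity)
      (show 2 * d ≠ 0 by omega)).1 ?_
    have hrd : 2 * A * C * t ^ (2 * d) ≤ r ^ d := by
      calc 2 * A * C * t ^ (2 * d) ≤ B * t ^ (2 * d) := by gcongr
        _ ≤ B ^ d * t ^ (2 * d) := by gcongr; exact le_self_pow₀ hB1 hd.ne'
        _ = (B * t ^ 2) ^ d := by rw [mul_pow B (t ^ 2) d, ← pow_mul]
        _ ≤ _ := by gcongr
    have hrd' : 2 * A * t ^ (2 * d) ≤ r ^ (2 * d) := by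
      calc 2 * A * t ^ (2 * d) ≤ B * t ^ (2 * d) := by gcongr
        _ ≤ B ^ (2 * d) * t ^ (2 * d) := by gcongr; exact le_self_pow₀ hB1 (by omega)
        _ = (B * t) ^ (2 * d) := (mul_pow B t (2 * d)).symm
        _ ≤ _ := by
          gcongr
          refine le_trans ?_ hr
          gcongr
          nlinarith
    have h4 : (((g : ℝ) * t) ^ (2 * d)) * r ^ (2 * d) ≤ N ^ (2 * d) * r ^ (2 * d) := by
      calc (((g : ℝ) * t) ^ (2 * d)) * r ^ (2 * d) = ((g : ℝ) * r) ^ (2 * d) * t ^ (2 * d) := by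
            rw [← mul_pow, ← mul_pow]; ring
        _ ≤ (A * C * (N ^ (2 * d) * r ^ d) + A) * t ^ (2 * d) := by gcongr
        _ = ((2 * A * C * t ^ (2 * d)) * (N ^ (2 * d) * r ^ d) + 2 * A * t ^ (2 * d)) / 2 := by ring
        _ ≤ (r ^ d * (N ^ (2 * d) * r ^ d) + r ^ (2 * d)) / 2 := by gcongr
        _ ≤ (r ^ d * (N ^ (2 * d) * r ^ d) + N ^ (2 * d) * r ^ (2 * d)) / 2 := by
          gcongr
          exact le_mul_of_one_le_left (by positivity) (one_le_pow₀ hN0)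
        _ = _ := by rw [mul_comm 2 d, pow_mul, pow_mul]; ring
    exact le_of_mul_le_mul_right h4 (by positivity)

end

section

variable {d : ℕ}

/-! ### Refining a simplex -/

lemma mem_crossing_of_isOpen {κ : Type*} [Fintype κ] {h : κ → Pt d × ℝ} {i : κ} {S : Set (Pt d)}
    (hS : IsOpen S) {z : Pt d} (hz : z ∈ S) (h0 : ev h i z = 0) (ha : (h i).1 ≠ 0) :
    i ∈ crossing h univ S := by
  have hcont : Continuous fun t : ℝ => z + t • (h i).1 := by fun_prop
  have h1 : ∀ᶠ t : ℝ in 𝓝 0, z + t • (h i).1 ∈ S :=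
    (hcont.tendsto 0).eventually (hS.mem_nhds (by simpa using hz))
  obtain ⟨δ, hδ, h2⟩ := Metric.eventually_nhds_iff.1 h1
  have ha' : 0 < ⟪(h i).1, (h i).1⟫ := real_inner_self_pos.2 ha
  refine mem_filter.2 ⟨mem_univ _, _, h2 (y := δ / 2) ?_, _, h2 (y := -(δ / 2)) ?_, ?_, ?_⟩
  · rw [Real.dist_eq, sub_zero, abs_of_pos (by positivity)]; linarith
  · rw [Real.dist_eq, sub_zero, abs_neg, abs_of_pos (by positivity)]; linarith
  · rw [ev_add_smul, h0, zero_add]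
    positivity
  · rw [ev_add_smul, h0, zero_add, neg_mul, neg_lt_zero]
    positivity

lemma mem_crossing_of_isOpen_of_nonneg {κ : Type*} [Fintype κ] {h : κ → Pt d × ℝ} {i : κ}
    {S : Set (Pt d)} (hS : IsOpen S) {y z : Pt d} (hy : y ∈ S) (hz : z ∈ S) (hy0 : ev h i y < 0)
    (hz0 : 0 ≤ ev h i z) : i ∈ crossing h univ S := by
  rcases hz0.eq_or_lt with h0 | h0
  · refine mem_crossing_of_isOpen hS hz h0.symm fun ha => ?_
    simp only [ev, ha, inner_zero_right] at hy0 h0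
    linarith
  · exact mem_filter.2 ⟨mem_univ _, z, hz, y, hy, h0, hy0⟩

lemma poly_eq_empty : poly (fun _ : Fin (d + 1) => ((0 : Pt d), (-1 : ℝ))) = ∅ := by
  refine Set.eq_empty_of_forall_notMem fun x hx => ?_
  have := hx 0
  simp only [inner_zero_right] at this
  linarith

/-- Each simplex can be subdivided so that every piece is crossed by few hyperplanes. -/
theorem exists_refinement (hd : 0 < d) : ∃ C : ℝ, 1 ≤ C ∧
    ∀ (ι : Type) [Fintype ι] (h : ι → Pt d × ℝ), (∀ i, h i ≠ 0) →
    ∀ q : Fin (d + 1) → Pt d × ℝ, (∀ k, ‖q k‖ = 1) → ∀ x : ℝ, 0 < x →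
    ∃ (M : ℕ) (f : Fin M → Fin (d + 1) → Pt d × ℝ),
      (M : ℝ) ≤ C * (1 + ((crossing h univ (interior (poly q))).card / x) ^ (2 * d)) ∧
      (∀ i k, ‖f i k‖ = 1) ∧
      (∀ i j, i ≠ j → ∀ x ∈ interior (poly (f i)), x ∉ interior (poly (f j))) ∧
      (∀ i, interior (poly (f i)) ⊆ interior (poly q)) ∧
      interior (poly q) ⊆ ⋃ i, poly (f i) ∧
      ∀ i, ((crossing h univ (interior (poly (f i)))).card : ℝ) ≤ x := by
  obtain ⟨C, hC, hcut⟩ := exists_cutting hd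
  refine ⟨1 + C * (d + 2) ^ (2 * d), le_add_of_nonneg_right (by positivity),
    fun ι _ h hh q hq x hx => ?_⟩
  set S := crossing h univ (interior (poly q)) with hS
  set g := S.card with hg
  have hgx : 0 ≤ ((g : ℝ) / x) ^ (2 * d) := by positivity
  rcases le_or_gt (g : ℝ) x with hle | hlt
  · refine ⟨1, fun _ => q, ?_, fun _ => hq, fun i j hij => absurd (Subsingleton.elim i j) hij,
      fun _ => subset_rfl, fun y hy => Set.mem_iUnion.2 ⟨0, interior_subset hy⟩, fun _ => hle⟩
    have : 0 ≤ C * (d + 2 : ℝ) ^ (2 * d) := by positivity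
    push_cast
    nlinarith
  have hg0 : 0 < g := by
    have : (0 : ℝ) < g := hx.trans hlt
    exact_mod_cast this
  set h' : {i // i ∈ S} ⊕ (Fin (d + 1) × Fin g) → Pt d × ℝ :=
    Sum.elim (fun i => h i) (fun k => q k.1) with hh'
  have hcard : Fintype.card ({i // i ∈ S} ⊕ (Fin (d + 1) × Fin g)) = (d + 2) * g := by
    rw [Fintype.card_sum, Fintype.card_coe, Fintype.card_prod, Fintype.card_fin, Fintype.card_fin]
    ring
  have ht : 1 ≤ (d + 2 : ℝ) * g / x := by
    rw [one_le_div hx]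
    have : (0 : ℝ) ≤ d * g := by positivity
    linarith
  obtain ⟨M, f, hM, hf1, hf2, hf3, hf4⟩ := hcut _ h'
    (by
      rintro (i | k)
      · exact hh i
      · intro h0
        have := hq k.1
        rw [show q k.1 = 0 from h0, norm_zero] at this
        exact zero_ne_one this)
    (by rw [hcard]; positivity) _ ht
  have hx' : ((Fintype.card ({i // i ∈ S} ⊕ (Fin (d + 1) × Fin g)) : ℕ) : ℝ) /
      ((d + 2 : ℝ) * g / x) = x := by
    rw [hcard]
    push_cast
    have : (0 : ℝ) < (d + 2 : ℝ) * g := by positivity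
    field_simp
  simp only [hx'] at hf4
  have hin : ∀ i, ∀ y ∈ interior (poly (f i)), y ∈ interior (poly q) →
      interior (poly (f i)) ⊆ interior (poly q) := by
    intro i y hy hyq z hz
    rw [interior_poly hq] at hyq ⊢
    by_contra hzq
    simp only [Set.mem_ofPred_eq, not_forall, not_lt] at hzq
    obtain ⟨k, hk⟩ := hzq
    have h1 : (univ : Finset (Fin g)).card ≤ (crossing h' univ (interior (poly (f i)))).card :=
      card_le_card_of_injOn (fun m => Sum.inr (k, m))
        (fun m _ => mem_crossing_of_isOpen_of_nonneg isOpen_interior hy hz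
          (by simpa [ev, hh'] using hyq k) (by simpa [ev, hh'] using hk))
        (fun a _ b _ hab => by simpa using hab)
    rw [card_univ, Fintype.card_fin] at h1
    have h2 : (g : ℝ) ≤ (crossing h' univ (interior (poly (f i)))).card := by exact_mod_cast h1
    linarith [hf4 i]
  have hcr : ∀ i, interior (poly (f i)) ⊆ interior (poly q) →
      ((crossing h univ (interior (poly (f i)))).card : ℝ) ≤ x := by
    intro i hi
    refine le_trans ?_ (hf4 i)
    have h1 : (crossing h univ (interior (poly (f i)))).attach.card ≤
        (crossing h' univ (interior (poly (f i)))).card :=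
      card_le_card_of_injOn (fun j => Sum.inl ⟨j.1, crossing_mono h univ hi j.2⟩)
        (fun j _ => mem_filter.2 ⟨mem_univ _, (mem_filter.1 j.2).2⟩)
        (fun a _ b _ hab => Subtype.ext (Subtype.mk.inj (Sum.inl.inj hab)))
    rw [card_attach] at h1
    exact_mod_cast h1
  set f' : Fin M → Fin (d + 1) → Pt d × ℝ := fun i =>
    if interior (poly (f i)) ⊆ interior (poly q) then f i else fun _ => (0, -1) with hf'
  have hcases : ∀ i, (f' i = f i ∧ interior (poly (f i)) ⊆ interior (poly q)) ∨
      (f' i = fun _ => (0, -1)) := by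
    intro i
    by_cases hi : interior (poly (f i)) ⊆ interior (poly q)
    · exact .inl ⟨if_pos hi, hi⟩
    · exact .inr (if_neg hi)
  refine ⟨M, f', ?_, fun i k => ?_, fun i j hij y hy => ?_, fun i => ?_, fun y hy => ?_,
    fun i => ?_⟩
  · refine hM.trans ?_
    rw [mul_div_assoc, mul_pow]
    have : 0 ≤ C * (d + 2 : ℝ) ^ (2 * d) := by positivity
    nlinarith
  · rcases hcases i with h1 | h1
    · rw [h1.1, hf1]
    · rw [h1]
      simp [Prod.norm_def]
  · rcases hcases i with h1 | h1
    · rcases hcases j with h2 | h2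
      · rw [h1.1] at hy
        rw [h2.1]
        exact hf2 i j hij y hy
      · simp [h2, poly_eq_empty]
    · simp [h1, poly_eq_empty] at hy
  · rcases hcases i with h1 | h1
    · rw [h1.1]
      exact h1.2
    · simp [h1, poly_eq_empty]
  · by_contra hy'
    obtain ⟨j, z, hz, hzq, hz'⟩ := exists_interior_inter (A := fun i => poly (f i))
      (O := interior (poly q) \ ⋃ i, poly (f' i)) (fun i => poly_closed _)
      (isOpen_interior.sdiff (isClosed_iUnion_of_finite fun i => poly_closed _)) ⟨y, hy, hy'⟩
      (fun w _ => Set.mem_iUnion.2 (hf3 w))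
    refine hz' (Set.mem_iUnion.2 ⟨j, ?_⟩)
    rw [show f' j = f j from if_pos (hin j z hz hzq)]
    exact interior_subset hz
  · rcases hcases i with h1 | h1
    · rw [h1.1]
      exact hcr i h1.2
    · simp [h1, poly_eq_empty, crossing, hx.le]

end

section

variable {d : ℕ}

/-! ### Optimal cuttings of zones -/

lemma Λ_add_le_logb (p : ℕ) {n : ℕ} {r : ℝ} (hn : 0 < n) (hnr : (n : ℝ) ≤ r) (hr : 2 ≤ r) :
    Λ (n + p) ≤ (3 + p) * Real.logb 2 r := by
  have hn' : (1 : ℝ) ≤ n := by exact_mod_cast hn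
  have hlog : 1 ≤ Real.logb 2 r := by
    rw [Real.le_logb_iff_rpow_le one_lt_two (by linarith), Real.rpow_one]
    exact hr
  have hlog' : Real.log r ≤ Real.logb 2 r := by
    rw [Real.logb, le_div_iff₀ (Real.log_pos one_lt_two)]
    refine mul_le_of_le_one_right (Real.log_nonneg (by linarith)) ?_
    have := Real.log_le_sub_one_of_pos (x := 2) two_pos
    linarith
  have h1 : Λ (n + p) = 1 + (harmonic (n + p) : ℝ) := by simp [Λ, harmonic]
  have h2 : Real.log ((n + p : ℕ) : ℝ) ≤ Real.log r + p := by
    calc Real.log ((n + p : ℕ) : ℝ) ≤ Real.log (r * (1 + p)) := by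
          refine Real.log_le_log (by positivity) ?_
          push_cast
          nlinarith [(p.cast_nonneg : (0 : ℝ) ≤ p)]
      _ = Real.log r + Real.log (1 + p) := Real.log_mul (by positivity) (by positivity)
      _ ≤ _ := by
        have := Real.log_le_sub_one_of_pos (x := 1 + (p : ℝ)) (by positivity)
        linarith
  have h3 := harmonic_le_one_add_log (n + p)
  rw [h1]
  nlinarith [mul_le_mul_of_nonneg_left hlog (p.cast_nonneg : (0 : ℝ) ≤ p)]

/-- The zone of the frontier of a convex set has cuttings of nearly optimal size. -/
theorem exists_zone_cutting (hd : 3 ≤ d) : ∃ C : ℝ, 0 ≤ C ∧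
    ∀ (ι : Type) [Fintype ι] (h : ι → Pt d × ℝ), (∀ i, h i ≠ 0) →
    ∀ K : Set (Pt d), Convex ℝ K → ∀ r : ℝ, 2 ≤ r → r ≤ Fintype.card ι →
    ∃ (M : ℕ) (f : Fin M → Fin (d + 1) → Pt d × ℝ),
      (M : ℝ) ≤ C * (r ^ (d - 1) * Real.logb 2 r) ∧
      (∀ i k, ‖f i k‖ = 1) ∧
      (∀ i j, i ≠ j → ∀ x ∈ interior (poly (f i)), x ∉ interior (poly (f j))) ∧
      (∀ i, (interior (poly (f i))).Nonempty) ∧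
      zone h (frontier K) ⊆ ⋃ i, poly (f i) ∧
      ∀ i, ((crossing h univ (interior (poly (f i)))).card : ℝ) ≤ Fintype.card ι / r := by
  have hp : 0 < 2 * d := by omega
  obtain ⟨A, hA1, hA⟩ := pow_le_mul_choose_add_one hp
  obtain ⟨C₁, hC₁, hzone⟩ := exists_isMomentCover_zone hd hp
  obtain ⟨C₂, hC₂, href⟩ := exists_refinement (d := d) (by omega)
  set p := 2 * d with hpdef
  have hA0 : 0 ≤ A := zero_le_one.trans hA1
  have hC₂0 : 0 ≤ C₂ := zero_le_one.trans hC₂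
  refine ⟨C₂ * (C₁ + A * C₁ * (2 ^ p + 1)) * (3 + p), by positivity,
    fun ι _ h hh K hK r hr2 hrn => ?_⟩
  set n := Fintype.card ι
  set r₀ := ⌊r⌋₊
  have hr₀r : (r₀ : ℝ) ≤ r := Nat.floor_le (by linarith)
  have hr₀1 : 0 < r₀ := Nat.floor_pos.2 (by linarith)
  have hr₀1' : (1 : ℝ) ≤ r₀ := by exact_mod_cast hr₀1
  have hr₀2 : r ≤ 2 * r₀ := by
    have := (Nat.lt_floor_add_one r).le
    linarith
  have hr₀n : r₀ ≤ n := Nat.floor_le_of_le hrn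
  have hn0 : (0 : ℝ) < n := by linarith
  obtain ⟨M, f, hM, hf⟩ := hzone ι h K hK r₀ hr₀1 hr₀n
  choose m F hm hF1 hF2 hF3 hF4 hF5 using fun i => href ι h hh (f i) (hf.norm_eq i) (n / r)
    (by positivity)
  set G : (Σ i, Fin (m i)) → Fin (d + 1) → Pt d × ℝ := fun s => F s.1 s.2 with hG
  set J := {s : Σ i, Fin (m i) // (interior (poly (G s))).Nonempty}
  set e := Fintype.equivFin J
  have hdisj : ∀ s t : Σ i, Fin (m i), s ≠ t →
      ∀ x ∈ interior (poly (G s)), x ∉ interior (poly (G t)) := by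
    rintro ⟨i, k⟩ ⟨j, l⟩ hst x hx hx'
    by_cases hij : i = j
    · subst hij
      exact hF2 i k l (fun hkl => hst (by rw [hkl])) x hx hx'
    · exact hf.disjoint i j hij x (hF3 i k hx) (hF3 j l hx')
  set E : ℝ := r₀ ^ (d - 1) * Λ (r₀ + p)
  have hΛ : Λ (r₀ + p) ≤ (3 + p) * Real.logb 2 r := Λ_add_le_logb p hr₀1 hr₀r hr2
  have hΛ0 : 0 ≤ Λ (r₀ + p) := zero_le_one.trans (one_le_Λ _)
  have hE0 : 0 ≤ E := by positivity
  have hE : E ≤ r ^ (d - 1) * ((3 + p) * Real.logb 2 r) := by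
    simp only [E]
    gcongr
  refine ⟨Fintype.card J, fun i => G (e.symm i).1, ?_, fun i k => hF1 _ _ _,
    fun i j hij => hdisj _ _ fun h0 => hij (e.symm.injective (Subtype.ext h0)),
    fun i => (e.symm i).2, fun z hz => ?_, fun i => hF5 _ _⟩
  · have h1 : (Fintype.card J : ℝ) ≤ ∑ i, (m i : ℝ) := by
      have := Fintype.card_subtype_le fun s : Σ i, Fin (m i) => (interior (poly (G s))).Nonempty
      rw [Fintype.card_sigma] at this
      simp only [Fintype.card_fin] at this
      exact_mod_cast this
    set g : Fin M → ℕ := fun i => (crossing h univ (interior (poly (f i)))).card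
    have h2 : ∑ i, (g i : ℝ) ^ p ≤ A * (C₁ * (n / r₀) ^ p * E + C₁ * E) := by
      calc ∑ i, (g i : ℝ) ^ p ≤ ∑ i, A * (((g i).choose p : ℝ) + 1) :=
            sum_le_sum fun i _ => hA (g i)
        _ = A * (∑ i, ((g i).choose p : ℝ) + M) := by
            rw [← mul_sum, sum_add_distrib]
            simp
        _ ≤ _ := by
            gcongr
            exact hf.moment.trans (le_of_eq (by ring))
    have h3 : ((n : ℝ) / r₀) ^ p * (r / n) ^ p ≤ 2 ^ p := by
      rw [← mul_pow, div_mul_div_cancel₀' hn0.ne']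
      gcongr
      rw [div_le_iff₀ (by linarith)]
      exact hr₀2
    have h4 : (r / n) ^ p ≤ 1 := pow_le_one₀ (by positivity) ((div_le_one hn0).2 hrn)
    calc (Fintype.card J : ℝ) ≤ ∑ i, (m i : ℝ) := h1
      _ ≤ ∑ i, C₂ * (1 + ((g i : ℝ) / (n / r)) ^ p) := sum_le_sum fun i _ => hm i
      _ = C₂ * (M + (∑ i, (g i : ℝ) ^ p) * (r / n) ^ p) := by
        rw [← mul_sum, sum_add_distrib, sum_mul]
        simp [div_div_eq_mul_div, mul_div_assoc, mul_pow]
      _ ≤ C₂ * (C₁ * E + (A * (C₁ * (n / r₀) ^ p * E + C₁ * E)) * (r / n) ^ p) := by gcongr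
      _ = C₂ * (C₁ * E + A * C₁ * E * ((n / r₀) ^ p * (r / n) ^ p + (r / n) ^ p)) := by ring
      _ ≤ C₂ * (C₁ * E + A * C₁ * E * (2 ^ p + 1)) := by gcongr
      _ = C₂ * (C₁ + A * C₁ * (2 ^ p + 1)) * E := by ring
      _ ≤ C₂ * (C₁ + A * C₁ * (2 ^ p + 1)) * (r ^ (d - 1) * ((3 + p) * Real.logb 2 r)) := by
        gcongr
      _ = _ := by ring
  · by_contra hz'
    have hcell : cellOf h z ⊆ ⋃ i, poly (f i) := fun y hy => hf.cover
      ⟨ev_ne_zero_of_mem_cellOf hy, by rw [cellOf_eq_of_mem hy]; exact hz.2⟩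
    set O := cellOf h z \ ⋃ i, poly (G (e.symm i).1)
    have hO : IsOpen O := (isOpen_cellOf h z).sdiff
      (isClosed_iUnion_of_finite fun i => poly_closed _)
    obtain ⟨i, hi⟩ := exists_interior_inter (fun i => poly_closed (f i)) hO
      ⟨z, mem_cellOf_self hz.1, hz'⟩ (Set.sdiff_subset.trans hcell)
    obtain ⟨k, w, hw, -, hwO⟩ := exists_interior_inter (fun k => poly_closed (F i k))
      (isOpen_interior.inter hO) hi (Set.inter_subset_left.trans (hF4 i))
    refine hwO.2 (Set.mem_iUnion.2 ⟨e ⟨⟨i, k⟩, w, hw⟩, ?_⟩)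
    rw [e.symm_apply_apply]
    exact interior_subset hw

/-! ### Connected components of the complement of an arrangement -/

lemma convex_cellOf {κ : Type*} (h : κ → Pt d × ℝ) (z : Pt d) : Convex ℝ (cellOf h z) := by
  intro x hx y hy a b ha hb hab i
  have h1 : ev h i (a • x + b • y) = a * ev h i x + b * ev h i y := by
    have h3 : (h i).2 = a * (h i).2 + b * (h i).2 := by rw [← add_mul, hab, one_mul]
    simp only [ev, inner_add_left, real_inner_smul_left]
    linarith
  rw [h1]
  have := hx i
  have := hy i
  rcases ha.eq_or_lt with rfl | ha
  · obtain rfl : b = 1 := by linarith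
    simpa
  · calc 0 < a * (ev h i z * ev h i x) + b * (ev h i z * ev h i y) := by positivity
      _ = _ := by ring

lemma connectedComponentIn_eq_cellOf {κ : Type*} {h : κ → Pt d × ℝ} {S : Set (Pt d)}
    (hS : ∀ y, y ∈ S ↔ ∀ i, ev h i y ≠ 0) {x : Pt d} (hx : x ∈ S) :
    connectedComponentIn S x = cellOf h x := by
  have hx0 := (hS x).1 hx
  refine subset_antisymm (fun y hy i => ?_) ?_
  · have hc : IsPreconnected ((fun y => ev h i x * ev h i y) '' connectedComponentIn S x) :=
      isPreconnected_connectedComponentIn.image _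
        (continuous_const.mul (continuous_ev h i)).continuousOn
    by_contra hneg
    obtain ⟨w, hw, hw0⟩ := hc.ordConnected.out (Set.mem_image_of_mem _ hy)
      (Set.mem_image_of_mem _ (mem_connectedComponentIn hx))
      ⟨not_lt.1 hneg, (mul_self_pos.2 (hx0 i)).le⟩
    exact (mul_ne_zero (hx0 i) ((hS w).1 (connectedComponentIn_subset _ _ hw) i)) hw0
  · exact (convex_cellOf h x).isPreconnected.subset_connectedComponentIn (mem_cellOf_self hx0)
      fun y hy => (hS y).2 fun i => ev_ne_zero_of_mem_cellOf hy i

lemma poly_eq_iInter_halfspace {q : Fin (d + 1) → Pt d × ℝ} (hne : (poly q).Nonempty) :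
    poly q = ⋂ k ∈ (univ.image q).filter (fun k => k.1 ≠ 0), halfspace k.1 k.2 := by
  obtain ⟨w, hw⟩ := hne
  ext x
  simp only [poly, halfspace, Set.mem_iInter, Set.mem_ofPred_eq, mem_filter, mem_image, mem_univ,
    true_and]
  refine ⟨?_, fun hx k => ?_⟩
  · rintro hx _ ⟨⟨k, rfl⟩, -⟩
    exact hx k
  · by_cases h0 : (q k).1 = 0
    · have := hw k
      rwa [h0, inner_zero_right] at this ⊢
    · exact hx _ ⟨⟨k, rfl⟩, h0⟩

end

end ZoneCutting

/-- Theorem 3.1, Cutting Lemma for the zone of a convex set, `d ≥ 3`. -/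
theorem cutting_lemma_zone_of_convex_set (d : ℕ) (hd : 3 ≤ d) :
    ∃ C : ℝ, 0 < C ∧
      ∀ (H : Finset (EuclideanSpace ℝ (Fin d) × ℝ)), (∀ h ∈ H, h.1 ≠ 0) →
      ∀ n : ℕ, H.card = n →
      ∀ r : ℝ, 2 ≤ r → r ≤ n →
      ∀ K₀ : Set (EuclideanSpace ℝ (Fin d)), Convex ℝ K₀ →
      ∃ (m : ℕ) (Δ : Fin m → Set (EuclideanSpace ℝ (Fin d))),
        (m : ℝ) ≤ C * r ^ (d - 1) * Real.logb 2 r ∧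
        (∀ i, ∃ s : Finset (EuclideanSpace ℝ (Fin d) × ℝ),
          s.card ≤ d + 1 ∧ (∀ p ∈ s, p.1 ≠ 0) ∧
          Δ i = (⋂ p ∈ s, halfspace p.1 p.2) ∧ (Δ i).Nonempty) ∧
        (∀ i j, i ≠ j → interior (Δ i) ∩ interior (Δ j) = ∅) ∧
        (∀ x ∉ ⋃ h ∈ H, hyperplane h.1 h.2,
          (closure (connectedComponentIn (⋃ h ∈ H, hyperplane h.1 h.2)ᶜ x) ∩
              frontier K₀).Nonempty →
            connectedComponentIn (⋃ h ∈ H, hyperplane h.1 h.2)ᶜ x ⊆ ⋃ i, Δ i) ∧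
        (∀ i, ((H.filter (fun h => (hyperplane h.1 h.2 ∩ interior (Δ i)).Nonempty)).card : ℝ)
            ≤ (n : ℝ) / r) := by
  obtain ⟨C, hC, hcut⟩ := ZoneCutting.exists_zone_cutting hd
  refine ⟨C + 1, by positivity, fun H hH n hn r hr2 hrn K₀ hK => ?_⟩
  set h : {h // h ∈ H} → EuclideanSpace ℝ (Fin d) × ℝ := fun i => i.1 with hh
  have hcard : Fintype.card {h // h ∈ H} = n := by rw [Fintype.card_coe, hn]
  obtain ⟨M, f, hM, hf1, hf2, hf3, hf4, hf5⟩ := hcut {h // h ∈ H} h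
    (fun i h0 => hH i.1 i.2 (congrArg Prod.fst h0)) K₀ hK r hr2 (by rwa [hcard])
  refine ⟨M, fun i => ZoneCutting.poly (f i), ?_, fun i => ?_, fun i j hij => ?_,
    fun x hx hne => ?_, fun i => ?_⟩
  · have h0 : 0 ≤ r ^ (d - 1) * Real.logb 2 r :=
      mul_nonneg (by positivity) (Real.logb_nonneg one_lt_two (by linarith))
    calc (M : ℝ) ≤ C * (r ^ (d - 1) * Real.logb 2 r) := hM
      _ ≤ (C + 1) * (r ^ (d - 1) * Real.logb 2 r) := by gcongr; linarith
      _ = _ := (mul_assoc _ _ _).symm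
  · have hne := (hf3 i).mono interior_subset
    refine ⟨_, ?_, ?_, ZoneCutting.poly_eq_iInter_halfspace hne, hne⟩
    · exact (Finset.card_filter_le _ _).trans (Finset.card_image_le.trans (by simp))
    · exact fun p hp => (Finset.mem_filter.1 hp).2
  · exact Set.eq_empty_of_forall_notMem fun x hx => hf2 i j hij x hx.1 hx.2
  · have hS : ∀ y, y ∈ (⋃ h ∈ H, hyperplane h.1 h.2)ᶜ ↔ ∀ i, ZoneCutting.ev h i y ≠ 0 := by
      simp [hyperplane, ZoneCutting.ev, hh, sub_eq_zero]
    rw [ZoneCutting.connectedComponentIn_eq_cellOf hS hx] at hne ⊢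
    refine fun y hy => hf4 ⟨ZoneCutting.ev_ne_zero_of_mem_cellOf hy, ?_⟩
    rwa [ZoneCutting.cellOf_eq_of_mem hy]
  · rw [← hcard]
    refine le_trans ?_ (hf5 i)
    rw [← Finset.card_map (Function.Embedding.subtype _)
      (s := ZoneCutting.crossing h Finset.univ _)]
    refine Nat.cast_le.2 (Finset.card_le_card fun p hp => ?_)
    obtain ⟨hpH, z, hz, hzi⟩ := Finset.mem_filter.1 hp
    exact Finset.mem_map.2 ⟨⟨p, hpH⟩, ZoneCutting.mem_crossing_of_isOpen isOpen_interior hzi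
      (sub_eq_zero.2 hz) (hH p hpH), rfl⟩
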